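/- Let n ≥ 2, β ≥ 0, C₀ > 1 and let χ be a cutoff. Assume α satisfies one of: (i) (n−3)/2 < β < (n−1)/2 and α < 2β − (n−3)/2; or (ii) β ≥ (n−1)/2 and α < β + 1. Then there exists a constant C > 0 such that for every θ ∈ S^{n−1} and every Schwartz function q on ℝⁿ: for every η ∈ H_θ the principal value P_θ(q)(η) := lim_{δ→0⁺} ∫_{{r > 0 : |1−r| > δ}} S_{θ,r}(q)(η)/(1−r) dr exists, and, setting P̃_θ(q)(η) := χ(η) P_θ(q)(η) for η ∈ H_θ and := 0 otherwise, one has ‖P̃_θ(q)‖_{L²_α} ≤ C ‖q‖²_{W^{β,2}_2}. -/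

import Mathlib

open MeasureTheory Real Filter Set Metric
open scoped FourierTransform RealInnerProductSpace SchwartzMap ENNReal

noncomputable section

abbrev En (n : ℕ) := EuclideanSpace ℝ (Fin n)

/-- Japanese bracket `⟨x⟩ = (1+|x|²)^{1/2}`. -/
def jap {n : ℕ} (x : En n) : ℝ := Real.sqrt (1 + ‖x‖ ^ 2)

/-- `k(η,θ) = -|η|²/(θ·η)`. -/
def kval {n : ℕ} (θ η : En n) : ℝ := -‖η‖ ^ 2 / ⟪θ, η⟫

/-- The Ewald sphere `Γ_r(-2kθ)`, of center `-kθ` and radius `rk`. -/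
def ewald {n : ℕ} (θ η : En n) (r : ℝ) : Set (En n) :=
  Metric.sphere (-(kval θ η • θ)) (r * kval θ η)

/-- The spherical operator `S_{θ,r}`. -/
def Sop {n : ℕ} (θ : En n) (r : ℝ) (q : En n → ℂ) (η : En n) : ℂ :=
  if ⟪η, θ⟫ < 0 then
    ((kval θ η * (r + 1))⁻¹ : ℝ) •
      ∫ ξ in ewald θ η r, 𝓕 q ξ * 𝓕 q (η - ξ) ∂μH[(n : ℝ) - 1]
  else 0

/-- The operator `K_r(g₁,g₂)`. -/
def Kop {n : ℕ} {G₁ G₂ : Type*} [NormedAddCommGroup G₁] [NormedAddCommGroup G₂]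
    (θ : En n) (r : ℝ) (g₁ : En n → G₁) (g₂ : En n → G₂) (η : En n) : ℝ :=
  if ⟪η, θ⟫ < 0 then
    (kval θ η)⁻¹ * ∫ ξ in ewald θ η r, ‖g₁ ξ‖ * ‖g₂ (η - ξ)‖ ∂μH[(n : ℝ) - 1]
  else 0

/-- Weighted norm `‖F‖_{L²_α}`. -/
def L2w {n : ℕ} {G : Type*} [NormedAddCommGroup G] (α : ℝ) (F : En n → G) : ℝ :=
  (∫ η, jap η ^ (2 * α) * ‖F η‖ ^ 2) ^ (1/2 : ℝ)

/-- Weighted Sobolev norm `‖q‖_{W^{β,2}_δ} = ‖⟨·⟩^δ 𝓕⁻¹(⟨·⟩^β 𝓕q)‖_{L²}`. -/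
def sobNorm {n : ℕ} (β δ : ℝ) (q : En n → ℂ) : ℝ :=
  (∫ x, jap x ^ (2 * δ) * ‖𝓕⁻ (fun ξ => (jap ξ ^ β : ℝ) • 𝓕 q ξ) x‖ ^ 2) ^ (1/2 : ℝ)

/-- A smooth radial cutoff vanishing for `|ξ| < C₀` and equal to `1` for `|ξ| > 2C₀`. -/
structure IsCutoff {n : ℕ} (C₀ : ℝ) (χ : En n → ℝ) : Prop where
  smooth : ContDiff ℝ (⊤ : ℕ∞) χ
  mem_Icc : ∀ ξ, χ ξ ∈ Set.Icc (0 : ℝ) 1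
  eq_one : ∀ ξ : En n, 2 * C₀ < ‖ξ‖ → χ ξ = 1
  eq_zero : ∀ ξ : En n, ‖ξ‖ < C₀ → χ ξ = 0


section PartA
open scoped Pointwise
lemma normalize_lip {E : Type*} [NormedAddCommGroup E] [NormedSpace ℝ E] (x y : E)
    (hx : 1 ≤ ‖x‖) (hy : 1 ≤ ‖y‖) :
    ‖‖x‖⁻¹ • x - ‖y‖⁻¹ • y‖ ≤ 2 * ‖x - y‖ := by
  have hx0 : 0 < ‖x‖ := by linarith
  have hy0 : 0 < ‖y‖ := by linarith
  have e : ‖x‖⁻¹ • x - ‖y‖⁻¹ • y = ‖x‖⁻¹ • (x - y) + (‖x‖⁻¹ - ‖y‖⁻¹) • y := by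
    rw [smul_sub, sub_smul]; abel
  rw [e]
  refine (norm_add_le _ _).trans ?_
  rw [norm_smul, norm_smul, norm_inv, norm_norm]
  have h1 : ‖x‖⁻¹ ≤ 1 := inv_le_one_of_one_le₀ hx
  have h2 : ‖(‖x‖⁻¹ - ‖y‖⁻¹)‖ * ‖y‖ ≤ ‖x - y‖ := by
    have : ‖x‖⁻¹ - ‖y‖⁻¹ = ‖x‖⁻¹ * ((‖y‖ - ‖x‖) * ‖y‖⁻¹) := by field_simp
    rw [this, norm_mul, norm_mul, norm_inv, norm_inv, norm_norm, norm_norm, Real.norm_eq_abs]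
    have h3 : |‖y‖ - ‖x‖| ≤ ‖x - y‖ := by rw [abs_sub_comm]; exact abs_norm_sub_norm_le x y
    have : ‖x‖⁻¹ * (|‖y‖ - ‖x‖| * ‖y‖⁻¹) * ‖y‖ = ‖x‖⁻¹ * |‖y‖ - ‖x‖| := by field_simp
    rw [this]
    calc ‖x‖⁻¹ * |‖y‖ - ‖x‖| ≤ 1 * ‖x - y‖ := by gcongr
      _ = _ := one_mul _
  have h4 : ‖x‖⁻¹ * ‖x - y‖ ≤ 1 * ‖x - y‖ := by gcongr
  linarith

/-- insertion of a coordinate into a Euclidean vector -/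
def insE {m : ℕ} (i : Fin (m+1)) (s : ℝ) (z : Fin m → ℝ) : En (m+1) :=
  WithLp.toLp 2 (i.insertNth (α := fun _ => ℝ) s z)

lemma insE_same {m : ℕ} (i : Fin (m+1)) (s : ℝ) (z : Fin m → ℝ) : insE i s z i = s := by
  simp [insE]
lemma insE_succAbove {m : ℕ} (i : Fin (m+1)) (s : ℝ) (z : Fin m → ℝ) (j : Fin m) :
    insE i s z (i.succAbove j) = z j := by
  simp [insE]

lemma insE_ext {m : ℕ} (i : Fin (m+1)) (x y : En (m+1)) (h : x i = y i)
    (h' : ∀ j, x (i.succAbove j) = y (i.succAbove j)) : x = y := by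
  ext j
  rcases Fin.eq_self_or_eq_succAbove i j with rfl | ⟨j', rfl⟩
  · exact h
  · exact h' j'

lemma insE_norm_sq {m : ℕ} (i : Fin (m+1)) (s : ℝ) (z : Fin m → ℝ) :
    ‖insE i s z‖ ^ 2 = s ^ 2 + ∑ j, (z j) ^ 2 := by
  rw [EuclideanSpace.norm_sq_eq, Fin.sum_univ_succAbove _ i]
  simp [insE_same, insE_succAbove]

lemma insE_mp {m : ℕ} (i : Fin (m+1)) :
    ∃ e : (ℝ × (Fin m → ℝ)) ≃ᵐ En (m+1), MeasurePreserving e volume volume ∧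
      ∀ p, e p = insE i p.1 p.2 := by
  refine ⟨(MeasurableEquiv.piFinSuccAbove (fun _ => ℝ) i).symm.trans
    (MeasurableEquiv.toLp 2 (Fin (m+1) → ℝ)), ?_, fun p => rfl⟩
  exact (PiLp.volume_preserving_toLp _).comp
    ((volume_preserving_piFinSuccAbove (fun _ => ℝ) i).symm)

lemma chart_dom (m : ℕ) (i : Fin (m+1)) (e : ℝ) (he : e = 1 ∨ e = -1) :
    ∃ K : ℝ≥0∞, K ≠ ⊤ ∧ ∀ A : Set (En (m+1)), MeasurableSet A → A ⊆ sphere 0 1 →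
      (∀ x ∈ A, (√(m+1:ℝ))⁻¹ ≤ e * x i) → μH[(m:ℝ)] A ≤ K * volume (Ioo (0:ℝ) 1 • A) := by
  set c := (√(m+1:ℝ))⁻¹ with hc
  have hc0 : 0 < c := by positivity
  have hee : e * e = 1 := by rcases he with rfl | rfl <;> norm_num
  have he2 : e ^ 2 = 1 := by rw [pow_two, hee]
  set N : (Fin m → ℝ) → En (m+1) := fun z => ‖insE i e z‖⁻¹ • insE i e z with hN
  have hJ1 : ∀ z, 1 ≤ ‖insE i e z‖ := by
    intro z
    have := insE_norm_sq i e z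
    have h2 : 0 ≤ ∑ j, (z j) ^ 2 := Finset.sum_nonneg (fun _ _ => sq_nonneg _)
    rw [he2] at this
    nlinarith [norm_nonneg (insE i e z)]
  have hlip : LipschitzWith (2 * (m+1)) N := by
    apply LipschitzWith.of_dist_le_mul
    intro z w
    rw [dist_eq_norm, dist_eq_norm]
    refine (normalize_lip _ _ (hJ1 z) (hJ1 w)).trans ?_
    have e1 : insE i e z - insE i e w = insE i 0 (z - w) := by
      apply insE_ext i <;> simp [insE_same, insE_succAbove]
    have h3 : ‖insE i 0 (z - w)‖ ≤ (m+1) * ‖z - w‖ := by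
      refine (sq_le_sq₀ (norm_nonneg _) (by positivity)).1 ?_
      rw [insE_norm_sq]
      calc (0:ℝ)^2 + ∑ j, ((z-w) j)^2 ≤ 0 ^ 2 + ∑ j : Fin m, ‖z-w‖^2 := by
            refine add_le_add le_rfl (Finset.sum_le_sum fun j _ => ?_)
            rw [← sq_abs]
            exact pow_le_pow_left₀ (abs_nonneg _) (norm_le_pi_norm (z-w) j) 2
        _ = m * ‖z-w‖^2 := by simp
        _ ≤ _ := by
            rw [mul_pow]; gcongr; nlinarith [(Nat.cast_nonneg m : (0:ℝ) ≤ m)]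
    rw [e1]
    push_cast
    nlinarith
  refine ⟨((2 * (m+1) : NNReal) : ℝ≥0∞) ^ (m:ℝ) * (ENNReal.ofReal (c/2) * ENNReal.ofReal ((c/2)^m))⁻¹, ?_, ?_⟩
  · apply ENNReal.mul_ne_top
    · exact ENNReal.rpow_ne_top_of_nonneg (by positivity) ENNReal.coe_ne_top
    · rw [ENNReal.inv_ne_top]
      have : 0 < c / 2 := by positivity
      simp; exact ⟨hc0, by positivity⟩
  intro A hA hAS hAc
  set Z := N ⁻¹' A with hZ
  have hZm : MeasurableSet Z := hlip.continuous.measurable hA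
  have h1 : A ⊆ N '' Z := by
    intro x hx
    have hxn : ‖x‖ = 1 := by simpa using hAS hx
    have hxi : 0 < e * x i := hc0.trans_le (hAc x hx)
    have : insE i e (fun j => x (i.succAbove j) / (e * x i)) = (e * x i)⁻¹ • x := by
      apply insE_ext i
      · rw [insE_same]; simp
        have h0 : x i ≠ 0 := by rintro h; simp [h] at hxi
        have h1 : e ≠ 0 := by rintro h; simp [h] at hxi
        field_simp
        rw [he2]
      · intro j; rw [insE_succAbove]; simp; field_simp
    have hNx : N (fun j => x (i.succAbove j) / (e * x i)) = x := by
      simp only [hN]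
      rw [this, norm_smul, hxn, norm_inv, Real.norm_of_nonneg hxi.le, smul_smul, mul_one, inv_inv,
        mul_inv_cancel₀ hxi.ne', one_smul]
    exact ⟨_, by rw [hZ, mem_preimage, hNx]; exact hx, hNx⟩
  have h2 : μH[(m:ℝ)] A ≤ ((2 * (m+1) : NNReal) : ℝ≥0∞) ^ (m:ℝ) * volume Z := by
    refine (measure_mono h1).trans ?_
    refine (hlip.hausdorffMeasure_image_le (by positivity) Z).trans ?_
    have := @hausdorffMeasure_pi_real (Fin m) _
    rw [Fintype.card_fin] at this
    rw [this]
  obtain ⟨eq, hmp, heq⟩ := insE_mp i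
  set Q : Set (ℝ × (Fin m → ℝ)) := {p | (c/2 < e * p.1 ∧ e * p.1 < c) ∧ (e * p.1)⁻¹ • p.2 ∈ Z} with hQ
  have hQm : MeasurableSet Q := by
    have h5 : Measurable (fun p : ℝ × (Fin m → ℝ) => e * p.1) := by fun_prop
    have h6 : Measurable (fun p : ℝ × (Fin m → ℝ) => (e * p.1)⁻¹ • p.2) := by fun_prop
    exact ((h5 measurableSet_Ioi).inter (h5 measurableSet_Iio)).inter (h6 hZm)
  have hQsub : Q ⊆ eq ⁻¹' (Ioo (0:ℝ) 1 • A) := by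
    rintro ⟨s, w⟩ ⟨⟨hs1, hs2⟩, hz⟩
    simp only at hs1 hs2 hz
    rw [mem_preimage, heq]
    set t := e * s with ht
    have ht0 : 0 < t := by linarith [half_pos hc0]
    set z := t⁻¹ • w with hzd
    have e1 : insE i s w = t • insE i e z := by
      apply insE_ext i
      · simp [insE_same, ht]; linear_combination - s * he2
      · intro j; simp [insE_succAbove, hzd]; field_simp
    have hJ0 : 0 < ‖insE i e z‖ := by linarith [hJ1 z]
    have hNi : e * N z i = ‖insE i e z‖⁻¹ := by
      simp [hN, insE_same]; linear_combination ‖insE i e z‖⁻¹ * he2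
    have hle : ‖insE i e z‖ ≤ c⁻¹ := by
      have := hAc _ hz
      rw [hNi] at this
      exact (le_inv_comm₀ hc0 hJ0).mp this
    show insE i s w ∈ _
    rw [e1]
    refine Set.mem_smul.2 ⟨t * ‖insE i e z‖, ⟨by positivity, ?_⟩, N z, hz, ?_⟩
    · calc t * ‖insE i e z‖ ≤ t * c⁻¹ := by gcongr
        _ < c * c⁻¹ := by gcongr
        _ = 1 := mul_inv_cancel₀ hc0.ne'
    · simp only [hN]; rw [smul_smul, mul_assoc, mul_inv_cancel₀ hJ0.ne', mul_one]
  have h3 : volume Q ≤ volume (Ioo (0:ℝ) 1 • A) := by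
    refine (measure_mono hQsub).trans ?_
    rw [hmp.measure_preimage_equiv]
  have h4 : (ENNReal.ofReal (c/2) * ENNReal.ofReal ((c/2)^m)) * volume Z ≤ volume Q := by
    rw [Measure.volume_eq_prod, Measure.prod_apply hQm]
    have hvol : volume {s : ℝ | c/2 < e * s ∧ e * s < c} = ENNReal.ofReal (c/2) := by
      rcases he with rfl | rfl
      · have : {s : ℝ | c/2 < 1 * s ∧ 1 * s < c} = Ioo (c/2) c := by ext; simp
        rw [this, Real.volume_Ioo]; congr 1; ring
      · have : {s : ℝ | c/2 < -1 * s ∧ -1 * s < c} = Ioo (-c) (-(c/2)) := by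
          ext; simp only [Set.mem_ofPred_eq, mem_Ioo]; constructor <;> rintro ⟨a, b⟩ <;> constructor <;> linarith
        rw [this, Real.volume_Ioo]; congr 1; ring
    calc _ = ∫⁻ s in {s : ℝ | c/2 < e * s ∧ e * s < c}, ENNReal.ofReal ((c/2)^m) * volume Z := by
          rw [setLIntegral_const, hvol]; ring
      _ ≤ ∫⁻ s in {s : ℝ | c/2 < e * s ∧ e * s < c}, volume (Prod.mk s ⁻¹' Q) := by
          apply setLIntegral_mono' 
          · have h5 : Measurable (fun s : ℝ => e * s) := by fun_prop
            exact (h5 measurableSet_Ioi).inter (h5 measurableSet_Iio)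
          intro s hs
          have hes : 0 < e * s := by have := hs.1; linarith [half_pos hc0]
          have : Prod.mk s ⁻¹' Q = (e * s) • Z := by
            ext w
            rw [Set.mem_smul_set_iff_inv_smul_mem₀ hes.ne']
            simp only [hQ, mem_preimage, Set.mem_ofPred_eq]
            exact ⟨fun h => h.2, fun h => ⟨hs, h⟩⟩
          rw [this, Measure.addHaar_smul]
          simp only [Module.finrank_fintype_fun_eq_card, Fintype.card_fin, abs_pow, abs_of_pos hes]
          gcongr
          exact hs.1.le
      _ ≤ _ := setLIntegral_le_lintegral _ _
  set κ := (ENNReal.ofReal (c/2) * ENNReal.ofReal ((c/2)^m)) with hκ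
  have hk0 : κ ≠ 0 := by
    have : 0 < c / 2 := by positivity
    simp [hκ]; exact ⟨hc0, by positivity⟩
  have hkt : κ ≠ ⊤ := by simp [hκ]; finiteness
  refine h2.trans ?_
  rw [mul_assoc]
  gcongr
  rw [← ENNReal.div_eq_inv_mul, ENNReal.le_div_iff_mul_le (Or.inl hk0) (Or.inl hkt), mul_comm]
  exact h4.trans h3

lemma sphere_dom (m : ℕ) : ∃ K : ℝ≥0∞, K ≠ ⊤ ∧
    (μH[(m:ℝ)] : Measure (En (m+1))).restrict (sphere (0:En (m+1)) 1) ≤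
      K • ((volume : Measure (En (m+1))).toSphere).map Subtype.val := by
  choose K hK h using fun (p : Fin (m+1) × Bool) =>
    chart_dom m p.1 (if p.2 then 1 else -1) (by split <;> simp)
  refine ⟨∑ p, K p, by simp [hK], ?_⟩
  rw [Measure.le_iff]
  intro B hB
  rw [Measure.restrict_apply hB, Measure.smul_apply, Measure.map_apply measurable_subtype_coe hB,
    Measure.toSphere_apply' _ (measurable_subtype_coe hB)]
  simp only [Subtype.image_preimage_coe]
  have hcov : B ∩ sphere (0:En (m+1)) 1 ⊆ ⋃ p : Fin (m+1) × Bool,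
      ((B ∩ sphere (0:En (m+1)) 1) ∩ {x | (√(m+1:ℝ))⁻¹ ≤ (if p.2 then 1 else -1) * x p.1}) := by
    intro x hx
    have hxn : ‖x‖ = 1 := by simpa using hx.2
    have hs : ∑ j, (x j)^2 = 1 := by
      have := EuclideanSpace.real_norm_sq_eq x
      rw [hxn] at this; linarith
    have : ∃ j, (m+1:ℝ)⁻¹ ≤ (x j)^2 := by
      by_contra! hcon
      have : ∑ j, (x j)^2 < ∑ j : Fin (m+1), (m+1:ℝ)⁻¹ :=
        Finset.sum_lt_sum_of_nonempty (by simp) (fun j _ => hcon j)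
      rw [hs] at this
      simp at this
      rw [mul_inv_cancel₀ (by positivity)] at this
      exact lt_irrefl _ this
    obtain ⟨j, hj⟩ := this
    have hj' : (√(m+1:ℝ))⁻¹ ≤ |x j| := by
      rw [← Real.sqrt_inv]
      apply Real.sqrt_le_iff.2 ⟨abs_nonneg _, by rwa [sq_abs]⟩
    rw [mem_iUnion]
    rcases le_total 0 (x j) with h0 | h0
    · refine ⟨(j, true), hx, ?_⟩
      rw [abs_of_nonneg h0] at hj'; simpa using hj'
    · refine ⟨(j, false), hx, ?_⟩
      rw [abs_of_nonpos h0] at hj'; simpa using hj'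
  refine (measure_mono hcov).trans ((measure_iUnion_le _).trans ?_)
  rw [tsum_fintype]
  have : ∀ p : Fin (m+1) × Bool, μH[(m:ℝ)] ((B ∩ sphere (0:En (m+1)) 1) ∩ {x | (√(m+1:ℝ))⁻¹ ≤ (if p.2 then 1 else -1) * x p.1})
      ≤ K p * volume (Ioo (0:ℝ) 1 • (sphere (0:En (m+1)) 1 ∩ B)) := by
    intro p
    refine (h p _ ?_ ?_ ?_).trans ?_
    · refine (hB.inter isClosed_sphere.measurableSet).inter (measurableSet_le (by fun_prop) ?_)
      fun_prop
    · exact fun x hx => hx.1.2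
    · exact fun x hx => hx.2
    · refine mul_le_mul_right (measure_mono (Set.smul_subset_smul_left ?_)) _
      exact fun x hx => ⟨hx.1.2, hx.1.1⟩
  refine (Finset.sum_le_sum (fun p _ => this p)).trans ?_
  rw [← Finset.sum_mul, smul_eq_mul]
  gcongr
  rw [show Module.finrank ℝ (En (m+1)) = m + 1 by simp]
  apply le_mul_of_one_le_left (by positivity)
  exact_mod_cast Nat.le_add_left 1 m
end PartA

section PartB
open scoped Pointwise

/-- polar measure on the unit sphere, seen in the ambient space -/
def tauS (n : ℕ) : Measure (En n) := ((volume : Measure (En n)).toSphere).map Subtype.val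

/-- Hausdorff measure on the unit sphere -/
def nuS (n : ℕ) : Measure (En n) := (μH[(n:ℝ) - 1] : Measure (En n)).restrict (sphere 0 1)

instance tauS_fin (n : ℕ) : IsFiniteMeasure (tauS n) := by
  unfold tauS; infer_instance

lemma nuS_le (n : ℕ) (hn : 1 ≤ n) : ∃ K : ℝ≥0∞, K ≠ ⊤ ∧ nuS n ≤ K • tauS n := by
  obtain ⟨m, rfl⟩ := Nat.exists_eq_add_of_le' hn
  obtain ⟨K, hK, h⟩ := sphere_dom m
  refine ⟨K, hK, ?_⟩
  have : ((m+1 : ℕ) : ℝ) - 1 = m := by push_cast; ring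
  rw [nuS, this]
  exact h

lemma nuS_fin (n : ℕ) (hn : 1 ≤ n) : IsFiniteMeasure (nuS n) := by
  obtain ⟨K, hK, h⟩ := nuS_le n hn
  constructor
  refine (Measure.le_iff'.1 h univ).trans_lt ?_
  rw [Measure.smul_apply, smul_eq_mul]
  exact ENNReal.mul_lt_top hK.lt_top (measure_lt_top _ _)

lemma tauS_ae (n : ℕ) : ∀ᵐ ω ∂(tauS n), ‖ω‖ = 1 := by
  unfold tauS
  rw [ae_map_iff (measurable_subtype_coe.aemeasurable) (measurableSet_eq_fun (by fun_prop) (by fun_prop))]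
  filter_upwards with x
  exact norm_eq_of_mem_sphere x

lemma nuS_ae (n : ℕ) : ∀ᵐ ω ∂(nuS n), ‖ω‖ = 1 := by
  unfold nuS
  filter_upwards [ae_restrict_mem isClosed_sphere.measurableSet] with x hx
  simpa using hx

lemma ewald_scale (n : ℕ) (hn : 1 ≤ n) (c : En n) (R : ℝ) (hR : 0 < R) (F : En n → ℂ) :
    ∫ ξ in sphere c R, F ξ ∂μH[(n:ℝ) - 1] = R ^ (n-1) • ∫ ω, F (c + R • ω) ∂(nuS n) := by
  have hd : (0:ℝ) ≤ (n:ℝ) - 1 := by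
    have : (1:ℝ) ≤ n := by exact_mod_cast hn
    linarith
  set T : En n ≃ₜ En n := (Homeomorph.smulOfNeZero R hR.ne').trans (Homeomorph.addLeft c) with hT
  have hTa : ∀ x, T x = c + R • x := fun x => rfl
  have hpre : T ⁻¹' (sphere c R) = sphere 0 1 := by
    ext x
    simp only [mem_preimage, hTa, mem_sphere_iff_norm, add_sub_cancel_left, sub_zero, norm_smul, Real.norm_of_nonneg hR.le]
    constructor
    · intro h; nlinarith
    · intro h; rw [h, mul_one]
  have hmap : Measure.map T (μH[(n:ℝ) - 1] : Measure (En n)) = (ENNReal.ofReal (R ^ (n-1)))⁻¹ • μH[(n:ℝ) - 1] := by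
    ext s hs
    rw [Measure.map_apply T.continuous.measurable hs, Measure.smul_apply, smul_eq_mul]
    have e1 : T '' (T ⁻¹' s) = s := T.image_preimage s
    have e2 : μH[(n:ℝ)-1] s = ENNReal.ofReal (R ^ (n-1)) * μH[(n:ℝ)-1] (T ⁻¹' s) := by
      have e3 : s = (IsometryEquiv.addLeft c) '' (R • (T ⁻¹' s)) := by
        conv_lhs => rw [← e1]
        rw [← Set.image_smul, Set.image_image]
        rfl
      conv_lhs => rw [e3]
      rw [IsometryEquiv.hausdorffMeasure_image, Measure.hausdorffMeasure_smul₀ hd hR.ne']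
      rw [ENNReal.smul_def, smul_eq_mul]
      congr 1
      rw [← Nat.cast_one (R := ℝ), ← Nat.cast_sub hn, NNReal.rpow_natCast, ENNReal.ofReal, Real.toNNReal_pow hR.le,
        Real.nnnorm_of_nonneg hR.le]
      congr 2
      exact (Real.toNNReal_of_nonneg hR.le).symm
    rw [e2, ← mul_assoc, ENNReal.inv_mul_cancel, one_mul]
    · simp; positivity
    · simp
  have h1 : ∫ ω, F (c + R • ω) ∂(nuS n) = ∫ ξ in sphere c R, F ξ ∂(Measure.map T (μH[(n:ℝ) - 1] : Measure (En n))) := by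
    rw [← T.toMeasurableEquiv_coe, MeasurableEquiv.restrict_map, MeasureTheory.integral_map_equiv]
    simp only [Homeomorph.toMeasurableEquiv_coe, hpre, hTa]
    rfl
  rw [h1, hmap, Measure.restrict_smul, integral_smul_measure, smul_smul]
  rw [ENNReal.toReal_inv, ENNReal.toReal_ofReal (by positivity), mul_inv_cancel₀ (by positivity), one_smul]

lemma polar (n : ℕ) (hn : 1 ≤ n) (c : En n) (H : En n → ℝ≥0∞) (hH : Measurable H) :
    ∫⁻ ζ, H ζ = ∫⁻ ω, (∫⁻ r in Ioi (0:ℝ), ENNReal.ofReal (r^(n-1)) * H (c + r • ω)) ∂(tauS n) := by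
  have : Nonempty (Fin n) := ⟨⟨0, hn⟩⟩
  have hfr : Module.finrank ℝ (En n) = n := by simp
  have hHc : Measurable (fun ζ => H (c + ζ)) := hH.comp (measurable_const_add c)
  rw [← lintegral_add_left_eq_self H c]
  have h0 : ∫⁻ ζ, H (c + ζ) = ∫⁻ ζ : ({0}ᶜ : Set (En n)), H (c + ζ) ∂(Measure.comap Subtype.val volume) := by
    rw [lintegral_subtype_comap (measurableSet_singleton _).compl (fun ζ => H (c + ζ)), restrict_compl_singleton]
  have hmp := (volume : Measure (En n)).measurePreserving_homeomorphUnitSphereProd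
  have h1 : ∫⁻ ζ : ({0}ᶜ : Set (En n)), H (c + ζ) ∂(Measure.comap Subtype.val volume)
      = ∫⁻ p : (sphere (0:En n) 1) × (Ioi (0:ℝ)), H (c + p.2.1 • p.1.1) ∂((volume : Measure (En n)).toSphere.prod (Measure.volumeIoiPow (Module.finrank ℝ (En n) - 1))) := by
    rw [← hmp.lintegral_comp]
    · apply lintegral_congr
      intro ζ
      have : ‖(ζ:En n)‖ ≠ 0 := norm_ne_zero_iff.2 ζ.2
      simp [homeomorphUnitSphereProd, homeomorphSphereProd, smul_smul, this]
    · exact hH.comp (by fun_prop)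
  have hm2 : Measurable (fun p : En n × ℝ => ENNReal.ofReal (p.2^(n-1)) * H (c + p.2 • p.1)) := by
    apply Measurable.mul (by fun_prop)
    exact hH.comp (by fun_prop)
  have hm3 : Measurable (fun p : (sphere (0:En n) 1) × (Ioi (0:ℝ)) => H (c + p.2.1 • p.1.1)) :=
    hH.comp (by fun_prop)
  rw [h0, h1, lintegral_prod _ hm3.aemeasurable, tauS, lintegral_map _ measurable_subtype_coe]
  · apply lintegral_congr
    intro ω
    have hm4 : Measurable (fun p : (Ioi (0:ℝ)) => H (c + p.1 • ω.1)) := hH.comp (by fun_prop)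
    rw [hfr, Measure.volumeIoiPow, lintegral_withDensity_eq_lintegral_mul _ (by fun_prop) hm4]
    simp only [Pi.mul_apply]
    exact lintegral_subtype_comap measurableSet_Ioi (fun r : ℝ => ENNReal.ofReal (r^(n-1)) * H (c + r • (ω:En n)))
  · exact hm2.lintegral_prod_right'

lemma lintegral_Ioi_scale (k : ℝ) (hk : 0 < k) (h : ℝ → ℝ≥0∞) :
    ∫⁻ r in Ioi (0:ℝ), h r = ∫⁻ r in Ioi (0:ℝ), ENNReal.ofReal k * h (r * k) := by
  have h1 := Real.smul_map_volume_mul_right hk.ne'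
  conv_lhs => rw [← h1]
  rw [Measure.restrict_smul, lintegral_smul_measure]
  have e := (Homeomorph.mulRight₀ k hk.ne').toMeasurableEquiv
  rw [show (fun x : ℝ => x * k) = (Homeomorph.mulRight₀ k hk.ne').toMeasurableEquiv from rfl]
  rw [MeasurableEquiv.restrict_map, lintegral_map_equiv, lintegral_const_mul' _ _ (by simp), abs_of_pos hk]
  have : (Homeomorph.mulRight₀ k hk.ne').toMeasurableEquiv ⁻¹' (Ioi (0:ℝ)) = Ioi 0 := by
    ext x; simp [hk]
  rw [this]
  simp

lemma polar_scaled (n : ℕ) (hn : 1 ≤ n) (c : En n) (k : ℝ) (hk : 0 < k) (H : En n → ℝ≥0∞) (hH : Measurable H) :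
    ∫⁻ ζ, H ζ = ∫⁻ ω, (∫⁻ r in Ioi (0:ℝ), ENNReal.ofReal (k * (r * k)^(n-1)) * H (c + (r * k) • ω)) ∂(tauS n) := by
  rw [polar n hn c H hH]
  apply lintegral_congr
  intro ω
  rw [lintegral_Ioi_scale k hk]
  apply lintegral_congr
  intro r
  rw [ENNReal.ofReal_mul hk.le, mul_assoc]

end PartB

section PartC
open scoped Topology

lemma pv_ibp (G G' : ℝ → ℂ) (δ a b : ℝ) (hδ : 0 < δ) (hab : a ≤ b)
    (hne : ∀ r ∈ Icc a b, r ≠ 1)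
    (hd : ∀ r ∈ Icc a b, HasDerivAt G (G' r) r) (hc : ContinuousOn G' (Icc a b)) :
    ∫ r in a..b, ((1 - r)⁻¹ : ℝ) • G r =
      (∫ r in a..b, G' r * (Real.log ((r - 1)/δ) : ℂ))
        - (G b * (Real.log ((b - 1)/δ) : ℂ) - G a * (Real.log ((a - 1)/δ) : ℂ)) := by
  have hu : uIcc a b = Icc a b := uIcc_of_le hab
  have hcinv : ContinuousOn (fun r : ℝ => (((r - 1)⁻¹ : ℝ) : ℂ)) (uIcc a b) := by
    rw [hu]
    apply Complex.continuous_ofReal.comp_continuousOn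
    apply ContinuousOn.inv₀ (by fun_prop)
    intro r hr
    exact sub_ne_zero.2 (hne r hr)
  have h := intervalIntegral.integral_mul_deriv_eq_deriv_mul (a := a) (b := b) (u := G) (u' := G')
    (v := fun r => ((Real.log ((r - 1)/δ) : ℝ) : ℂ)) (v' := fun r => (((r - 1)⁻¹ : ℝ) : ℂ))
    (by rw [hu]; exact hd) ?_ ?_ hcinv.intervalIntegrable
  · have e : ∫ r in a..b, ((1 - r)⁻¹ : ℝ) • G r = - ∫ r in a..b, G r * (((r - 1)⁻¹ : ℝ) : ℂ) := by
      rw [← intervalIntegral.integral_neg]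
      apply intervalIntegral.integral_congr
      intro r _
      simp only [Complex.real_smul]
      rw [show (1 - r)⁻¹ = - (r - 1)⁻¹ by rw [← neg_sub r 1, inv_neg]]
      push_cast; ring
    rw [e, h]; ring
  · intro r hr
    rw [hu] at hr
    have h1 : r - 1 ≠ 0 := sub_ne_zero.2 (hne r hr)
    have h2 : HasDerivAt (fun r : ℝ => Real.log ((r - 1)/δ)) ((r-1)⁻¹) r := by
      have := (((hasDerivAt_id r).sub_const 1).div_const δ).log (by simp; exact ⟨h1, hδ.ne'⟩)
      have e : 1/δ/((r-1)/δ) = (r-1)⁻¹ := by field_simp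
      rw [← e]; exact this
    exact h2.ofReal_comp
  · apply ContinuousOn.intervalIntegrable; rwa [hu]

lemma log_int (δ a b : ℝ) (hδ : 0 < δ) :
    IntervalIntegrable (fun r => ((Real.log ((r - 1)/δ) : ℝ) : ℂ)) volume a b := by
  suffices H : IntervalIntegrable (fun r => Real.log ((r - 1)/δ)) volume a b from
    ⟨H.1.ofReal, H.2.ofReal⟩
  have h1 : IntervalIntegrable Real.log volume ((a-1)/δ) ((b-1)/δ) :=
    intervalIntegral.intervalIntegrable_log'
  have h2 := (h1.comp_mul_left (c := δ⁻¹))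
  have h3 := h2.comp_sub_right 1
  convert h3 using 1
  · ext r; rw [div_eq_inv_mul]
  · field_simp; ring
  · field_simp; ring

lemma pv1d (G G' : ℝ → ℂ) (δ : ℝ) (hδ : 0 < δ) (hδ1 : δ < 1)
    (hd : ∀ r ∈ Ioi (0:ℝ), HasDerivAt G (G' r) r) (hc : ContinuousOn G' (Ioi 0))
    (hi : IntegrableOn G (Ioi 0)) :
    ∃ P : ℂ, Tendsto (fun d : ℝ => ∫ r in {r : ℝ | 0 < r ∧ d < |1 - r|}, ((1 - r)⁻¹ : ℝ) • G r)
        (nhdsWithin 0 (Set.Ioi 0)) (nhds P) ∧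
      ‖P‖ₑ ≤ (∫⁻ r in {r : ℝ | |1 - r| < δ}, ‖G' r‖ₑ * ENNReal.ofReal (Real.log (δ / |1 - r|)))
        + ∫⁻ r in {r : ℝ | 0 < r ∧ δ ≤ |1 - r|}, ‖G r‖ₑ * ENNReal.ofReal (|1 - r|⁻¹) := by
  set LG : ℝ → ℂ := fun r => G' r * (Real.log ((r - 1)/δ) : ℂ) with hLG
  set far : Set ℝ := {r : ℝ | 0 < r ∧ δ ≤ |1 - r|} with hfar
  have hfarm : MeasurableSet far := by
    apply MeasurableSet.inter measurableSet_Ioi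
    have : Measurable (fun r : ℝ => |1 - r|) := by fun_prop
    exact this measurableSet_Ici
  set Pf : ℂ := ∫ r in far, ((1 - r)⁻¹ : ℝ) • G r with hPf
  have hIcc : Icc (1-δ) (1+δ) ⊆ Ioi (0:ℝ) := fun r hr => by
    have := hr.1; simp only [mem_Ioi]; linarith
  have hLGi : IntervalIntegrable LG volume (1-δ) (1+δ) := by
    apply (log_int δ _ _ hδ).continuousOn_mul
    rw [uIcc_of_le (by linarith)]
    exact hc.mono hIcc
  have hLGi1 : IntegrableOn LG (Icc (1-δ) (1+δ)) := by
    rwa [intervalIntegrable_iff_integrableOn_Icc_of_le (by linarith)] at hLGi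
  have hfari : IntegrableOn (fun r => ((1 - r)⁻¹ : ℝ) • G r) far := by
    have h1 : IntegrableOn G far := hi.mono_set (fun r hr => hr.1)
    refine Integrable.mono' (h1.norm.const_mul δ⁻¹) ?_ ?_
    · refine AEStronglyMeasurable.smul (f := fun r : ℝ => (1 - r)⁻¹) ?_ h1.aestronglyMeasurable
      exact (by fun_prop : Measurable fun r : ℝ => (1 - r)⁻¹).aestronglyMeasurable
    · filter_upwards [ae_restrict_mem hfarm] with r hr
      rw [norm_smul, norm_inv, Real.norm_eq_abs]
      gcongr
      exact hr.2
  refine ⟨Pf + (∫ r in (1-δ)..(1+δ), LG r), ?_, ?_⟩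
  · -- the limit
    have key : ∀ᶠ d in 𝓝[>] (0:ℝ), 
        (Pf + ((∫ r in (1-δ)..(1-d), LG r) + ∫ r in (1+d)..(1+δ), LG r)
          + (G (1+d) - G (1-d)) * (Real.log (d/δ) : ℂ)) =
        ∫ r in {r : ℝ | 0 < r ∧ d < |1 - r|}, ((1 - r)⁻¹ : ℝ) • G r := by
      filter_upwards [Ioo_mem_nhdsGT hδ] with d hd'
      obtain ⟨hd0, hdδ⟩ := hd'
      have i1 := pv_ibp G G' δ (1-δ) (1-d) hδ (by linarith) (fun r hr h => by linarith [hr.2])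
        (fun r hr => hd r (hIcc ⟨hr.1, by linarith [hr.2]⟩))
        (hc.mono fun r hr => hIcc ⟨hr.1, by linarith [hr.2]⟩)
      have i2 := pv_ibp G G' δ (1+d) (1+δ) hδ (by linarith) (fun r hr h => by linarith [hr.1])
        (fun r hr => hd r (hIcc ⟨by linarith [hr.1], hr.2⟩))
        (hc.mono fun r hr => hIcc ⟨by linarith [hr.1], hr.2⟩)
      have l1 : Real.log ((1 - δ - 1)/δ) = 0 := by
        rw [show (1 - δ - 1)/δ = -1 by field_simp; ring]; simp
      have l2 : Real.log ((1 + δ - 1)/δ) = 0 := by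
        rw [show (1 + δ - 1)/δ = 1 by field_simp; ring]; simp
      have l3 : Real.log ((1 - d - 1)/δ) = Real.log (d/δ) := by
        rw [show (1 - d - 1)/δ = -(d/δ) by ring, Real.log_neg_eq_log]
      have l4 : Real.log ((1 + d - 1)/δ) = Real.log (d/δ) := by
        rw [show (1 + d - 1)/δ = (d/δ) by ring]
      rw [l1, l3] at i1
      rw [l2, l4] at i2
      have hset : {r : ℝ | 0 < r ∧ d < |1 - r|} = far ∪ (Ioo (1-δ) (1-d) ∪ Ioo (1+d) (1+δ)) := by
        ext r
        simp only [hfar, mem_union, Set.mem_ofPred_eq, mem_Ioo]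
        constructor
        · rintro ⟨h0, h1⟩
          by_cases h : δ ≤ |1 - r|
          · exact Or.inl ⟨h0, h⟩
          · right
            push Not at h
            rw [abs_lt] at h
            rcases lt_abs.1 h1 with h2 | h2
            · left; constructor <;> linarith
            · right; constructor <;> linarith
        · rintro (⟨h0, h1⟩ | ⟨h0, h1⟩ | ⟨h0, h1⟩)
          · exact ⟨h0, by linarith⟩
          · exact ⟨by linarith, lt_abs.2 (Or.inl (by linarith))⟩
          · exact ⟨by linarith, lt_abs.2 (Or.inr (by linarith))⟩
      have hInt0 : ∀ a b : ℝ, 0 < a → (∀ r ∈ Icc a b, r ≠ 1) → 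
          IntegrableOn (fun r => ((1 - r)⁻¹ : ℝ) • G r) (Ioo a b) := by
        intro a b ha hne
        apply IntegrableOn.mono_set (t := Icc a b) _ Ioo_subset_Icc_self
        apply ContinuousOn.integrableOn_Icc
        refine ContinuousOn.smul (f := fun r : ℝ => (1 - r)⁻¹) (g := G) ?_ ?_
        · apply ContinuousOn.inv₀ (by fun_prop)
          intro r hr h
          exact hne r hr (by linarith)
        · intro r hr
          exact (hd r (lt_of_lt_of_le ha hr.1)).continuousAt.continuousWithinAt
      have hi1 := hInt0 (1-δ) (1-d) (by linarith) (fun r hr h => by linarith [hr.2])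
      have hi2 := hInt0 (1+d) (1+δ) (by linarith) (fun r hr h => by linarith [hr.1])
      rw [hset, setIntegral_union _ (measurableSet_Ioo.union measurableSet_Ioo) hfari (hi1.union hi2),
        setIntegral_union _ measurableSet_Ioo hi1 hi2]
      · rw [← integral_Ioc_eq_integral_Ioo, ← integral_Ioc_eq_integral_Ioo,
          ← intervalIntegral.integral_of_le (by linarith), ← intervalIntegral.integral_of_le (by linarith), i1, i2]
        simp only [hLG, hPf]
        push_cast
        ring
      · rw [Set.disjoint_left]; intro r h1 h2; linarith [h1.2, h2.1]
      · rw [Set.disjoint_left]; rintro r ⟨h0, h1⟩ (h2 | h2)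
        · rw [abs_of_pos (by linarith [h2.2])] at h1; linarith [h2.1]
        · rw [abs_of_neg (by linarith [h2.1])] at h1; linarith [h2.2]
    refine Tendsto.congr' key ?_
    have t1 : Tendsto (fun d => ∫ r in (1-δ)..(1-d), LG r) (𝓝[>] (0:ℝ)) (𝓝 (∫ r in (1-δ)..1, LG r)) := by
      have := (intervalIntegral.continuousOn_primitive_interval (f := LG) (μ := volume) (a := 1-δ) (b := 1+δ)
        (by rwa [uIcc_of_le (by linarith)])) 1 (by rw [uIcc_of_le (by linarith)]; constructor <;> linarith)
      apply this.tendsto.comp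
      apply tendsto_nhdsWithin_of_tendsto_nhds_of_eventually_within
      · have : Tendsto (fun d : ℝ => 1 - d) (𝓝 0) (𝓝 (1 - 0)) := (continuous_const.sub continuous_id).tendsto 0
        rw [sub_zero] at this
        exact this.mono_left nhdsWithin_le_nhds
      · filter_upwards [Ioo_mem_nhdsGT hδ] with d hd'
        rw [uIcc_of_le (by linarith)]
        constructor <;> linarith [hd'.1, hd'.2]
    have t2 : Tendsto (fun d => ∫ r in (1+d)..(1+δ), LG r) (𝓝[>] (0:ℝ)) (𝓝 (∫ r in 1..(1+δ), LG r)) := by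
      have := (intervalIntegral.continuousOn_primitive_interval_left (f := LG) (μ := volume) (a := 1-δ) (b := 1+δ)
        (by rwa [uIcc_of_le (by linarith)])) 1 (by rw [uIcc_of_le (by linarith)]; constructor <;> linarith)
      apply this.tendsto.comp
      apply tendsto_nhdsWithin_of_tendsto_nhds_of_eventually_within
      · have : Tendsto (fun d : ℝ => 1 + d) (𝓝 0) (𝓝 (1 + 0)) := (continuous_const.add continuous_id).tendsto 0
        rw [add_zero] at this
        exact this.mono_left nhdsWithin_le_nhds
      · filter_upwards [Ioo_mem_nhdsGT hδ] with d hd'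
        rw [uIcc_of_le (by linarith)]
        constructor <;> linarith [hd'.1, hd'.2]
    have t3 : Tendsto (fun d => (G (1+d) - G (1-d)) * (Real.log (d/δ) : ℂ)) (𝓝[>] (0:ℝ)) (𝓝 0) := by
      have hg : HasDerivAt (fun d => G (1+d) - G (1-d)) (G' 1 + G' 1) 0 := by
        have h1 : HasDerivAt G (G' 1) (1 + 0) := by rw [add_zero]; exact hd 1 (by simp)
        have h2 : HasDerivAt G (G' 1) (1 - 0) := by rw [sub_zero]; exact hd 1 (by simp)
        have := (h1.comp_const_add 1 0).fun_sub (h2.comp_const_sub 1 0)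
        rwa [sub_neg_eq_add] at this
      have hO : (fun d => G (1+d) - G (1-d)) =O[𝓝[>] (0:ℝ)] (fun d => d) := by
        have := hg.isBigO_sub
        simp at this
        exact this.mono nhdsWithin_le_nhds
      have hO2 : (fun d => (G (1+d) - G (1-d)) * (Real.log (d/δ) : ℂ)) =O[𝓝[>] (0:ℝ)]
          (fun d => d * Real.log (d/δ)) := by
        apply hO.mul
        apply Asymptotics.isBigO_of_le
        intro d; simp
      apply hO2.trans_tendsto
      have h3 : Tendsto (fun d => Real.log d * d - Real.log δ * d) (𝓝[>] (0:ℝ)) (𝓝 (0 - Real.log δ * 0)) := by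
        have h0 : Tendsto (fun d => Real.log d * d) (𝓝[>] (0:ℝ)) (𝓝 0) := by
          simpa only [rpow_one] using tendsto_log_mul_rpow_nhdsGT_zero zero_lt_one
        apply h0.sub
        apply Tendsto.mono_left _ nhdsWithin_le_nhds
        exact (continuous_const.mul continuous_id).tendsto 0
      simp at h3
      refine h3.congr' ?_
      filter_upwards [self_mem_nhdsWithin] with d hd0
      rw [Real.log_div (ne_of_gt hd0) hδ.ne']; ring
    have i1 : IntervalIntegrable LG volume (1-δ) 1 := hLGi.mono_set (by
      rw [uIcc_of_le (by linarith), uIcc_of_le (by linarith)]; exact Icc_subset_Icc le_rfl (by linarith))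
    have i2 : IntervalIntegrable LG volume 1 (1+δ) := hLGi.mono_set (by
      rw [uIcc_of_le (by linarith), uIcc_of_le (by linarith)]; exact Icc_subset_Icc (by linarith) le_rfl)
    rw [← intervalIntegral.integral_add_adjacent_intervals i1 i2]
    have := ((tendsto_const_nhds (x := Pf)).add (t1.add t2)).add t3
    simpa using this
  · rw [add_comm]
    refine (enorm_add_le _ _).trans (add_le_add ?_ ?_)
    · rw [intervalIntegral.integral_of_le (by linarith), integral_Ioc_eq_integral_Ioo]
      have hs : {r : ℝ | |1 - r| < δ} = Ioo (1-δ) (1+δ) := by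
        ext r; simp only [Set.mem_ofPred_eq, mem_Ioo, abs_lt]
        constructor <;> rintro ⟨h1, h2⟩ <;> constructor <;> linarith
      rw [hs]
      refine (enorm_integral_le_lintegral_enorm _).trans ?_
      apply setLIntegral_mono' measurableSet_Ioo
      intro r hr
      simp only [hLG, enorm_mul]
      gcongr
      rw [← ofReal_norm, Complex.norm_real, Real.norm_eq_abs]
      apply ENNReal.ofReal_le_ofReal
      have h1 : Real.log ((r-1)/δ) = - Real.log (δ / |1 - r|) := by
        rw [← Real.log_inv, inv_div, ← Real.log_abs, abs_div, abs_of_pos hδ, abs_sub_comm]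
      rw [h1, abs_neg]
      by_cases h0 : |1 - r| = 0
      · simp [h0]
      · rw [abs_of_nonneg]
        apply Real.log_nonneg
        have : 0 < |1 - r| := lt_of_le_of_ne (abs_nonneg _) (Ne.symm h0)
        rw [le_div_iff₀ this, one_mul, abs_le]
        constructor <;> linarith [hr.1, hr.2]
    · refine (enorm_integral_le_lintegral_enorm _).trans ?_
      apply lintegral_mono
      intro r
      beta_reduce
      rw [enorm_smul, mul_comm]
      gcongr
      rw [← ofReal_norm, norm_inv, Real.norm_eq_abs]
end PartC

section PartD
open scoped Topology

lemma polar_nu (n : ℕ) (hn : 1 ≤ n) : ∃ K : ℝ≥0∞, K ≠ ⊤ ∧ ∀ (c : En n) (k : ℝ), 0 < k →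
    ∀ H : En n → ℝ≥0∞, Measurable H →
    ∫⁻ r in Ioi (0:ℝ), ENNReal.ofReal (k * (r * k)^(n-1)) * ∫⁻ ω, H (c + (r * k) • ω) ∂(nuS n)
      ≤ K * ∫⁻ ζ, H ζ := by
  obtain ⟨K, hK, hle⟩ := nuS_le n hn
  refine ⟨K, hK, fun c k hk H hH => ?_⟩
  rw [polar_scaled n hn c k hk H hH]
  have hm : Measurable (fun p : ℝ × En n => ENNReal.ofReal (k * (p.1 * k)^(n-1)) * H (c + (p.1 * k) • p.2)) := by
    fun_prop
  calc _ ≤ ∫⁻ r in Ioi (0:ℝ), K * ∫⁻ ω, ENNReal.ofReal (k * (r * k)^(n-1)) * H (c + (r * k) • ω) ∂(tauS n) := by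
        apply lintegral_mono
        intro r
        beta_reduce
        rw [lintegral_const_mul _ (by fun_prop), mul_left_comm]
        gcongr
        refine (lintegral_mono' hle le_rfl).trans ?_
        rw [lintegral_smul_measure]; rfl
    _ = _ := by
        rw [lintegral_const_mul' _ _ hK]
        congr 1
        rw [lintegral_lintegral_swap]
        exact hm.aemeasurable

/-- the spherical mean and its derivative -/
lemma mean_deriv (n : ℕ) (hn : 1 ≤ n) (F : En n → ℂ) (hF : ContDiff ℝ 1 F) (B : ℝ)
    (hB : ∀ x, ‖F x‖ ≤ B ∧ ‖fderiv ℝ F x‖ ≤ B) (c : En n) (k : ℝ) (hk : 0 < k) :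
    (∀ r : ℝ, HasDerivAt (fun r : ℝ => ∫ ω, F (c + (r * k) • ω) ∂(nuS n))
      (∫ ω, fderiv ℝ F (c + (r * k) • ω) (k • ω) ∂(nuS n)) r) ∧
    Continuous (fun r : ℝ => ∫ ω, fderiv ℝ F (c + (r * k) • ω) (k • ω) ∂(nuS n)) := by
  have := nuS_fin n hn
  have hB0 : 0 ≤ B := (norm_nonneg _).trans (hB 0).1
  have hfd : Continuous (fderiv ℝ F) := hF.continuous_fderiv (by norm_num)
  have hFc := hF.continuous
  have hbd : ∀ᵐ ω ∂(nuS n), ∀ r : ℝ, ‖fderiv ℝ F (c + (r * k) • ω) (k • ω)‖ ≤ B * k := by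
    filter_upwards [nuS_ae n] with ω hω r
    refine (ContinuousLinearMap.le_opNorm _ _).trans ?_
    rw [norm_smul, hω, mul_one, Real.norm_eq_abs, abs_of_pos hk]
    gcongr
    exact (hB _).2
  constructor
  · intro r0
    refine (hasDerivAt_integral_of_dominated_loc_of_deriv_le (μ := nuS n) (s := univ) (bound := fun _ => B * k)
      (F := fun r ω => F (c + (r * k) • ω)) (F' := fun r ω => fderiv ℝ F (c + (r * k) • ω) (k • ω))
      univ_mem ?_ ?_ ?_ ?_ ?_ ?_).2
    · filter_upwards with r
      exact (by fun_prop : Continuous fun ω => F (c + (r * k) • ω)).aestronglyMeasurable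
    · apply Integrable.of_bound (C := B)
      · exact (by fun_prop : Continuous fun ω => F (c + (r0 * k) • ω)).aestronglyMeasurable
      · filter_upwards with ω using (hB _).1
    · exact (by fun_prop : Continuous fun ω => fderiv ℝ F (c + (r0 * k) • ω) (k • ω)).aestronglyMeasurable
    · filter_upwards [hbd] with ω h r _ using h r
    · exact integrable_const _
    · filter_upwards with ω r _
      have h1 : HasFDerivAt F (fderiv ℝ F (c + (r * k) • ω)) (c + (r * k) • ω) :=
        (hF.differentiable (by norm_num) _).hasFDerivAt
      have h2 : HasDerivAt (fun r : ℝ => c + (r * k) • ω) (k • ω) r := by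
        have := (((hasDerivAt_id r).mul_const k).smul_const ω).const_add c
        simpa using this
      exact h1.comp_hasDerivAt r h2
  · apply continuous_of_dominated (bound := fun _ => B * k)
    · intro r
      exact (by fun_prop : Continuous fun ω => fderiv ℝ F (c + (r * k) • ω) (k • ω)).aestronglyMeasurable
    · intro r; filter_upwards [hbd] with ω h using h r
    · exact integrable_const _
    · filter_upwards with ω
      fun_prop

/-- derivative of the weight -/
lemma weight_deriv (m : ℕ) (k : ℝ) (hk : 0 < k) : ∃ a' : ℝ → ℝ,
    (∀ r ∈ Ioi (0:ℝ), HasDerivAt (fun r => (k * (r+1))⁻¹ * (r*k)^m) (a' r) r) ∧ ContinuousOn a' (Ioi 0) ∧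
    ∀ r, 1/2 < r → |a' r| ≤ (2*m+1) * (k⁻¹ * (r*k)^m) := by
  refine ⟨fun r => -(k) / (k*(r+1))^2 * (r*k)^m + (k * (r+1))⁻¹ * (m * (r*k)^(m-1) * k), ?_, ?_, ?_⟩
  · intro r hr
    have hr : 0 < r := hr
    have h1 : HasDerivAt (fun r => (k * (r+1))) k r := by
      simpa using ((hasDerivAt_id r).add_const 1).const_mul k
    have h2 : HasDerivAt (fun r => r * k) k r := by
      simpa using (hasDerivAt_id r).mul_const k
    have h3 := (h1.fun_inv (by positivity)).fun_mul (h2.fun_pow m)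
    exact h3
  · have : ∀ r ∈ Ioi (0:ℝ), k * (r+1) ≠ 0 := fun r hr => by
      have : 0 < r := hr
      positivity
    apply ContinuousOn.add
    · apply ContinuousOn.mul
      · apply ContinuousOn.div₀ (by fun_prop) (by fun_prop)
        intro r hr; exact pow_ne_zero _ (this r hr)
      · fun_prop
    · apply ContinuousOn.mul
      · exact ContinuousOn.inv₀ (by fun_prop) this
      · fun_prop
  · intro r hr
    have hr0 : 0 < r := by linarith
    have e1 : |-(k) / (k*(r+1))^2 * (r*k)^m| ≤ k⁻¹ * (r*k)^m := by
      rw [abs_mul, abs_of_nonneg (by positivity : 0 ≤ (r*k)^m), abs_div, abs_neg, abs_of_pos hk, abs_of_pos (by positivity)]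
      gcongr
      rw [div_le_iff₀ (by positivity)]
      field_simp
      nlinarith
    have e2 : |(k * (r+1))⁻¹ * (m * (r*k)^(m-1) * k)| ≤ 2*m*(k⁻¹ * (r*k)^m) := by
      rw [abs_of_nonneg (by positivity)]
      rcases m with _ | m
      · simp
      · simp only [Nat.add_sub_cancel]
        have : (k * (r+1))⁻¹ * (((m+1:ℕ):ℝ) * (r*k)^m * k) = (((m+1:ℕ):ℝ) * (k⁻¹ * (r*k)^(m+1))) * (r*(r+1))⁻¹ := by
          rw [pow_succ]; field_simp
        rw [this]
        have : (r*(r+1))⁻¹ ≤ 2 := by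
          rw [inv_le_comm₀ (by positivity) (by norm_num)]; nlinarith
        calc _ ≤ (((m+1:ℕ):ℝ) * (k⁻¹ * (r*k)^(m+1))) * 2 := by gcongr
          _ = _ := by ring
    refine (abs_add_le _ _).trans ?_
    linarith

lemma log_bound (k ε r : ℝ) (hk : 1 ≤ k) (hε : 0 < ε) (hε1 : ε < 1) (hr : |1 - r| < 1/(2*k)) :
    Real.log (1/(2*k) / |1 - r|) ≤ 2/(1-ε) * (k * |(r*k)^2 - k^2| ^ (-1+ε)) := by
  have hk0 : 0 < k := by linarith
  have h1e : 0 < 1 - ε := by linarith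
  by_cases h0 : |1 - r| = 0
  · rw [h0]; simp; positivity
  have hs : 0 < |1 - r| := lt_of_le_of_ne (abs_nonneg _) (Ne.symm h0)
  refine (Real.log_le_rpow_div (by positivity) h1e).trans ?_
  have hs2 : |1 - r| < 1/2 := by
    refine hr.trans_le ?_
    apply one_div_le_one_div_of_le <;> linarith
  have hrr := abs_lt.1 hs2
  have hphi : |(r*k)^2 - k^2| = k^2 * (r+1) * |1 - r| := by
    rw [show (r*k)^2 - k^2 = -(k^2 * (r+1) * (1 - r)) by ring, abs_neg, abs_mul, abs_of_nonneg]
    have : 0 < r + 1 := by linarith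
    positivity
  have hr1 : 0 < r + 1 := by linarith
  have hphi0 : 0 < |(r*k)^2 - k^2| := by rw [hphi]; positivity
  have h2 : 1/(2*k) / |1 - r| ≤ (2 * k) * |(r*k)^2 - k^2|⁻¹ := by
    rw [hphi, div_div, ← div_eq_mul_inv, div_le_div_iff₀ (by positivity) (by positivity)]
    have : 0 ≤ k^2 * |1 - r| := by positivity
    nlinarith
  have h3 : (1/(2*k) / |1 - r|) ^ (1-ε) ≤ 2 * k * |(r*k)^2 - k^2| ^ (-1+ε) := by
    refine (Real.rpow_le_rpow (by positivity) h2 h1e.le).trans ?_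
    rw [Real.mul_rpow (by positivity) (by positivity), Real.inv_rpow hphi0.le, ← Real.rpow_neg hphi0.le]
    rw [show -(1-ε) = -1+ε by ring]
    gcongr
    calc (2*k)^(1-ε) ≤ (2*k)^(1:ℝ) := Real.rpow_le_rpow_of_exponent_le (by linarith) (by linarith)
      _ = _ := Real.rpow_one _
  calc _ ≤ (2 * k * |(r*k)^2 - k^2| ^ (-1+ε)) / (1-ε) := by gcongr
    _ = _ := by ring

lemma far_bound (k ε r : ℝ) (hk : 1 ≤ k) (hε : 0 < ε) (hε1 : ε < 1) (hr0 : 0 < r) (hr : 1/(2*k) ≤ |1 - r|) :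
    (k * (r+1))⁻¹ * |1 - r|⁻¹ ≤ 2 * (k * |(r*k)^2 - k^2| ^ (-1+ε)) := by
  have hk0 : 0 < k := by linarith
  have hs : 0 < |1 - r| := lt_of_lt_of_le (by positivity) hr
  have hphi : |(r*k)^2 - k^2| = k^2 * (r+1) * |1 - r| := by
    rw [show (r*k)^2 - k^2 = -(k^2 * (r+1) * (1 - r)) by ring, abs_neg, abs_mul, abs_of_nonneg (by positivity)]
  set φ := |(r*k)^2 - k^2| with hφ
  have h1 : 1/2 ≤ φ := by
    rw [hphi]
    calc (1:ℝ)/2 ≤ k * 1/2 := by linarith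
      _ = k^2 * 1 * (1/(2*k)) := by field_simp
      _ ≤ _ := by gcongr; linarith
  have hφ0 : 0 < φ := by linarith
  have h2 : φ⁻¹ ≤ 2 * φ ^ (-1+ε) := by
    have : φ⁻¹ = φ ^ (-1+ε) * (φ⁻¹) ^ ε := by
      rw [Real.inv_rpow hφ0.le, ← Real.rpow_neg hφ0.le, ← Real.rpow_add hφ0, ← Real.rpow_neg_one]
      congr 1; ring
    rw [this, mul_comm]
    gcongr
    calc (φ⁻¹)^ε ≤ 2^ε := by
          apply Real.rpow_le_rpow (by positivity) _ hε.le
          rw [inv_le_comm₀ hφ0 (by norm_num)]; linarith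
      _ ≤ 2^(1:ℝ) := Real.rpow_le_rpow_of_exponent_le (by norm_num) hε1.le
      _ = 2 := Real.rpow_one _
  calc (k * (r+1))⁻¹ * |1 - r|⁻¹ = k * φ⁻¹ := by rw [hphi]; field_simp
    _ ≤ k * (2 * φ ^ (-1+ε)) := by gcongr
    _ = _ := by ring
end PartD

section PartD2
open scoped Topology

lemma pv_bound (n : ℕ) (hn : 1 ≤ n) (ε : ℝ) (hε : 0 < ε) (hε1 : ε < 1) : ∃ Kc : ℝ≥0∞, Kc ≠ ⊤ ∧
    ∀ (c : En n) (k : ℝ), 0 < k → ∀ F : En n → ℂ, ContDiff ℝ 1 F →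
      (∃ B : ℝ, ∀ x, ‖F x‖ ≤ B ∧ ‖fderiv ℝ F x‖ ≤ B) → Integrable F →
    ∃ P : ℂ, Tendsto (fun d : ℝ => ∫ r in {r : ℝ | 0 < r ∧ d < |1 - r|},
        ((1 - r)⁻¹ : ℝ) • (((k * (r+1))⁻¹ : ℝ) • ∫ ξ in sphere c (r * k), F ξ ∂μH[(n:ℝ) - 1]))
        (nhdsWithin 0 (Set.Ioi 0)) (nhds P) ∧
      (1 ≤ k → ‖P‖ₑ ≤ Kc * ∫⁻ ξ, (‖F ξ‖ₑ + ‖fderiv ℝ F ξ‖ₑ) *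
        ENNReal.ofReal (|‖ξ - c‖^2 - k^2| ^ (-1 + ε))) := by
  obtain ⟨K, hK, hpolar⟩ := polar_nu n hn
  set C1 : ℝ := 2 / (1-ε) * (2 * (n-1:ℕ) + 1) with hC1
  have h1e : 0 < 1 - ε := by linarith
  have hC10 : 0 ≤ C1 := by positivity
  refine ⟨(ENNReal.ofReal C1 + ENNReal.ofReal 2) * K, by finiteness, ?_⟩
  rintro c k hk F hF ⟨B, hB⟩ hFi
  have hfd : Continuous (fderiv ℝ F) := hF.continuous_fderiv (by norm_num)
  have hFc := hF.continuous
  obtain ⟨hM, hM'c⟩ := mean_deriv n hn F hF B hB c k hk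
  obtain ⟨a', ha', ha'c, ha'b⟩ := weight_deriv (n-1) k hk
  set M : ℝ → ℂ := fun r => ∫ ω, F (c + (r * k) • ω) ∂(nuS n) with hMdef
  set M' : ℝ → ℂ := fun r => ∫ ω, fderiv ℝ F (c + (r * k) • ω) (k • ω) ∂(nuS n) with hM'def
  set a : ℝ → ℝ := fun r => (k * (r+1))⁻¹ * (r*k)^(n-1) with hadef
  set G : ℝ → ℂ := fun r => a r • M r with hG
  set G' : ℝ → ℂ := fun r => a r • M' r + a' r • M r with hG'
  set δ : ℝ := min (1/2) (1/(2*k)) with hδ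
  have hδ0 : 0 < δ := by rw [hδ]; positivity
  have hδ1 : δ < 1 := (min_le_left _ _).trans_lt (by norm_num)
  have hd : ∀ r ∈ Ioi (0:ℝ), HasDerivAt G (G' r) r := fun r hr => (ha' r hr).fun_smul (hM r)
  have hac : ContinuousOn a (Ioi 0) := fun r hr => (ha' r hr).continuousAt.continuousWithinAt
  have hMc : Continuous M := by
    rw [continuous_iff_continuousAt]; exact fun r => (hM r).continuousAt
  have hc : ContinuousOn G' (Ioi 0) := 
    (hac.smul hM'c.continuousOn).add (ha'c.smul hMc.continuousOn)
  have ha0 : ∀ r ∈ Ioi (0:ℝ), 0 ≤ a r := fun r hr => by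
    have : 0 < r := hr
    simp only [hadef]; positivity
  have hMb : ∀ r, ‖M r‖ₑ ≤ ∫⁻ ω, ‖F (c + (r * k) • ω)‖ₑ ∂(nuS n) := fun r =>
    enorm_integral_le_lintegral_enorm _
  have hM'b : ∀ r, ‖M' r‖ₑ ≤ ENNReal.ofReal k * ∫⁻ ω, ‖fderiv ℝ F (c + (r * k) • ω)‖ₑ ∂(nuS n) := fun r => by
    refine (enorm_integral_le_lintegral_enorm _).trans ?_
    rw [← lintegral_const_mul' _ _ (by simp)]
    apply lintegral_mono_ae
    filter_upwards [nuS_ae n] with ω hω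
    refine (ContinuousLinearMap.le_opENorm _ _).trans ?_
    rw [mul_comm, enorm_smul]
    gcongr
    rw [← ofReal_norm ω, hω, ← ofReal_norm k, Real.norm_eq_abs, abs_of_pos hk]; simp
  have hi : IntegrableOn G (Ioi 0) := by
    refine ⟨(hac.smul hMc.continuousOn).aestronglyMeasurable measurableSet_Ioi, ?_⟩
    have h2 : ∫⁻ r in Ioi (0:ℝ), ‖G r‖ₑ ≤ ∫⁻ r in Ioi (0:ℝ), ENNReal.ofReal ((k^2)⁻¹) *
        (ENNReal.ofReal (k * (r * k)^(n-1)) * ∫⁻ ω, ‖F (c + (r * k) • ω)‖ₑ ∂(nuS n)) := by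
      apply setLIntegral_mono' measurableSet_Ioi
      intro r hr
      have hr0 : 0 < r := hr
      rw [← mul_assoc, ← ENNReal.ofReal_mul (by positivity)]
      simp only [hG, enorm_smul]
      refine mul_le_mul' ?_ (hMb r)
      rw [← ofReal_norm, Real.norm_eq_abs, abs_of_nonneg (ha0 r hr)]
      apply ENNReal.ofReal_le_ofReal
      simp only [hadef]
      rw [← mul_assoc]
      gcongr
      rw [show (k^2)⁻¹ * k = k⁻¹ by field_simp]
      apply inv_anti₀ hk
      nlinarith
    refine lt_of_le_of_lt h2 ?_
    rw [lintegral_const_mul' _ _ (by simp)]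
    refine lt_of_le_of_lt (mul_le_mul' le_rfl (hpolar c k hk (fun ζ => ‖F ζ‖ₑ) (by fun_prop))) ?_
    have := hFi.hasFiniteIntegral
    exact ENNReal.mul_lt_top (by simp) (ENNReal.mul_lt_top hK.lt_top this)
  obtain ⟨P, hP, hPb⟩ := pv1d G G' δ hδ0 hδ1 hd hc hi
  refine ⟨P, ?_, ?_⟩
  · refine hP.congr' ?_
    filter_upwards [self_mem_nhdsWithin] with d hd0
    apply setIntegral_congr_fun
    · apply MeasurableSet.inter measurableSet_Ioi
      have : Measurable (fun r : ℝ => |1 - r|) := by fun_prop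
      exact this measurableSet_Ioi
    · intro r hr
      have hr0 : 0 < r := hr.1
      beta_reduce
      rw [ewald_scale n hn c (r*k) (by positivity) F]
      simp only [hG, hadef, hMdef, mul_smul]
  · intro hk1
    have hδk : δ = 1/(2*k) := by
      rw [hδ, min_eq_right]
      apply one_div_le_one_div_of_le <;> linarith
    set g : En n → ℝ≥0∞ := fun ξ => ‖F ξ‖ₑ + ‖fderiv ℝ F ξ‖ₑ with hg
    have hgm : Measurable g := by fun_prop
    set w : ℝ → ℝ≥0∞ := fun r => ENNReal.ofReal (|(r*k)^2 - k^2| ^ (-1+ε)) with hw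
    set W : En n → ℝ≥0∞ := fun ξ => g ξ * ENNReal.ofReal (|‖ξ - c‖^2 - k^2| ^ (-1 + ε)) with hW
    have hWm : Measurable W := by
      apply hgm.mul
      fun_prop
    have hWr : ∀ r : ℝ, (∫⁻ ω, g (c + (r * k) • ω) ∂(nuS n)) * w r = ∫⁻ ω, W (c + (r * k) • ω) ∂(nuS n) := by
      intro r
      rw [← lintegral_mul_const _ (by fun_prop)]
      apply lintegral_congr_ae
      filter_upwards [nuS_ae n] with ω hω
      simp only [hW, hw]
      rw [add_sub_cancel_left, norm_smul, hω, mul_one, Real.norm_eq_abs, sq_abs]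
    have near : ∫⁻ r in {r : ℝ | |1 - r| < δ}, ‖G' r‖ₑ * ENNReal.ofReal (Real.log (δ / |1 - r|))
        ≤ ENNReal.ofReal C1 * (K * ∫⁻ ξ, W ξ) := by
      refine le_trans ?_ (mul_le_mul' le_rfl (hpolar c k hk W hWm))
      rw [← lintegral_const_mul' _ _ (by simp)]
      have hsub : {r : ℝ | |1 - r| < δ} ⊆ Ioi 0 := by
        intro r hr
        have hr : |1 - r| < δ := hr
        have := (abs_lt.1 (lt_of_lt_of_le hr (min_le_left _ _))).2
        simp only [mem_Ioi]; linarith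
      refine le_trans ?_ (lintegral_mono_set hsub)
      apply setLIntegral_mono'
      · have : Measurable (fun r : ℝ => |1 - r|) := by fun_prop
        exact this measurableSet_Iio
      intro r hr
      have hr0 : 0 < r := hsub hr
      have hr2 : 1/2 < r := by
        have hr : |1 - r| < δ := hr
        have := (abs_lt.1 (lt_of_lt_of_le hr (min_le_left _ _))).2
        linarith
      have hr' : |1 - r| < 1/(2*k) := by rw [← hδk]; exact hr
      have e1 : ENNReal.ofReal (Real.log (δ / |1 - r|)) ≤ ENNReal.ofReal (2/(1-ε)) * (ENNReal.ofReal k * w r) := by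
        rw [hδk, hw, ← ENNReal.ofReal_mul (by positivity), ← ENNReal.ofReal_mul (by positivity)]
        exact ENNReal.ofReal_le_ofReal (log_bound k ε r hk1 hε hε1 hr')
      have e2 : ‖G' r‖ₑ ≤ ENNReal.ofReal ((2 * (n-1:ℕ) + 1) * (r*k)^(n-1)) * ∫⁻ ω, g (c + (r * k) • ω) ∂(nuS n) := by
        have : ∫⁻ ω, g (c + (r * k) • ω) ∂(nuS n) = ∫⁻ ω, ‖fderiv ℝ F (c + (r * k) • ω)‖ₑ ∂(nuS n) + 
            ∫⁻ ω, ‖F (c + (r * k) • ω)‖ₑ ∂(nuS n) := by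
          rw [add_comm, ← lintegral_add_left]
          exact (by fun_prop : Continuous fun ω => F (c + (r * k) • ω)).enorm.measurable
        rw [this, mul_add]
        simp only [hG']
        refine (enorm_add_le _ _).trans (add_le_add ?_ ?_)
        · rw [enorm_smul]
          refine (mul_le_mul' le_rfl (hM'b r)).trans ?_
          rw [← mul_assoc]
          gcongr
          rw [← ofReal_norm, Real.norm_eq_abs, abs_of_nonneg (ha0 r hr0), ← ENNReal.ofReal_mul (ha0 r hr0)]
          apply ENNReal.ofReal_le_ofReal
          simp only [hadef]
          calc (k * (r + 1))⁻¹ * (r * k) ^ (n - 1) * k = (r+1)⁻¹ * (r * k) ^ (n - 1) := by field_simp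
            _ ≤ _ := by
              gcongr
              calc (r+1)⁻¹ ≤ 1 := inv_le_one_of_one_le₀ (by linarith)
                _ ≤ _ := by
                  have : (0:ℝ) ≤ (n-1:ℕ) := Nat.cast_nonneg _
                  linarith
        · rw [enorm_smul]
          refine mul_le_mul' ?_ (hMb r)
          rw [← ofReal_norm, Real.norm_eq_abs]
          apply ENNReal.ofReal_le_ofReal
          refine (ha'b r hr2).trans ?_
          gcongr
          refine mul_le_of_le_one_left (by positivity) ?_
          exact inv_le_one_of_one_le₀ hk1
      refine (mul_le_mul' e2 e1).trans ?_
      rw [← hWr r]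
      have : ENNReal.ofReal ((2 * (n-1:ℕ) + 1) * (r*k)^(n-1)) * (ENNReal.ofReal (2/(1-ε)) * ENNReal.ofReal k) =
          ENNReal.ofReal C1 * ENNReal.ofReal (k * (r*k)^(n-1)) := by
        rw [← ENNReal.ofReal_mul (by positivity), ← ENNReal.ofReal_mul (by positivity), ← ENNReal.ofReal_mul (by positivity)]
        congr 1; rw [hC1]; ring
      calc _ = (ENNReal.ofReal ((2 * (n-1:ℕ) + 1) * (r*k)^(n-1)) * (ENNReal.ofReal (2/(1-ε)) * ENNReal.ofReal k)) * 
            ((∫⁻ ω, g (c + (r * k) • ω) ∂(nuS n)) * w r) := by ring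
        _ ≤ _ := by rw [this, mul_assoc]
    have far : ∫⁻ r in {r : ℝ | 0 < r ∧ δ ≤ |1 - r|}, ‖G r‖ₑ * ENNReal.ofReal (|1 - r|⁻¹)
        ≤ ENNReal.ofReal 2 * (K * ∫⁻ ξ, W ξ) := by
      refine le_trans ?_ (mul_le_mul' le_rfl (hpolar c k hk W hWm))
      rw [← lintegral_const_mul' _ _ (by simp)]
      have hsub : {r : ℝ | 0 < r ∧ δ ≤ |1 - r|} ⊆ Ioi 0 := fun r hr => hr.1
      refine le_trans ?_ (lintegral_mono_set hsub)
      apply setLIntegral_mono'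
      · apply MeasurableSet.inter measurableSet_Ioi
        have : Measurable (fun r : ℝ => |1 - r|) := by fun_prop
        exact this measurableSet_Ici
      intro r hr
      have hr0 : 0 < r := hr.1
      have hr' : 1/(2*k) ≤ |1 - r| := by rw [← hδk]; exact hr.2
      rw [← hWr r]
      have e1 : ‖G r‖ₑ ≤ ENNReal.ofReal (a r) * ∫⁻ ω, g (c + (r * k) • ω) ∂(nuS n) := by
        simp only [hG]
        rw [enorm_smul, ← ofReal_norm (a r), Real.norm_eq_abs, abs_of_nonneg (ha0 r hr0)]
        refine mul_le_mul' le_rfl ((hMb r).trans ?_)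
        apply lintegral_mono
        intro ω
        exact le_self_add
      have e2 : ENNReal.ofReal (a r) * ENNReal.ofReal (|1 - r|⁻¹) ≤ 
          ENNReal.ofReal 2 * ENNReal.ofReal (k * (r*k)^(n-1)) * w r := by
        rw [hw, ← ENNReal.ofReal_mul (ha0 r hr0), ← ENNReal.ofReal_mul (by positivity), ← ENNReal.ofReal_mul (by positivity)]
        apply ENNReal.ofReal_le_ofReal
        simp only [hadef]
        calc _ = (r*k)^(n-1) * ((k * (r+1))⁻¹ * |1 - r|⁻¹) := by ring
          _ ≤ (r*k)^(n-1) * (2 * (k * |(r*k)^2 - k^2| ^ (-1+ε))) := by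
            gcongr ?_ * ?_
            exact far_bound k ε r hk1 hε hε1 hr0 hr'
          _ = _ := by ring
      calc _ ≤ ENNReal.ofReal (a r) * (∫⁻ ω, g (c + (r * k) • ω) ∂(nuS n)) * ENNReal.ofReal (|1 - r|⁻¹) := by gcongr
        _ = (ENNReal.ofReal (a r) * ENNReal.ofReal (|1 - r|⁻¹)) * (∫⁻ ω, g (c + (r * k) • ω) ∂(nuS n)) := by ring
        _ ≤ _ := mul_le_mul' e2 le_rfl
        _ = _ := by ring
    refine (hPb.trans (add_le_add near far)).trans ?_
    rw [← add_mul, mul_assoc]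
end PartD2

section PartE
open scoped Topology

lemma lint_rpow_Icc (ε R : ℝ) (hε : 0 < ε) (hR : 0 ≤ R) :
    ∫⁻ t in Icc 0 R, ENNReal.ofReal (|t| ^ (-1+ε)) = ENNReal.ofReal (R^ε/ε) := by
  have h1 : IntervalIntegrable (fun t : ℝ => t ^ (-1+ε)) volume 0 R :=
    intervalIntegral.intervalIntegrable_rpow' (by linarith)
  rw [intervalIntegrable_iff_integrableOn_Icc_of_le hR] at h1
  have h2 : ∫⁻ t in Icc 0 R, ENNReal.ofReal (|t| ^ (-1+ε)) = ∫⁻ t in Icc 0 R, ENNReal.ofReal (t ^ (-1+ε)) := by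
    apply setLIntegral_congr_fun measurableSet_Icc
    intro t ht
    beta_reduce
    rw [abs_of_nonneg ht.1]
  rw [h2, ← ofReal_integral_eq_lintegral_ofReal h1]
  · rw [integral_Icc_eq_integral_Ioc, ← intervalIntegral.integral_of_le hR, integral_rpow (Or.inl (by linarith))]
    simp [Real.zero_rpow hε.ne']
  · filter_upwards [ae_restrict_mem measurableSet_Icc] with t ht
    exact Real.rpow_nonneg ht.1 _

lemma lint_rpow_ball (ε R t0 : ℝ) (hε : 0 < ε) (hR : 0 ≤ R) :
    ∫⁻ t in Icc (t0-R) (t0+R), ENNReal.ofReal (|t-t0| ^ (-1+ε)) ≤ ENNReal.ofReal (2*R^ε/ε) := by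
  have hsub : Icc (t0-R) (t0+R) ⊆ (fun t => t - t0) ⁻¹' (Icc 0 R) ∪ (fun t => t0 - t) ⁻¹' (Icc 0 R) := by
    intro t ht
    rcases le_total t0 t with h | h
    · left; simp only [mem_preimage, mem_Icc] at *; constructor <;> linarith
    · right; simp only [mem_preimage, mem_Icc] at *; constructor <;> linarith
  refine (lintegral_mono_set hsub).trans ((lintegral_union_le _ _ _).trans ?_)
  have m1 : MeasurePreserving (fun t : ℝ => t - t0) volume volume := measurePreserving_sub_right volume t0
  have m2 : MeasurePreserving (fun t : ℝ => t0 - t) volume volume := Measure.measurePreserving_sub_left volume t0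
  have hm : Measurable (fun t : ℝ => ENNReal.ofReal (|t| ^ (-1+ε))) := by fun_prop
  have e1 := m1.setLIntegral_comp_preimage (s := Icc 0 R) measurableSet_Icc hm
  have e2 := m2.setLIntegral_comp_preimage (s := Icc 0 R) measurableSet_Icc hm
  rw [e1]
  simp only [abs_sub_comm t0] at e2
  rw [e2, lint_rpow_Icc ε R hε hR, ← ENNReal.ofReal_add (by positivity) (by positivity)]
  apply ENNReal.ofReal_le_ofReal
  apply le_of_eq; ring

lemma weight_int_one (ε : ℝ) (hε : 0 < ε) (hε1 : ε < 1/2) :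
    ∫⁻ r in Ioi (0:ℝ), ENNReal.ofReal (|r^2 - 1| ^ (-1+ε)) < ⊤ := by
  have hsub : Ioi (0:ℝ) ⊆ Icc (1-1) (1+1) ∪ Ioi 2 := by
    intro t ht
    have ht : 0 < t := ht
    rcases le_or_gt t 2 with h | h
    · left; constructor <;> linarith
    · right; exact h
  refine lt_of_le_of_lt ((lintegral_mono_set hsub).trans (lintegral_union_le _ _ _)) ?_
  apply ENNReal.add_lt_top.2
  constructor
  · refine lt_of_le_of_lt ?_ (lt_of_le_of_lt (lint_rpow_ball ε 1 1 hε zero_le_one) ENNReal.ofReal_lt_top)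
    apply setLIntegral_mono' measurableSet_Icc
    intro r hr
    apply ENNReal.ofReal_le_ofReal
    have hr0 : 0 ≤ r := by linarith [hr.1]
    rw [show r^2-1 = (r-1)*(r+1) by ring, abs_mul, Real.mul_rpow (abs_nonneg _) (abs_nonneg _)]
    refine mul_le_of_le_one_right (by positivity) ?_
    rw [abs_of_nonneg (by linarith)]
    exact Real.rpow_le_one_of_one_le_of_nonpos (by linarith) (by linarith)
  · have hi := integrableOn_Ioi_rpow_of_lt (a := -2+2*ε) (by linarith) (c := 2) (by norm_num)
    have : ∫⁻ r in Ioi (2:ℝ), ENNReal.ofReal (|r^2 - 1| ^ (-1+ε)) ≤ 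
        ∫⁻ r in Ioi (2:ℝ), ENNReal.ofReal ((1/2:ℝ)^(-1+ε)) * ‖r ^ (-2+2*ε)‖ₑ := by
      apply setLIntegral_mono' measurableSet_Ioi
      intro r hr
      have hr : 2 < r := hr
      rw [← ofReal_norm, ← ENNReal.ofReal_mul (by positivity)]
      apply ENNReal.ofReal_le_ofReal
      rw [Real.norm_of_nonneg (by positivity), show -2+2*ε = 2*(-1+ε) by ring, Real.rpow_mul (by positivity),
        ← Real.mul_rpow (by positivity) (by positivity)]
      apply Real.rpow_le_rpow_of_nonpos (by positivity) _ (by linarith)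
      rw [Real.rpow_two, abs_of_nonneg (by nlinarith)]
      nlinarith
    refine lt_of_le_of_lt this ?_
    rw [lintegral_const_mul' _ _ (by simp)]
    exact ENNReal.mul_lt_top (by simp) hi.2

lemma weight_int (ε : ℝ) (hε : 0 < ε) (hε1 : ε < 1/2) : ∃ C : ℝ≥0∞, C ≠ ⊤ ∧ ∀ k : ℝ, 0 < k →
    ∫⁻ r in Ioi (0:ℝ), ENNReal.ofReal (|r^2 - k^2| ^ (-1+ε)) = C * ENNReal.ofReal (k ^ (-1+2*ε)) := by
  refine ⟨_, (weight_int_one ε hε hε1).ne, fun k hk => ?_⟩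
  rw [lintegral_Ioi_scale k hk, ← lintegral_mul_const' _ _ (by simp)]
  apply lintegral_congr
  intro r
  rw [← ENNReal.ofReal_mul hk.le, ← ENNReal.ofReal_mul (by positivity)]
  congr 1
  rw [show (r*k)^2 - k^2 = (r^2-1)*k^2 by ring, abs_mul, Real.mul_rpow (abs_nonneg _) (abs_nonneg _),
    abs_of_nonneg (by positivity : 0 ≤ k^2), ← Real.rpow_natCast k 2, ← Real.rpow_mul hk.le]
  push_cast
  have : k ^ (-1+2*ε) = k * k ^ (2*(-1+ε)) := by
    rw [← Real.rpow_one_add' hk.le (by linarith)]; congr 1; ring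
  rw [this]; ring

lemma radial_bound {n : ℕ} (u : 𝓢(En n, ℂ)) (c ω : En n) (hω : ‖ω‖ = 1) (r : ℝ) (m : ℕ) (hr : 0 < r) :
    ENNReal.ofReal (r^m) * ‖u (c + r • ω)‖ₑ^2 ≤ 
      ∫⁻ s in Ioi (0:ℝ), ENNReal.ofReal (s^m) * 
        (‖u (c + s • ω)‖ₑ^2 + ‖fderiv ℝ u (c + s • ω)‖ₑ^2) := by
  set v : ℝ → ℂ := fun s => u (c + s • ω) with hv
  set v' : ℝ → ℂ := fun s => fderiv ℝ u (c + s • ω) ω with hv'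
  have hfd : Continuous (fderiv ℝ u) := (u.smooth 1).continuous_fderiv (by norm_num)
  have hvd : ∀ s, HasDerivAt v (v' s) s := by
    intro s
    have h1 : HasFDerivAt u (fderiv ℝ u (c + s • ω)) (c + s • ω) := u.differentiableAt.hasFDerivAt
    have h2 : HasDerivAt (fun r : ℝ => c + r • ω) ω s := by
      simpa using ((hasDerivAt_id s).smul_const ω).const_add c
    exact h1.comp_hasDerivAt s h2
  have hvc : Continuous v := by have := u.continuous; fun_prop
  have hv'c : Continuous v' := by fun_prop
  have hsq : ∀ z : ℂ, ‖z‖ₑ^2 = ENNReal.ofReal (‖z‖^2) := fun z => by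
    rw [ENNReal.ofReal_pow (norm_nonneg _), ofReal_norm]
  have step : ‖v r‖ₑ^2 ≤ ∫⁻ s in Ioi r, (‖v s‖ₑ^2 + ‖fderiv ℝ u (c + s • ω)‖ₑ^2) := by
    set J := ∫⁻ s in Ioi r, (‖v s‖ₑ^2 + ‖fderiv ℝ u (c + s • ω)‖ₑ^2) with hJ
    have hR : ∀ R, r ≤ R → ‖v r‖ₑ^2 ≤ ‖v R‖ₑ^2 + J := by
      intro R hrR
      have hder : ∀ s ∈ uIcc r R, HasDerivAt (fun s => ‖v s‖^2) (2 * ⟪v s, v' s⟫) s := fun s _ => (hvd s).norm_sq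
      have hcont : Continuous (fun s => 2 * ⟪v s, v' s⟫) := by fun_prop
      have hInt0 := intervalIntegral.integral_eq_sub_of_hasDerivAt hder (hcont.intervalIntegrable _ _)
      have hb : ‖∫ s in r..R, 2 * ⟪v s, v' s⟫‖ₑ ≤ J := by
        rw [intervalIntegral.integral_of_le hrR]
        refine (enorm_integral_le_lintegral_enorm _).trans ?_
        refine le_trans ?_ (lintegral_mono_set (Ioc_subset_Ioi_self (a := R)))
        apply lintegral_mono
        intro s
        beta_reduce
        have e1 : ‖v' s‖ ≤ ‖fderiv ℝ u (c + s • ω)‖ := by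
          have := ContinuousLinearMap.le_opNorm (fderiv ℝ u (c + s • ω)) ω
          rwa [hω, mul_one] at this
        have e2 : ‖2 * ⟪v s, v' s⟫‖ ≤ ‖v s‖^2 + ‖fderiv ℝ u (c + s • ω)‖^2 := by
          rw [norm_mul, Real.norm_two]
          have h1 := norm_inner_le_norm (𝕜 := ℝ) (v s) (v' s)
          have h2 : ‖v s‖ * ‖v' s‖ ≤ ‖v s‖ * ‖fderiv ℝ u (c + s • ω)‖ := by gcongr
          nlinarith [sq_nonneg (‖v s‖ - ‖fderiv ℝ u (c + s • ω)‖)]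
        rw [hsq, ← ofReal_norm, ← ofReal_norm (fderiv ℝ u (c + s • ω)), ← ENNReal.ofReal_pow (norm_nonneg _),
          ← ENNReal.ofReal_add (by positivity) (by positivity)]
        exact ENNReal.ofReal_le_ofReal e2
      rw [hInt0] at hb
      rw [hsq, hsq]
      calc ENNReal.ofReal (‖v r‖^2) ≤ ENNReal.ofReal (‖v R‖^2 + ‖‖v R‖^2 - ‖v r‖^2‖) := by
            apply ENNReal.ofReal_le_ofReal
            have := neg_abs_le (‖v R‖^2 - ‖v r‖^2)
            rw [Real.norm_eq_abs]; linarith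
        _ = ENNReal.ofReal (‖v R‖^2) + ‖‖v R‖^2 - ‖v r‖^2‖ₑ := by
            rw [ENNReal.ofReal_add (by positivity) (by positivity), ofReal_norm]
        _ ≤ _ := by gcongr
    have ht : Tendsto (fun R => ‖v R‖ₑ^2 + J) atTop (𝓝 (0 + J)) := by
      apply Tendsto.add_const
      have h0 : Tendsto v atTop (𝓝 0) := by
        have h1 : Tendsto u (cocompact (En n)) (𝓝 0) := zero_at_infty u
        apply h1.comp
        rw [← Metric.cobounded_eq_cocompact, ← tendsto_norm_atTop_iff_cobounded]
        apply tendsto_atTop_mono (f := fun s : ℝ => s - ‖c‖)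
        · intro s
          have h2 : ‖s • ω‖ = |s| := by rw [norm_smul, hω, mul_one, Real.norm_eq_abs]
          have h3 : ‖s • ω‖ ≤ ‖c + s • ω‖ + ‖c‖ := by
            calc ‖s • ω‖ = ‖(c + s • ω) - c‖ := by rw [add_sub_cancel_left]
              _ ≤ _ := norm_sub_le _ _
          have := le_abs_self s
          linarith
        · exact tendsto_atTop_add_const_right _ _ tendsto_id
      have h2 : Tendsto (fun R => ‖v R‖ₑ) atTop (𝓝 0) := by
        simpa using h0.enorm
      simpa using ENNReal.Tendsto.pow (n := 2) h2
    rw [zero_add] at ht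
    refine ge_of_tendsto ht ?_
    filter_upwards [eventually_ge_atTop r] with R hR' using hR R hR'
  calc _ ≤ ENNReal.ofReal (r^m) * ∫⁻ s in Ioi r, (‖v s‖ₑ^2 + ‖fderiv ℝ u (c + s • ω)‖ₑ^2) := by gcongr
    _ = ∫⁻ s in Ioi r, ENNReal.ofReal (r^m) * (‖v s‖ₑ^2 + ‖fderiv ℝ u (c + s • ω)‖ₑ^2) := by
        rw [lintegral_const_mul' _ _ (by simp)]
    _ ≤ ∫⁻ s in Ioi r, ENNReal.ofReal (s^m) * (‖v s‖ₑ^2 + ‖fderiv ℝ u (c + s • ω)‖ₑ^2) := by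
        apply setLIntegral_mono' measurableSet_Ioi
        intro s hs
        have hs : r < s := hs
        gcongr
    _ ≤ _ := lintegral_mono_set (Ioi_subset_Ioi hr.le)

lemma trace_bound (n : ℕ) (hn : 1 ≤ n) (ε : ℝ) (hε : 0 < ε) (hε1 : ε < 1/2) : ∃ C : ℝ≥0∞, C ≠ ⊤ ∧
    ∀ (u : 𝓢(En n, ℂ)) (c : En n) (k : ℝ), 0 < k →
    ∫⁻ ζ, ‖u ζ‖ₑ^2 * ENNReal.ofReal (|‖ζ - c‖^2 - k^2| ^ (-1+ε)) ≤
      C * ENNReal.ofReal (k ^ (-1+2*ε)) * ∫⁻ ζ, (‖u ζ‖ₑ^2 + ‖fderiv ℝ u ζ‖ₑ^2) := by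
  obtain ⟨C, hC, hw⟩ := weight_int ε hε hε1
  refine ⟨C, hC, fun u c k hk => ?_⟩
  have hfd : Continuous (fderiv ℝ u) := (u.smooth 1).continuous_fderiv (by norm_num)
  have huc := u.continuous
  rw [polar n hn c _ (by fun_prop), polar n hn c (fun ζ => ‖u ζ‖ₑ^2 + ‖fderiv ℝ u ζ‖ₑ^2) (by fun_prop),
    ← lintegral_const_mul' _ _ (by finiteness)]
  apply lintegral_mono_ae
  filter_upwards [tauS_ae n] with ω hω
  rw [← hw k hk]
  set J := ∫⁻ s in Ioi (0:ℝ), ENNReal.ofReal (s^(n-1)) * 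
        (‖u (c + s • ω)‖ₑ^2 + ‖fderiv ℝ u (c + s • ω)‖ₑ^2) with hJ
  rw [← lintegral_mul_const _ (by fun_prop)]
  apply setLIntegral_mono' measurableSet_Ioi
  intro r hr
  rw [add_sub_cancel_left, norm_smul, hω, mul_one, Real.norm_eq_abs, sq_abs, ← mul_assoc, mul_comm]
  gcongr
  exact radial_bound u c ω hω r (n-1) hr
end PartE

section PartF
open scoped Topology

lemma insE_eq {m : ℕ} (t : ℝ) (z : Fin m → ℝ) :
    insE 0 t z = t • (EuclideanSpace.single (0 : Fin (m+1)) (1:ℝ)) + insE 0 0 z := by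
  apply insE_ext 0
  · simp [insE_same]
  · intro j
    rw [PiLp.add_apply, insE_succAbove, insE_succAbove]
    simp

lemma slice (m : ℕ) (e : En (m+1)) (he : ‖e‖ = 1) : ∃ L : (Fin m → ℝ) → En (m+1), Continuous L ∧
    (∀ z, ⟪e, L z⟫ = 0) ∧ (∀ z, ‖L z‖ = ‖(WithLp.toLp 2 z : En m)‖) ∧
    ∀ H : En (m+1) → ℝ≥0∞, Measurable H → ∫⁻ x, H x = ∫⁻ z : Fin m → ℝ, ∫⁻ t : ℝ, H (t • e + L z) := by
  obtain ⟨b, hb⟩ := Orthonormal.exists_orthonormalBasis_extension_of_card_eq (𝕜 := ℝ) (E := En (m+1))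
    (ι := Fin (m+1)) (by simp) (v := fun _ => e) (s := {0}) (by
      rw [orthonormal_iff_ite]
      rintro ⟨i, hi⟩ ⟨j, hj⟩
      simp only [mem_singleton_iff] at hi hj
      subst hi; subst hj
      simp [he])
  have hb0 : b 0 = e := hb 0 rfl
  set A := b.repr.symm with hA
  have hAe : A (EuclideanSpace.single (0 : Fin (m+1)) (1:ℝ)) = e := by
    rw [hA, OrthonormalBasis.repr_symm_single, hb0]
  obtain ⟨Φ, hΦ, hΦe⟩ := insE_mp (m := m) 0
  refine ⟨fun z => A (insE 0 0 z), ?_, ?_, ?_, ?_⟩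
  · refine A.continuous.comp ?_
    unfold insE
    fun_prop
  · intro z
    rw [← hAe, LinearIsometryEquiv.inner_map_map, EuclideanSpace.inner_single_left]
    simp [insE_same]
  · intro z
    rw [LinearIsometryEquiv.norm_map, ← sq_eq_sq₀ (norm_nonneg _) (norm_nonneg _), insE_norm_sq,
      EuclideanSpace.real_norm_sq_eq]
    simp
  · intro H hH
    have hAm : MeasurePreserving A volume volume := A.measurePreserving
    rw [← hAm.lintegral_comp hH]
    have hHA : Measurable (fun x => H (A x)) := hH.comp A.continuous.measurable
    rw [← hΦ.lintegral_comp hHA]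
    rw [Measure.volume_eq_prod, lintegral_prod_symm]
    · apply lintegral_congr
      intro z
      apply lintegral_congr
      intro t
      rw [hΦe, insE_eq, map_add, map_smul, hAe]
    · exact (hHA.comp Φ.measurable).aemeasurable

lemma z_int (m : ℕ) (β μ ε : ℝ) (hε : 0 < ε) (hμ : 0 ≤ μ) (hμm : (m:ℝ) ≤ 2*β + μ) :
    ∃ C : ℝ≥0∞, C ≠ ⊤ ∧ ∀ R : ℝ, 1/2 ≤ R → 
    ∫⁻ z in {z : Fin m → ℝ | ‖(WithLp.toLp 2 z : En m)‖ ≤ 2*R}, ENNReal.ofReal (jap (WithLp.toLp 2 z : En m) ^ (-2*β))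
      ≤ C * ENNReal.ofReal (R ^ (μ + ε)) := by
  set γ := 2*β + μ + ε with hγ
  have hInt0 : Integrable (fun z : En m => (1 + ‖z‖^2) ^ (-γ/2)) :=
    integrable_rpow_neg_one_add_norm_sq (by simp; linarith)
  refine ⟨ENNReal.ofReal ((4:ℝ)^(μ+ε)) * ∫⁻ z : En m, ‖(1 + ‖z‖^2) ^ (-γ/2)‖ₑ, ?_, ?_⟩
  · exact ENNReal.mul_ne_top (by simp) hInt0.2.ne
  intro R hR
  have hmp := EuclideanSpace.volume_preserving_symm_measurableEquiv_toLp (Fin m)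
  have e1 : ∫⁻ z : En m, ‖(1 + ‖z‖^2) ^ (-γ/2)‖ₑ = ∫⁻ z : Fin m → ℝ, ‖(1 + ‖(WithLp.toLp 2 z : En m)‖^2) ^ (-γ/2)‖ₑ := by
    have h2 := PiLp.volume_preserving_toLp (Fin m)
    exact (h2.lintegral_comp (by fun_prop)).symm
  rw [e1, mul_right_comm, ← ENNReal.ofReal_mul (by positivity), ← lintegral_const_mul' _ _ (by simp)]
  refine le_trans (setLIntegral_mono' ?_ ?_) (setLIntegral_le_lintegral _ _)
  · exact (measurable_id.norm.comp (PiLp.volume_preserving_toLp (Fin m)).measurable) measurableSet_Iic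
  · intro z hz
    have hz : ‖(WithLp.toLp 2 z : En m)‖ ≤ 2*R := hz
    set x := (WithLp.toLp 2 z : En m)
    rw [← ofReal_norm, ← ENNReal.ofReal_mul (by positivity), Real.norm_of_nonneg (by positivity)]
    apply ENNReal.ofReal_le_ofReal
    have hj : jap x = (1 + ‖x‖^2)^(1/2:ℝ) := by rw [jap, Real.sqrt_eq_rpow]
    have hj0 : 0 < jap x := by rw [jap]; positivity
    have h3 : (1 + ‖x‖^2) ^ (-γ/2) = jap x ^ (-γ) := by
      rw [hj, ← Real.rpow_mul (by positivity)]; congr 1; ring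
    have h4 : jap x ^ (-2*β) = jap x ^ (μ+ε) * jap x ^ (-γ) := by
      rw [← Real.rpow_add hj0]; congr 1; rw [hγ]; ring
    rw [h3, h4, ← Real.mul_rpow (by positivity) (by positivity)]
    gcongr
    rw [jap, Real.sqrt_le_left (by positivity)]
    nlinarith [norm_nonneg x]

/-- one-dimensional sublevel lemma -/
lemma sublevel (ε : ℝ) (hε : 0 < ε) (hε1 : ε < 1) (Ω : Set ℝ) (hΩ : IsCompact Ω) (R D : ℝ) (hR : 0 < R) (hD : 0 < D)
    (hΩR : Ω ⊆ Icc (-R) R) (p : ℝ → ℝ) (hp : Continuous p)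
    (hpD : ∀ t ∈ Ω, ∀ t' ∈ Ω, D * |t - t'| ≤ |p t - p t'|) :
    ∫⁻ t in Ω, ENNReal.ofReal (|p t| ^ (-1+ε)) ≤ ENNReal.ofReal ((8/ε) * (D^(-1+ε) * R^ε)) := by
  rcases Ω.eq_empty_or_nonempty with h | h
  · simp [h]
  obtain ⟨t0, ht0, hmin⟩ := hΩ.exists_isMinOn h hp.abs.continuousOn
  have hb : ∀ t ∈ Ω, D/2 * |t - t0| ≤ |p t| := by
    intro t ht
    have h1 := hpD t ht t0 ht0
    have h2 : |p t0| ≤ |p t| := hmin ht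
    have h3 := abs_sub (p t) (p t0)
    linarith
  have hsub : Ω ⊆ Icc (t0 - 2*R) (t0 + 2*R) := fun t ht => by
    have h1 := hΩR ht
    have h2 := hΩR ht0
    constructor <;> linarith [h1.1, h1.2, h2.1, h2.2]
  have hae : ∀ᵐ t : ℝ ∂(volume.restrict Ω), t ≠ t0 := ae_restrict_of_ae (Measure.ae_ne volume t0)
  calc ∫⁻ t in Ω, ENNReal.ofReal (|p t| ^ (-1+ε)) ≤ 
      ∫⁻ t in Ω, ENNReal.ofReal ((D/2)^(-1+ε)) * ENNReal.ofReal (|t - t0| ^ (-1+ε)) := by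
        apply lintegral_mono_ae
        filter_upwards [hae, ae_restrict_mem hΩ.isClosed.measurableSet] with t ht htΩ
        rw [← ENNReal.ofReal_mul (by positivity)]
        apply ENNReal.ofReal_le_ofReal
        rw [← Real.mul_rpow (by positivity) (by positivity)]
        have : 0 < |t - t0| := abs_pos.2 (sub_ne_zero.2 ht)
        exact Real.rpow_le_rpow_of_nonpos (by positivity) (hb t htΩ) (by linarith)
    _ = ENNReal.ofReal ((D/2)^(-1+ε)) * ∫⁻ t in Ω, ENNReal.ofReal (|t - t0| ^ (-1+ε)) := 
        lintegral_const_mul' _ _ (by simp)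
    _ ≤ ENNReal.ofReal ((D/2)^(-1+ε)) * ENNReal.ofReal (2*(2*R)^ε/ε) := by
        gcongr
        exact (lintegral_mono_set hsub).trans (lint_rpow_ball ε (2*R) t0 hε (by positivity))
    _ ≤ _ := by
        rw [← ENNReal.ofReal_mul (by positivity)]
        apply ENNReal.ofReal_le_ofReal
        rw [Real.div_rpow hD.le (by norm_num), Real.mul_rpow (by norm_num) hR.le]
        have h1 : ((2:ℝ)^(-1+ε))⁻¹ = 2 * (2^ε)⁻¹ := by
          rw [Real.rpow_add (by norm_num), Real.rpow_neg_one]; field_simp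
        rw [div_eq_mul_inv, h1]
        have h2 : (0:ℝ) < 2^ε := by positivity
        calc _ = (4/ε) * (D^(-1+ε) * R^ε) * (2^ε * (2^ε)⁻¹) := by ring
          _ = (4/ε) * (D^(-1+ε) * R^ε) := by rw [mul_inv_cancel₀ h2.ne', mul_one]
          _ ≤ _ := by gcongr; norm_num

/-- averaging lemma -/
lemma avg_bound (ε : ℝ) (hε : 0 < ε) (hε1 : ε < 1) : ∃ C : ℝ, 0 ≤ C ∧ ∀ A B : ℝ, 0 < A →
    ∫⁻ l in Icc (1:ℝ) 2, ENNReal.ofReal (|A + l * B| ^ (-1+ε)) ≤ ENNReal.ofReal (C * A^(-1+ε)) := by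
  refine ⟨(1/4:ℝ)^(-1+ε) * (2*6^ε/ε) + (1/2)^(-1+ε), by positivity, fun A B hA => ?_⟩
  rcases lt_or_ge |B| (A/4) with h | h
  · calc _ ≤ ∫⁻ l in Icc (1:ℝ) 2, ENNReal.ofReal ((1/2)^(-1+ε) * A^(-1+ε)) := by
          apply setLIntegral_mono' measurableSet_Icc
          intro l hl
          apply ENNReal.ofReal_le_ofReal
          rw [← Real.mul_rpow (by norm_num) hA.le]
          apply Real.rpow_le_rpow_of_nonpos (by positivity) _ (by linarith)
          have h2 : |l * B| ≤ A/2 := by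
            rw [abs_mul, abs_of_nonneg (by linarith [hl.1])]
            nlinarith [hl.1, hl.2, abs_nonneg B]
          have h3 := neg_abs_le (l * B)
          refine le_trans ?_ (le_abs_self _)
          linarith
      _ = ENNReal.ofReal ((1/2)^(-1+ε) * A^(-1+ε)) := by
          rw [setLIntegral_const, Real.volume_Icc]; norm_num
      _ ≤ _ := by
          apply ENNReal.ofReal_le_ofReal
          gcongr
          have : (0:ℝ) ≤ (1/4:ℝ)^(-1+ε) * (2*6^ε/ε) := by positivity
          linarith
  · have hB : 0 < |B| := by linarith
    have hB0 : B ≠ 0 := abs_pos.1 hB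
    set l0 := -(A/B) with hl0
    have hl0b : |l0| ≤ 4 := by
      rw [hl0, abs_neg, abs_div, abs_of_pos hA, div_le_iff₀ hB]; linarith
    have hl := abs_le.1 hl0b
    calc _ ≤ ∫⁻ l in Icc (1:ℝ) 2, ENNReal.ofReal ((1/4)^(-1+ε) * A^(-1+ε)) * ENNReal.ofReal (|l - l0| ^ (-1+ε)) := by
          apply setLIntegral_mono' measurableSet_Icc
          intro l hl
          rw [← ENNReal.ofReal_mul (by positivity)]
          apply ENNReal.ofReal_le_ofReal
          have : A + l * B = B * (l - l0) := by rw [hl0]; field_simp; ring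
          rw [this, abs_mul, Real.mul_rpow (by positivity) (by positivity)]
          gcongr
          rw [← Real.mul_rpow (by norm_num) hA.le]
          exact Real.rpow_le_rpow_of_nonpos (by positivity) (by linarith) (by linarith)
      _ = ENNReal.ofReal ((1/4)^(-1+ε) * A^(-1+ε)) * ∫⁻ l in Icc (1:ℝ) 2, ENNReal.ofReal (|l - l0| ^ (-1+ε)) :=
          lintegral_const_mul' _ _ (by simp)
      _ ≤ ENNReal.ofReal ((1/4)^(-1+ε) * A^(-1+ε)) * ENNReal.ofReal (2*6^ε/ε) := by
          gcongr
          refine (lintegral_mono_set ?_).trans (lint_rpow_ball ε 6 l0 hε (by norm_num))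
          exact Icc_subset_Icc (by linarith) (by linarith)
      _ ≤ _ := by
          rw [← ENNReal.ofReal_mul (by positivity)]
          apply ENNReal.ofReal_le_ofReal
          have : (0:ℝ) ≤ (1/2:ℝ)^(-1+ε) * A^(-1+ε) := by positivity
          nlinarith
end PartF

section PartG1
open scoped Topology

lemma cubic_alg (t1 t2 s a2 b2 Y2 : ℝ) (ha : 0 ≤ a2) (hb : 0 ≤ b2)
    (h1 : t1 + s ≤ 0) (h2 : t2 + s ≤ 0) (k1 : 4 * (t1^2 + a2) ≤ (t1+s)^2 + b2)
    (k2 : 4 * (t2^2 + a2) ≤ (t2+s)^2 + b2) (l1 : 4 * Y2 ≤ 9 * ((t1+s)^2 + b2))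
    (l2 : 4 * Y2 ≤ 9 * ((t2+s)^2 + b2)) :
    Y2/3 * |t1 - t2| ≤ |((t1^2 + a2) * (t1 + s) - 2 * ((t1+s)^2 + b2) * t1)
      - ((t2^2 + a2) * (t2 + s) - 2 * ((t2+s)^2 + b2) * t2)| := by
  have e : ((t1^2 + a2) * (t1 + s) - 2 * ((t1+s)^2 + b2) * t1)
      - ((t2^2 + a2) * (t2 + s) - 2 * ((t2+s)^2 + b2) * t2) = 
      -(((t1+s)^2 + (t1+s)*(t2+s) + (t2+s)^2 - s^2 - a2 + 2 * b2) * (t1 - t2)) := by ring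
  rw [e, abs_neg, abs_mul]
  gcongr
  refine le_trans ?_ (le_abs_self _)
  have m1 : s^2 + a2 ≤ 9/4 * (t1+s)^2 + 3/4 * b2 := by nlinarith [sq_nonneg (3 * t1 + s), sq_nonneg (t1 * 3 + s * 1)]
  have m2 : s^2 + a2 ≤ 9/4 * (t2+s)^2 + 3/4 * b2 := by nlinarith [sq_nonneg (3 * t2 + s)]
  rcases le_total (t1+s) (t2+s) with h | h
  · have p1 : (t2+s)^2 ≤ (t1+s)*(t2+s) := by nlinarith
    have p2 : (t2+s)^2 ≤ (t1+s)^2 := by nlinarith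
    linarith
  · have p1 : (t1+s)^2 ≤ (t1+s)*(t2+s) := by nlinarith
    have p2 : (t1+s)^2 ≤ (t2+s)^2 := by nlinarith
    linarith

lemma jap_pos {n : ℕ} (x : En n) : 0 < jap x := by rw [jap]; positivity
lemma jap_ge_one {n : ℕ} (x : En n) : 1 ≤ jap x := by
  rw [jap, Real.one_le_sqrt]; nlinarith [sq_nonneg ‖x‖]
lemma jap_ge_norm {n : ℕ} (x : En n) : ‖x‖ ≤ jap x := by
  rw [jap]; apply Real.le_sqrt_of_sq_le; linarith
lemma jap_mono {n m : ℕ} (x : En n) (y : En m) (h : ‖x‖ ≤ ‖y‖) : jap x ≤ jap y := by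
  rw [jap, jap]; gcongr
lemma jap_le {n : ℕ} (x : En n) (R : ℝ) (hR : 1/2 ≤ R) (h : ‖x‖ ≤ 2*R) : jap x ≤ 3 * R := by
  rw [jap, Real.sqrt_le_left (by positivity)]; nlinarith [norm_nonneg x]
lemma jap_cont {n : ℕ} : Continuous (jap : En n → ℝ) := by
  unfold jap; fun_prop
lemma jap_rpow_cont {n : ℕ} (s : ℝ) : Continuous (fun x : En n => jap x ^ s) := 
  jap_cont.rpow_const (fun x => Or.inl (jap_pos x).ne')

/-- the polynomial `p` -/
def pcub {n : ℕ} (θ y ξ : En n) : ℝ := ‖ξ‖^2 * ⟪θ, ξ + y⟫ - 2 * ‖ξ + y‖^2 * ⟪θ, ξ⟫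

lemma kval_ge {n : ℕ} (θ η : En n) (hθ : ‖θ‖ = 1) (h : ⟪η, θ⟫ < 0) : ‖η‖ ≤ kval θ η ∧ 0 < ‖η‖ ∧
    ‖η‖^2 = kval θ η * (-⟪θ, η⟫) ∧ -⟪θ, η⟫ ≤ ‖η‖ ∧ 0 < -⟪θ, η⟫ := by
  rw [real_inner_comm] at h
  have h1 : -⟪θ, η⟫ ≤ ‖η‖ := by
    have := abs_real_inner_le_norm θ η
    rw [hθ, one_mul] at this
    linarith [neg_abs_le ⟪θ, η⟫]
  have h0 : 0 < ‖η‖ := by linarith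
  have h2 : kval θ η = ‖η‖^2 / (-⟪θ, η⟫) := by rw [kval]; rw [div_neg, neg_div]
  have h3 : 0 < -⟪θ, η⟫ := by linarith
  refine ⟨?_, h0, ?_, h1, h3⟩
  · rw [h2, le_div_iff₀ h3]; nlinarith
  · rw [h2, div_mul_cancel₀ _ h3.ne']

lemma phi_eq {n : ℕ} (θ ξ : En n) (k : ℝ) (hθ : ‖θ‖ = 1) :
    ‖ξ - (-(k • θ))‖^2 - k^2 = ‖ξ‖^2 + 2 * k * ⟪θ, ξ⟫ := by
  rw [sub_neg_eq_add, norm_add_sq_real, inner_smul_right, norm_smul, hθ, real_inner_comm, mul_one, Real.norm_eq_abs, sq_abs]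
  ring

lemma ker1_pt {n : ℕ} (θ y ξ : En n) (hθ : ‖θ‖ = 1) (ε α β : ℝ) (hε : 0 < ε) (hε1 : ε < 1/2) (hα : 0 ≤ α) (hβ : 0 ≤ β)
    (h : ⟪ξ + y, θ⟫ < 0) (h1 : 1 ≤ ‖ξ + y‖) (h2 : ‖ξ‖ ≤ ‖ξ + y‖/2) :
    jap (ξ + y) ^ (2*α) * (jap y ^ (-2*β) * (kval θ (ξ+y) ^ (-1+2*ε) * (jap ξ ^ (-2*β) * 
      |‖ξ - (-(kval θ (ξ+y) • θ))‖^2 - kval θ (ξ+y)^2| ^ (-1+ε))))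
    ≤ 3^(2*α) * 2 * ‖y‖^(2*α-2*β+ε) * (jap ξ ^ (-2*β) * |pcub θ y ξ| ^ (-1+ε)) := by
  have hn : ‖ξ + y‖ ≤ ‖ξ‖ + ‖y‖ := norm_add_le _ _
  have hy2 : ‖ξ + y‖ ≤ 2 * ‖y‖ := by linarith
  have hy : 1/2 ≤ ‖y‖ := by linarith
  have hy0 : 0 < ‖y‖ := by linarith
  obtain ⟨g1, g2, g3, g4, g5⟩ := kval_ge θ (ξ+y) hθ h
  set η := ξ + y with hη
  set k := kval θ η with hk
  set u := -⟪θ, η⟫ with hu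
  have hk0 : 0 < k := by linarith
  have hφ : |‖ξ - (-(k • θ))‖^2 - k^2| * u = |pcub θ y ξ| := by
    rw [phi_eq θ ξ k hθ]
    have h7 : (‖ξ‖^2+2*k*⟪θ,ξ⟫)*u = -pcub θ y ξ := by rw [pcub, ← hη, g3, hu]; ring
    rw [← abs_neg (pcub θ y ξ), ← h7, abs_mul, abs_of_pos g5]
  have hφ2 : |‖ξ - (-(k • θ))‖^2 - k^2| = |pcub θ y ξ| / u := by rw [← hφ]; field_simp
  have hk2 : k = ‖η‖^2 / u := by rw [g3]; field_simp
  have e1 : k ^ (-1+2*ε) * |‖ξ - (-(k • θ))‖^2 - k^2| ^ (-1+ε) ≤ ‖η‖^ε * |pcub θ y ξ| ^ (-1+ε) := by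
    rw [hφ2, hk2, Real.div_rpow (by positivity) g5.le, Real.div_rpow (abs_nonneg _) g5.le]
    have : ‖η‖^ε = (‖η‖^2)^(-1+2*ε) * ‖η‖^(2-3*ε) := by
      rw [← Real.rpow_natCast ‖η‖ 2, ← Real.rpow_mul (norm_nonneg _), ← Real.rpow_add g2]
      congr 1; push_cast; ring
    have hu2 : (u^(-1+2*ε))⁻¹ * (u^(-1+ε))⁻¹ = u^(2-3*ε) := by
      rw [← Real.rpow_neg g5.le, ← Real.rpow_neg g5.le, ← Real.rpow_add g5]; congr 1; ring
    rw [this]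
    calc _ = (‖η‖^2)^(-1+2*ε) * ((u^(-1+2*ε))⁻¹ * (u^(-1+ε))⁻¹) * |pcub θ y ξ| ^ (-1+ε) := by
          rw [div_eq_mul_inv, div_eq_mul_inv]; ring
      _ ≤ _ := by
          rw [hu2]
          gcongr
          linarith
  have e2 : jap η ^ (2*α) ≤ 3^(2*α) * ‖y‖^(2*α) := by
    rw [← Real.mul_rpow (by norm_num) hy0.le]
    exact Real.rpow_le_rpow (jap_pos _).le (jap_le η ‖y‖ hy hy2) (by linarith)
  have e3 : jap y ^ (-2*β) ≤ ‖y‖^(-2*β) := 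
    Real.rpow_le_rpow_of_nonpos hy0 (jap_ge_norm y) (by linarith)
  have e4 : ‖η‖^ε ≤ 2 * ‖y‖^ε := by
    calc ‖η‖^ε ≤ (2*‖y‖)^ε := Real.rpow_le_rpow g2.le hy2 hε.le
      _ = 2^ε * ‖y‖^ε := Real.mul_rpow (by norm_num) hy0.le
      _ ≤ _ := by
        gcongr
        calc (2:ℝ)^ε ≤ 2^(1:ℝ) := Real.rpow_le_rpow_of_exponent_le (by norm_num) (by linarith)
          _ = 2 := Real.rpow_one _
  have hjξ : 0 < jap ξ := jap_pos _
  have hjη : 0 < jap η := jap_pos _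
  have hjy : 0 < jap y := jap_pos _
  calc _ = jap η ^ (2*α) * jap y ^ (-2*β) * jap ξ ^ (-2*β) * (k ^ (-1+2*ε) * |‖ξ - (-(k • θ))‖^2 - k^2| ^ (-1+ε)) := by ring
    _ ≤ (3^(2*α) * ‖y‖^(2*α)) * ‖y‖^(-2*β) * jap ξ ^ (-2*β) * ((2 * ‖y‖^ε) * |pcub θ y ξ| ^ (-1+ε)) := by
        have e5 := e1.trans (mul_le_mul_of_nonneg_right e4 (Real.rpow_nonneg (abs_nonneg (pcub θ y ξ)) (-1+ε)))
        refine mul_le_mul ?_ e5 (by positivity) (by positivity)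
        gcongr
    _ = 3^(2*α) * 2 * (‖y‖^(2*α) * ‖y‖^(-2*β) * ‖y‖^ε) * (jap ξ ^ (-2*β) * |pcub θ y ξ| ^ (-1+ε)) := by ring
    _ = _ := by
        rw [← Real.rpow_add hy0, ← Real.rpow_add hy0]
        congr 4; ring
end PartG1

section PartG1b
open scoped Topology

lemma isClosed_le2 {X : Type*} [TopologicalSpace X] {f g f' g' : X → ℝ} (hf : Continuous f) (hg : Continuous g)
    (hf' : Continuous f') (hg' : Continuous g') : IsClosed {x | f x ≤ g x ∧ f' x ≤ g' x} :=
  (isClosed_le hf hg).inter (isClosed_le hf' hg')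

lemma meas_lt_le2 {X : Type*} [TopologicalSpace X] [MeasurableSpace X] [BorelSpace X] {f0 g0 f g f' g' : X → ℝ}
    (hf0 : Continuous f0) (hg0 : Continuous g0) (hf : Continuous f) (hg : Continuous g)
    (hf' : Continuous f') (hg' : Continuous g') : MeasurableSet {x | f0 x < g0 x ∧ f x ≤ g x ∧ f' x ≤ g' x} :=
  (isOpen_lt hf0 hg0).measurableSet.inter (isClosed_le2 hf hg hf' hg').measurableSet

lemma ker1_slice (m : ℕ) (θ y : En (m+1)) (hθ : ‖θ‖ = 1) (hy : 1/2 ≤ ‖y‖) (w : En (m+1)) (hw : ⟪θ, w⟫ = 0)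
    (ε : ℝ) (hε : 0 < ε) (hε1 : ε < 1/2) :
    ∫⁻ t in {t : ℝ | ⟪θ, t • θ + w + y⟫ ≤ 0 ∧ ‖t • θ + w‖ ≤ ‖t • θ + w + y‖/2},
      ENNReal.ofReal (|pcub θ y (t • θ + w)| ^ (-1+ε)) ≤
      ENNReal.ofReal ((8/ε)*((‖y‖^2/3)^(-1+ε)*‖y‖^ε)) := by
  have hθθ : ⟪θ, θ⟫ = 1 := by rw [real_inner_self_eq_norm_sq, hθ]; norm_num
  have n1 : ∀ t : ℝ, ‖t • θ + w‖^2 = t^2 + ‖w‖^2 := by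
    intro t
    rw [norm_add_sq_real, inner_smul_left, hw, norm_smul, hθ, Real.norm_eq_abs, mul_one, sq_abs]; simp
  set s := ⟪θ, y⟫ with hs
  have n2 : ∀ t : ℝ, ‖t • θ + w + y‖^2 = (t+s)^2 + (‖w + y‖^2 - s^2) := by
    intro t
    rw [add_assoc, norm_add_sq_real, inner_smul_left, inner_add_right, hw, norm_smul, hθ, Real.norm_eq_abs, mul_one, sq_abs]
    simp only [conj_trivial]; rw [← hs]; ring
  have n3 : ∀ t : ℝ, ⟪θ, t • θ + w + y⟫ = t + s := by
    intro t
    rw [inner_add_right, inner_add_right, inner_smul_right, hw, hθθ, ← hs]; ring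
  have n4 : ∀ t : ℝ, ⟪θ, t • θ + w⟫ = t := by
    intro t
    rw [inner_add_right, inner_smul_right, hw, hθθ]; ring
  have hb : 0 ≤ ‖w + y‖^2 - s^2 := by
    have h1 := n2 (-s)
    have h2 := sq_nonneg ‖(-s) • θ + w + y‖
    rw [h1] at h2
    nlinarith
  have bd : ∀ t : ℝ, ‖t • θ + w‖ ≤ ‖t • θ + w + y‖/2 → ‖t • θ + w‖ ≤ ‖y‖ ∧ 4 * ‖y‖^2 ≤ 9 * ‖t • θ + w + y‖^2 := by
    intro t ht
    have h1 := norm_add_le (t • θ + w) y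
    have h2 : ‖y‖ ≤ ‖t • θ + w + y‖ + ‖t • θ + w‖ := by
      calc ‖y‖ = ‖(t • θ + w + y) - (t • θ + w)‖ := by congr 1; abel
        _ ≤ _ := norm_sub_le _ _
    refine ⟨by linarith, ?_⟩
    nlinarith [norm_nonneg y, norm_nonneg (t • θ + w + y)]
  have hsub : {t : ℝ | ⟪θ, t • θ + w + y⟫ ≤ 0 ∧ ‖t • θ + w‖ ≤ ‖t • θ + w + y‖/2} ⊆ Icc (-‖y‖) ‖y‖ := by
    rintro t ⟨_, ht⟩
    have h1 := (bd t ht).1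
    have h2 := n1 t
    rw [Set.mem_Icc, ← abs_le]
    apply abs_le_of_sq_le_sq _ (norm_nonneg _)
    nlinarith [norm_nonneg (t • θ + w), sq_nonneg ‖w‖]
  apply sublevel ε hε (by linarith) _ _ ‖y‖ (‖y‖^2/3) (by linarith) (by positivity) hsub
  · unfold pcub; fun_prop
  · rintro t ⟨a1, a2⟩ t' ⟨b1, b2⟩
    have := cubic_alg t t' s (‖w‖^2) (‖w+y‖^2 - s^2) (‖y‖^2) (sq_nonneg _) hb
      (by rw [← n3]; exact a1) (by rw [← n3]; exact b1)
      (by rw [← n1, ← n2]; nlinarith [norm_nonneg (t • θ + w)])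
      (by rw [← n1, ← n2]; nlinarith [norm_nonneg (t' • θ + w)])
      (by rw [← n2]; exact (bd t a2).2) (by rw [← n2]; exact (bd t' b2).2)
    simp only [pcub, n1, n2, n3, n4]
    exact this
  · apply Metric.isCompact_of_isClosed_isBounded
    · apply isClosed_le2 <;> fun_prop
    · exact Metric.isBounded_Icc _ _ |>.subset hsub

lemma rpow_half (Y E : ℝ) (hY : 1/2 ≤ Y) (hE : E ≤ 0) : Y^E ≤ (1/2:ℝ)^E :=
  Real.rpow_le_rpow_of_nonpos (by norm_num) hY hE

lemma ker1 (m : ℕ) (α β μ ε : ℝ) (hε : 0 < ε) (hε1 : ε < 1/2) (hα : 0 ≤ α) (hβ : 0 ≤ β) (hμ : 0 ≤ μ)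
    (hm : (m:ℝ) ≤ 2*β+μ) (hE : 2*α-2*β-2+μ+5*ε ≤ 0) : ∃ C : ℝ≥0∞, C ≠ ⊤ ∧ ∀ θ : En (m+1), ‖θ‖ = 1 → ∀ y : En (m+1),
    ∫⁻ η in {η : En (m+1) | ⟪η, θ⟫ < 0 ∧ 1 ≤ ‖η‖ ∧ ‖η - y‖ ≤ ‖η‖/2},
      ENNReal.ofReal (jap η ^ (2*α) * (jap y ^ (-2*β) * (kval θ η ^ (-1+2*ε) * (jap (η-y) ^ (-2*β) * 
      |‖(η - y) - (-(kval θ η • θ))‖^2 - kval θ η^2| ^ (-1+ε))))) ≤ C := by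
  obtain ⟨Cz, hCz, hz⟩ := z_int m β μ ε hε hμ hm
  set K0 : ℝ := 3^(2*α) * 2 * (8/ε * (1/3)^(-1+ε)) with hK0
  refine ⟨Cz * ENNReal.ofReal (K0 * (1/2)^(2*α-2*β-2+μ+5*ε)), by finiteness, ?_⟩
  intro θ hθ y
  set T : Set (En (m+1)) := {η : En (m+1) | ⟪η, θ⟫ < 0 ∧ 1 ≤ ‖η‖ ∧ ‖η - y‖ ≤ ‖η‖/2} with hT
  by_cases hy : ‖y‖ < 1/2
  · have : T = ∅ := by
      ext η
      simp only [hT, Set.mem_ofPred_eq, Set.mem_empty_iff_false, iff_false]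
      rintro ⟨_, h1, h2⟩
      have : ‖η‖ ≤ ‖η - y‖ + ‖y‖ := by
        calc ‖η‖ = ‖(η - y) + y‖ := by simp
          _ ≤ _ := norm_add_le _ _
      linarith
    rw [this]; simp
  push Not at hy
  have hy0 : 0 < ‖y‖ := by linarith
  have mT : MeasurableSet T := by
    apply meas_lt_le2 <;> fun_prop
  set S : Set (En (m+1)) := {ξ | ⟪θ, ξ + y⟫ ≤ 0 ∧ ‖ξ‖ ≤ ‖ξ + y‖/2} with hS
  have mS : MeasurableSet S := by
    apply IsClosed.measurableSet; apply isClosed_le2 <;> fun_prop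
  set K : ℝ := 3^(2*α) * 2 * ‖y‖^(2*α-2*β+ε) with hK
  have hK0' : 0 ≤ K := by positivity
  set H : En (m+1) → ℝ≥0∞ := S.indicator (fun ξ => ENNReal.ofReal (jap ξ ^ (-2*β) * |pcub θ y ξ| ^ (-1+ε))) with hH
  have mH : Measurable H := by
    apply Measurable.indicator _ mS
    have c1 : Continuous (fun ξ : En (m+1) => |pcub θ y ξ|) := by unfold pcub; fun_prop
    exact ((jap_rpow_cont (-2*β)).measurable.mul (c1.measurable.pow_const _)).ennreal_ofReal
  rw [← lintegral_indicator mT]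
  rw [← lintegral_add_right_eq_self _ y]
  have step1 : ∀ ξ : En (m+1), T.indicator (fun η => ENNReal.ofReal (jap η ^ (2*α) * (jap y ^ (-2*β) * (kval θ η ^ (-1+2*ε) * (jap (η-y) ^ (-2*β) * 
      |‖(η - y) - (-(kval θ η • θ))‖^2 - kval θ η^2| ^ (-1+ε)))))) (ξ + y) ≤ ENNReal.ofReal K * H ξ := by
    intro ξ
    by_cases h : ξ + y ∈ T
    · rw [Set.indicator_of_mem h]
      obtain ⟨h1, h2, h3⟩ := h
      rw [add_sub_cancel_right] at h3
      have hξ : ξ ∈ S := ⟨by rw [real_inner_comm]; exact h1.le, h3⟩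
      rw [hH, Set.indicator_of_mem hξ, ← ENNReal.ofReal_mul hK0', add_sub_cancel_right]
      exact ENNReal.ofReal_le_ofReal (ker1_pt θ y ξ hθ ε α β hε hε1 hα hβ h1 h2 h3)
    · rw [Set.indicator_of_notMem h]; exact zero_le
  refine (lintegral_mono step1).trans ?_
  rw [lintegral_const_mul _ mH]
  obtain ⟨L, cL, L1, L2, L3⟩ := slice m θ hθ
  rw [L3 H mH]
  set Q : ℝ := (8/ε)*((‖y‖^2/3)^(-1+ε)*‖y‖^ε) with hQ
  set Z : Set (Fin m → ℝ) := {z : Fin m→ℝ | ‖(WithLp.toLp 2 z : En m)‖ ≤ 2*‖y‖} with hZ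
  have mZ : MeasurableSet Z := by
    have : Continuous (fun z : Fin m → ℝ => (WithLp.toLp 2 z : En m)) := by fun_prop
    exact (isClosed_le (by fun_prop) (by fun_prop)).measurableSet
  have step2 : ∀ z, ∫⁻ t : ℝ, H (t • θ + L z) ≤ Z.indicator (fun z => ENNReal.ofReal (jap (WithLp.toLp 2 z : En m)^(-2*β)) * ENNReal.ofReal Q) z := by
    intro z
    have hL : ∀ t : ℝ, ‖L z‖ ≤ ‖t • θ + L z‖ := by
      intro t
      apply le_of_sq_le_sq _ (norm_nonneg _)
      rw [norm_add_sq_real, inner_smul_left, L1]; simp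
    by_cases hz : z ∈ Z
    · rw [Set.indicator_of_mem hz]
      refine le_trans ?_ (mul_le_mul_right (ker1_slice m θ y hθ hy (L z) (L1 z) ε hε hε1) _)
      rw [← lintegral_const_mul' _ _ ENNReal.ofReal_ne_top, ← lintegral_indicator]
      · apply lintegral_mono
        intro t
        beta_reduce
        by_cases ht : t • θ + L z ∈ S
        · rw [hH, Set.indicator_of_mem ht, Set.indicator_of_mem (by exact ht), ← ENNReal.ofReal_mul (Real.rpow_nonneg (jap_pos _).le _)]
          apply ENNReal.ofReal_le_ofReal
          refine mul_le_mul_of_nonneg_right ?_ (by positivity)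
          have hjm := jap_mono (WithLp.toLp 2 z : En m) (t • θ + L z) ((L2 z).symm.le.trans (hL t))
          exact Real.rpow_le_rpow_of_nonpos (jap_pos _) hjm (by linarith)
        · rw [hH, Set.indicator_of_notMem ht]; exact zero_le
      · apply IsClosed.measurableSet; apply isClosed_le2 <;> fun_prop
    · rw [Set.indicator_of_notMem hz]
      have : ∀ t : ℝ, H (t • θ + L z) = 0 := by
        intro t
        apply Set.indicator_of_notMem
        rintro ⟨_, h2⟩
        apply hz
        have h1 := norm_add_le (t • θ + L z) y
        have h3 := hL t
        rw [L2] at h3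
        rw [hZ, Set.mem_ofPred_eq]
        linarith
      simp [this]
  calc ENNReal.ofReal K * ∫⁻ z, ∫⁻ t : ℝ, H (t • θ + L z) 
      ≤ ENNReal.ofReal K * ((Cz * ENNReal.ofReal (‖y‖^(μ+ε))) * ENNReal.ofReal Q) := by
        gcongr
        refine (lintegral_mono step2).trans ?_
        rw [lintegral_indicator mZ, lintegral_mul_const' _ _ ENNReal.ofReal_ne_top]
        gcongr
        exact hz ‖y‖ hy
    _ = Cz * ENNReal.ofReal (K * ‖y‖^(μ+ε) * Q) := by
        rw [ENNReal.ofReal_mul (p := K * ‖y‖^(μ+ε)) (by positivity), ENNReal.ofReal_mul (p := K) (by positivity)]; ring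
    _ ≤ _ := by
        refine mul_le_mul_right (ENNReal.ofReal_le_ofReal ?_) _
        have : K * ‖y‖^(μ+ε) * Q = K0 * ‖y‖^(2*α-2*β-2+μ+5*ε) := by
          have h1 : (‖y‖^2/3)^(-1+ε) = ‖y‖^(-2+2*ε) * (1/3)^(-1+ε) := by
            rw [div_eq_mul_one_div, Real.mul_rpow (by positivity) (by norm_num), ← Real.rpow_natCast ‖y‖ 2, ← Real.rpow_mul hy0.le]
            congr 2; push_cast; ring
          have h2 : ‖y‖^(2*α-2*β-2+μ+5*ε) = ‖y‖^(2*α-2*β+ε) * ‖y‖^(μ+ε) * ‖y‖^(-2+2*ε) * ‖y‖^ε := by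
            rw [← Real.rpow_add hy0, ← Real.rpow_add hy0, ← Real.rpow_add hy0]; congr 1; ring
          rw [hK, hQ, hK0, h1, h2]; ring
        rw [this]
        have := rpow_half ‖y‖ _ hy hE
        gcongr
end PartG1b

section PartG2
open scoped Topology

lemma dil_avg (n : ℕ) (G : En n → ℝ≥0∞) (hG : Measurable G) :
    ∫⁻ x, G x ≤ ENNReal.ofReal (2^n) * ∫⁻ x, ∫⁻ l in Icc (1:ℝ) 2, G (l • x) := by
  have h1 : ∀ l ∈ Icc (1:ℝ) 2, ∫⁻ x, G x ≤ ENNReal.ofReal (2^n) * ∫⁻ x, G (l • x) := by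
    intro l hl
    have hl0 : 0 < l := by linarith [hl.1]
    have h2 : ∫⁻ x, G (l • x) = ENNReal.ofReal ((l^n)⁻¹) * ∫⁻ x, G x := by
      rw [← lintegral_map (f := G) (g := fun x : En n => l • x) hG (measurable_const_smul l),
        Measure.map_addHaar_smul _ hl0.ne', lintegral_smul_measure, abs_of_pos (by positivity)]
      simp
    rw [h2, ← mul_assoc, ← ENNReal.ofReal_mul (by positivity)]
    calc ∫⁻ x, G x = 1 * ∫⁻ x, G x := (one_mul _).symm
      _ ≤ _ := by
        refine mul_le_mul_left ?_ _
        rw [ENNReal.one_le_ofReal, ← div_eq_mul_inv, le_div_iff₀ (by positivity), one_mul]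
        exact pow_le_pow_left₀ hl0.le hl.2 _
  have hm : Measurable (fun p : En n × ℝ => G (p.2 • p.1)) := by
    exact hG.comp (measurable_snd.smul measurable_fst)
  rw [lintegral_lintegral_swap hm.aemeasurable]
  calc ∫⁻ x, G x = ∫⁻ l in Icc (1:ℝ) 2, ∫⁻ x, G x := by
        rw [setLIntegral_const, Real.volume_Icc]; norm_num
    _ ≤ ∫⁻ l in Icc (1:ℝ) 2, ENNReal.ofReal (2^n) * ∫⁻ x, G (l • x) := 
        setLIntegral_mono' measurableSet_Icc h1
    _ = _ := lintegral_const_mul' _ _ ENNReal.ofReal_ne_top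

lemma kval_smul {n : ℕ} (θ η : En n) (l : ℝ) (hl : 0 < l) : kval θ (l • η) = l * kval θ η := by
  rw [kval, kval, norm_smul, inner_smul_right, Real.norm_eq_abs, abs_of_pos hl]
  by_cases h : ⟪θ, η⟫ = 0
  · simp [h]
  · field_simp

lemma kval_meas {n : ℕ} (θ : En n) : Measurable (kval θ) := by
  unfold kval
  apply Measurable.div
  · exact (by fun_prop : Continuous fun η : En n => -‖η‖^2).measurable
  · exact (by fun_prop : Continuous fun η : En n => ⟪θ, η⟫).measurable

set_option maxHeartbeats 1600000 in
lemma ker2 (m : ℕ) (α β μ ε : ℝ) (hε : 0 < ε) (hε1 : ε < 1/2) (hα : 0 ≤ α) (hβ : 0 ≤ β) (hμ : 0 ≤ μ)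
    (hm : (m:ℝ) ≤ 2*β+μ) (hE : 2*α-2*β-2+μ+5*ε ≤ 0) : ∃ C : ℝ≥0∞, C ≠ ⊤ ∧ ∀ θ : En (m+1), ‖θ‖ = 1 → ∀ ξ : En (m+1),
    ∫⁻ η in {η : En (m+1) | ⟪η, θ⟫ < 0 ∧ 1 ≤ ‖η‖ ∧ ‖η‖ ≤ 2*‖ξ‖},
      ENNReal.ofReal (jap η ^ (2*α) * (jap ξ ^ (-2*β) * (kval θ η ^ (-1+2*ε) * (jap (η-ξ) ^ (-2*β) * 
      |‖ξ - (-(kval θ η • θ))‖^2 - kval θ η^2| ^ (-1+ε))))) ≤ C := by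
  obtain ⟨Cz, hCz, hz⟩ := z_int m β μ ε hε hμ hm
  obtain ⟨Ca, hCa, ha⟩ := avg_bound ε hε (by linarith)
  set K0 : ℝ := 2^(m+1) * (3^(2*α) * Ca * (2 * 2^(2*ε)/(2*ε))) with hK0
  have hK00 : 0 ≤ K0 := by positivity
  refine ⟨Cz * ENNReal.ofReal (K0 * (1/2)^(2*α-2*β-2+μ+5*ε)), by finiteness, ?_⟩
  intro θ hθ ξ
  set T : Set (En (m+1)) := {η : En (m+1) | ⟪η, θ⟫ < 0 ∧ 1 ≤ ‖η‖ ∧ ‖η‖ ≤ 2*‖ξ‖} with hT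
  by_cases hy : ‖ξ‖ < 1/2
  · have : T = ∅ := by
      ext η
      simp only [hT, Set.mem_ofPred_eq, Set.mem_empty_iff_false, iff_false]
      rintro ⟨_, h1, h2⟩
      linarith
    rw [this]; simp
  push Not at hy
  have hy0 : 0 < ‖ξ‖ := by linarith
  have mT : MeasurableSet T := by
    apply meas_lt_le2 <;> fun_prop
  set K : ℝ := 3^(2*α) * ‖ξ‖^(2*α-2*β) with hK
  have hK0' : 0 ≤ K := by positivity
  set G : En (m+1) → ℝ≥0∞ := T.indicator (fun η => ENNReal.ofReal (kval θ η ^ (-1+2*ε) * (jap (η-ξ) ^ (-2*β) * 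
      |‖ξ‖^2 + 2 * kval θ η * ⟪θ, ξ⟫| ^ (-1+ε)))) with hG
  have mG : Measurable G := by
    apply Measurable.indicator _ mT
    have k1 := kval_meas θ
    have c1 : Measurable (fun η : En (m+1) => |‖ξ‖^2 + 2 * kval θ η * ⟪θ, ξ⟫|) := by 
      have c0 : Continuous (fun k : ℝ => |‖ξ‖^2 + 2 * k * ⟪θ, ξ⟫|) := by fun_prop
      exact c0.measurable.comp k1
    have c2 : Measurable (fun η : En (m+1) => jap (η - ξ) ^ (-2*β)) := 
      ((jap_rpow_cont (-2*β)).comp (by fun_prop : Continuous fun η : En (m+1) => η - ξ)).measurable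
    exact ((k1.pow_const _).mul (c2.mul (c1.pow_const _))).ennreal_ofReal
  have step0 : ∫⁻ η in T, ENNReal.ofReal (jap η ^ (2*α) * (jap ξ ^ (-2*β) * (kval θ η ^ (-1+2*ε) * (jap (η-ξ) ^ (-2*β) * 
      |‖ξ - (-(kval θ η • θ))‖^2 - kval θ η^2| ^ (-1+ε))))) ≤ ENNReal.ofReal K * ∫⁻ η, G η := by
    rw [hG, lintegral_indicator mT, ← lintegral_const_mul' _ _ ENNReal.ofReal_ne_top]
    apply setLIntegral_mono' mT
    rintro η ⟨h1, h2, h3⟩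
    rw [← ENNReal.ofReal_mul hK0', phi_eq θ ξ _ hθ, ← mul_assoc]
    apply ENNReal.ofReal_le_ofReal
    obtain ⟨g1, g2, -⟩ := kval_ge θ η hθ h1
    have hjη : 0 < jap (η-ξ) := jap_pos _
    have hjη' : 0 < jap η := jap_pos _
    have hjξ' : 0 < jap ξ := jap_pos _
    have hk0 : 0 < kval θ η := by linarith
    refine mul_le_mul_of_nonneg_right ?_ (by positivity)
    have e2 : jap η ^ (2*α) ≤ 3^(2*α) * ‖ξ‖^(2*α) := by
      rw [← Real.mul_rpow (by norm_num) hy0.le]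
      exact Real.rpow_le_rpow (jap_pos _).le (jap_le η ‖ξ‖ hy h3) (by linarith)
    have e3 : jap ξ ^ (-2*β) ≤ ‖ξ‖^(-2*β) := 
      Real.rpow_le_rpow_of_nonpos hy0 (jap_ge_norm ξ) (by linarith)
    have e4 : ‖ξ‖^(2*α-2*β) = ‖ξ‖^(2*α) * ‖ξ‖^(-2*β) := by
      rw [← Real.rpow_add hy0]; congr 1; ring
    rw [hK, e4, ← mul_assoc]
    exact mul_le_mul e2 e3 (by positivity) (by positivity)
  refine step0.trans ?_
  set J : En (m+1) → ℝ≥0∞ := fun x => ∫⁻ l in Icc (1:ℝ) 2, G (l • x) with hJ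
  have mJ : Measurable J := by
    have hm : Measurable (fun p : En (m+1) × ℝ => G (p.2 • p.1)) := mG.comp (measurable_snd.smul measurable_fst)
    exact hm.lintegral_prod_right'
  set e : En (m+1) := ‖ξ‖⁻¹ • ξ with he
  have he1 : ‖e‖ = 1 := by rw [he, norm_smul, norm_inv, norm_norm, inv_mul_cancel₀ hy0.ne']
  have heξ : ξ = ‖ξ‖ • e := by rw [he, smul_smul, mul_inv_cancel₀ hy0.ne', one_smul]
  obtain ⟨L, cL, L1, L2, L3⟩ := slice m e he1
  have hLn : ∀ (t : ℝ) z, ‖t • e + L z‖^2 = t^2 + ‖(WithLp.toLp 2 z : En m)‖^2 := by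
    intro t z
    rw [norm_add_sq_real, inner_smul_left, L1, norm_smul, he1, L2, Real.norm_eq_abs, mul_one, sq_abs]; simp
  set Q : ℝ := Ca * (‖ξ‖^2)^(-1+ε) with hQ
  have step2 : ∀ (t : ℝ) z, t ≠ 0 → J (t • e + L z) ≤ ENNReal.ofReal (|t|^(-1+2*ε) * jap (WithLp.toLp 2 z : En m)^(-2*β)) * ENNReal.ofReal Q := by
    intro t z ht
    have ht0 : 0 < |t| := abs_pos.2 ht
    set η := t • e + L z with hη
    have hjz : 0 < jap (WithLp.toLp 2 z : En m) := jap_pos _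
    refine le_trans ?_ (mul_le_mul_right (ha (‖ξ‖^2) (2 * kval θ η * ⟪θ, ξ⟫) (by positivity)) _)
    rw [← lintegral_const_mul' _ _ ENNReal.ofReal_ne_top]
    apply setLIntegral_mono' measurableSet_Icc
    intro l hl
    have hl0 : 0 < l := by linarith [hl.1]
    by_cases hlη : l • η ∈ T
    · rw [hG, Set.indicator_of_mem hlη, ← ENNReal.ofReal_mul (by positivity)]
      apply ENNReal.ofReal_le_ofReal
      obtain ⟨h1, h2, h3⟩ := hlη
      have h1' : ⟪η, θ⟫ < 0 := by
        rw [inner_smul_left] at h1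
        simp only [conj_trivial] at h1
        by_contra hc
        push Not at hc
        linarith [mul_nonneg hl0.le hc]
      obtain ⟨g1, g2, -⟩ := kval_ge θ η hθ h1'
      rw [kval_smul θ η l hl0, show 2 * (l * kval θ η) * ⟪θ, ξ⟫ = l * (2 * kval θ η * ⟪θ, ξ⟫) by ring, ← mul_assoc]
      refine mul_le_mul_of_nonneg_right ?_ (by positivity)
      have hjl : 0 < jap (l • η - ξ) := jap_pos _
      have a1 : |t| ≤ ‖η‖ := by
        apply abs_le_of_sq_le_sq _ (norm_nonneg _)
        rw [hη, hLn]; nlinarith [sq_nonneg ‖(WithLp.toLp 2 z : En m)‖]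
      have a2 : |t| ≤ l * kval θ η := by nlinarith [hl.1]
      have a3 : ‖(WithLp.toLp 2 z : En m)‖ ≤ ‖l • η - ξ‖ := by
        have e1 : l • η - ξ = (l * t - ‖ξ‖) • e + l • L z := by
          conv_lhs => rw [heξ, hη]
          rw [smul_add, sub_smul, smul_smul]; abel
        apply le_of_sq_le_sq _ (norm_nonneg _)
        rw [e1, norm_add_sq_real, inner_smul_left, inner_smul_right, L1, norm_smul l, L2, Real.norm_eq_abs, abs_of_pos hl0]
        simp only [mul_zero, add_zero]
        have : ‖(WithLp.toLp 2 z : En m)‖ ≤ l * ‖(WithLp.toLp 2 z : En m)‖ := by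
          nlinarith [norm_nonneg (WithLp.toLp 2 z : En m), hl.1]
        nlinarith [norm_nonneg (WithLp.toLp 2 z : En m), sq_nonneg ‖(l * t - ‖ξ‖) • e‖]
      refine mul_le_mul ?_ ?_ (by positivity) (by positivity)
      · exact Real.rpow_le_rpow_of_nonpos ht0 a2 (by linarith)
      · exact Real.rpow_le_rpow_of_nonpos hjz (jap_mono _ _ a3) (by linarith)
    · rw [hG, Set.indicator_of_notMem hlη]; exact zero_le
  have step3 : ∀ (t : ℝ) z, 2 * ‖ξ‖ < ‖t • e + L z‖ → J (t • e + L z) = 0 := by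
    intro t z h
    rw [hJ]; beta_reduce
    rw [setLIntegral_congr_fun (g := fun _ => 0) measurableSet_Icc, lintegral_zero]
    intro l hl
    apply Set.indicator_of_notMem
    rintro ⟨-, -, h3⟩
    rw [norm_smul, Real.norm_eq_abs, abs_of_pos (by linarith [hl.1])] at h3
    nlinarith [hl.1, norm_nonneg (t • e + L z)]
  set Z : Set (Fin m → ℝ) := {z : Fin m→ℝ | ‖(WithLp.toLp 2 z : En m)‖ ≤ 2*‖ξ‖} with hZ
  have mZ : MeasurableSet Z := by
    have : Continuous (fun z : Fin m → ℝ => (WithLp.toLp 2 z : En m)) := by fun_prop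
    exact (isClosed_le (by fun_prop) (by fun_prop)).measurableSet
  set V : ℝ := 2 * (2*‖ξ‖)^(2*ε)/(2*ε) with hV
  have step4 : ∀ z, ∫⁻ t : ℝ, J (t • e + L z) ≤ Z.indicator (fun z => ENNReal.ofReal (jap (WithLp.toLp 2 z : En m)^(-2*β)) * ENNReal.ofReal (V * Q)) z := by
    intro z
    by_cases hz : z ∈ Z
    · rw [Set.indicator_of_mem hz]
      have hjz : 0 < jap (WithLp.toLp 2 z : En m) := jap_pos _
      have hV0 : 0 ≤ V := by positivity
      have b1 := lint_rpow_ball (2*ε) (2*‖ξ‖) 0 (by linarith) (by linarith)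
      calc ∫⁻ t : ℝ, J (t • e + L z) ≤ ∫⁻ t : ℝ, (Icc (0-2*‖ξ‖) (0+2*‖ξ‖)).indicator (fun t => ENNReal.ofReal (|t-0|^(-1+2*ε))) t * 
            ENNReal.ofReal (jap (WithLp.toLp 2 z : En m)^(-2*β) * Q) := by
            apply lintegral_mono_ae
            have hae : ∀ᵐ t : ℝ, t ≠ 0 := by
              rw [ae_iff]; simp
            filter_upwards [hae] with t ht
            by_cases hI : t ∈ Icc (0-2*‖ξ‖) (0+2*‖ξ‖)
            · rw [Set.indicator_of_mem hI, sub_zero, ← ENNReal.ofReal_mul (by positivity)]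
              refine (step2 t z ht).trans (le_of_eq ?_)
              rw [← ENNReal.ofReal_mul (by positivity)]
              congr 1; ring
            · rw [step3 t z]
              · exact zero_le
              · by_contra hc
                push Not at hc
                apply hI
                rw [Set.mem_Icc, zero_sub, zero_add, ← abs_le]
                apply abs_le_of_sq_le_sq _ (by positivity)
                have := hLn t z
                nlinarith [norm_nonneg (t • e + L z), sq_nonneg ‖(WithLp.toLp 2 z : En m)‖]
        _ ≤ ENNReal.ofReal V * ENNReal.ofReal (jap (WithLp.toLp 2 z : En m)^(-2*β) * Q) := by
            rw [lintegral_mul_const' _ _ ENNReal.ofReal_ne_top, lintegral_indicator measurableSet_Icc]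
            exact mul_le_mul_left b1 _
        _ = _ := by
            rw [← ENNReal.ofReal_mul hV0, ← ENNReal.ofReal_mul (by positivity)]
            congr 1; ring
    · rw [Set.indicator_of_notMem hz]
      have : ∀ t : ℝ, J (t • e + L z) = 0 := by
        intro t
        apply step3
        by_contra hc
        push Not at hc
        apply hz
        rw [hZ, Set.mem_ofPred_eq]
        apply le_of_sq_le_sq _ (by positivity)
        have := hLn t z
        nlinarith [norm_nonneg (t • e + L z), sq_nonneg t]
      simp [this]
  calc ENNReal.ofReal K * ∫⁻ η, G η ≤ ENNReal.ofReal K * (ENNReal.ofReal (2^(m+1)) * ∫⁻ x, J x) :=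
        mul_le_mul_right (dil_avg (m+1) G mG) _
    _ = ENNReal.ofReal K * (ENNReal.ofReal (2^(m+1)) * ∫⁻ z, ∫⁻ t : ℝ, J (t • e + L z)) := by rw [L3 J mJ]
    _ ≤ ENNReal.ofReal K * (ENNReal.ofReal (2^(m+1)) * ((Cz * ENNReal.ofReal (‖ξ‖^(μ+ε))) * ENNReal.ofReal (V * Q))) := by
        refine mul_le_mul_right (mul_le_mul_right ?_ _) _
        refine (lintegral_mono step4).trans ?_
        rw [lintegral_indicator mZ, lintegral_mul_const' _ _ ENNReal.ofReal_ne_top]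
        exact mul_le_mul_left (hz ‖ξ‖ hy) _
    _ = Cz * ENNReal.ofReal (K * 2^(m+1) * ‖ξ‖^(μ+ε) * (V * Q)) := by
        rw [ENNReal.ofReal_mul (p := K * 2^(m+1) * ‖ξ‖^(μ+ε)) (by positivity), ENNReal.ofReal_mul (p := K * 2^(m+1)) (by positivity), ENNReal.ofReal_mul (p := K) (by positivity)]; ring
    _ ≤ _ := by
        refine mul_le_mul_right (ENNReal.ofReal_le_ofReal ?_) _
        have : K * 2^(m+1) * ‖ξ‖^(μ+ε) * (V * Q) = K0 * ‖ξ‖^(2*α-2*β-2+μ+5*ε) := by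
          have h1 : (‖ξ‖^2)^(-1+ε) = ‖ξ‖^(-2+2*ε) := by
            rw [← Real.rpow_natCast ‖ξ‖ 2, ← Real.rpow_mul hy0.le]
            congr 1; push_cast; ring
          have h3 : (2 * ‖ξ‖)^(2*ε) = 2^(2*ε) * ‖ξ‖^(2*ε) := Real.mul_rpow (by norm_num) hy0.le
          have h2 : ‖ξ‖^(2*α-2*β-2+μ+5*ε) = ‖ξ‖^(2*α-2*β) * ‖ξ‖^(μ+ε) * ‖ξ‖^(-2+2*ε) * ‖ξ‖^(2*ε) := by
            rw [← Real.rpow_add hy0, ← Real.rpow_add hy0, ← Real.rpow_add hy0]; congr 1; ring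
          rw [hK, hQ, hV, hK0, h1, h2, h3]; ring
        rw [this]
        exact mul_le_mul_of_nonneg_left (rpow_half ‖ξ‖ _ hy hE) hK00
end PartG2

section PartH
open scoped Topology

lemma cs_w {X : Type*} [MeasurableSpace X] (μ : Measure X) (f g w : X → ℝ≥0∞) (hf : AEMeasurable f μ) 
    (hg : AEMeasurable g μ) (hw : AEMeasurable w μ) :
    (∫⁻ x, f x * g x * w x ∂μ)^2 ≤ (∫⁻ x, f x ^2 * w x ∂μ) * (∫⁻ x, g x ^ 2 * w x ∂μ) := by
  have h := ENNReal.lintegral_mul_le_Lp_mul_Lq μ (p := 2) (q := 2) (by constructor <;> norm_num)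
    (f := fun x => f x * w x ^ (1/2:ℝ)) (g := fun x => g x * w x ^ (1/2:ℝ)) 
    (hf.mul (hw.pow_const _)) (hg.mul (hw.pow_const _))
  have hw2 : ∀ x, w x ^ (1/2:ℝ) * w x ^ (1/2:ℝ) = w x := by
    intro x; rw [← ENNReal.rpow_add_of_nonneg _ _ (by norm_num) (by norm_num)]; norm_num
  have e1 : ∀ u : X → ℝ≥0∞, (∫⁻ x, (u x * w x ^ (1/2:ℝ)) ^ (2:ℝ) ∂μ) = ∫⁻ x, u x ^ 2 * w x ∂μ := by
    intro u
    congr 1; ext x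
    rw [show (2:ℝ) = ((2:ℕ):ℝ) by norm_num, ENNReal.rpow_natCast, mul_pow, sq (w x ^ _)]
    have := hw2 x
    norm_num at this ⊢
    rw [this]
  rw [e1, e1] at h
  have e2 : (∫⁻ x, f x * g x * w x ∂μ) ≤ (∫⁻ x, f x ^2 * w x ∂μ)^(1/2:ℝ) * (∫⁻ x, g x ^ 2 * w x ∂μ)^(1/2:ℝ) := by
    refine le_trans (le_of_eq ?_) h
    congr 1; ext x
    simp only [Pi.mul_apply]
    rw [← hw2 x]; 
    have := hw2 x
    rw [this]
    calc f x * g x * w x = f x * g x * (w x ^ (1/2:ℝ) * w x ^ (1/2:ℝ)) := by rw [hw2 x]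
      _ = _ := by ring
  have e3 : ∀ A : ℝ≥0∞, (A^(1/2:ℝ))^2 = A := by
    intro A
    rw [← ENNReal.rpow_natCast, ← ENNReal.rpow_mul]; norm_num
  calc _ ≤ ((∫⁻ x, f x ^2 * w x ∂μ)^(1/2:ℝ) * (∫⁻ x, g x ^ 2 * w x ∂μ)^(1/2:ℝ))^2 := by gcongr
    _ = _ := by rw [mul_pow, e3, e3]

/-- singular weight -/
def wgt {n : ℕ} (θ : En n) (ε : ℝ) (η ξ : En n) : ℝ≥0∞ :=
  ENNReal.ofReal (|‖ξ - (-(kval θ η • θ))‖^2 - kval θ η^2| ^ (-1+ε))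

/-- the full kernel -/
def Wk {n : ℕ} (θ : En n) (α β ε : ℝ) (η ξ : En n) : ℝ≥0∞ :=
  ENNReal.ofReal (jap η ^ (2*α)) * (ENNReal.ofReal (kval θ η ^ (-1+2*ε)) *
    ((ENNReal.ofReal (jap ξ ^ (-β)) * ENNReal.ofReal (jap (η-ξ) ^ (-β)))^2 * wgt θ ε η ξ))

/-- H1 norm squared -/
def H1n {n : ℕ} (u : 𝓢(En n, ℂ)) : ℝ≥0∞ := ∫⁻ ζ, (‖u ζ‖ₑ^2 + ‖fderiv ℝ u ζ‖ₑ^2)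

lemma jap_sq {n : ℕ} (x : En n) (β : ℝ) : (ENNReal.ofReal (jap x ^ (-β)))^2 = ENNReal.ofReal (jap x ^ (-2*β)) := by
  have := jap_pos x
  rw [← ENNReal.ofReal_pow (by positivity), ← Real.rpow_natCast, ← Real.rpow_mul this.le]
  congr 2; push_cast; ring

lemma Wk_eq {n : ℕ} (θ : En n) (hθ : ‖θ‖ = 1) (α β ε : ℝ) (η ξ : En n) (h : ⟪η, θ⟫ < 0) :
    Wk θ α β ε η ξ = ENNReal.ofReal (jap η ^ (2*α) * (jap ξ ^ (-2*β) * (kval θ η ^ (-1+2*ε) * (jap (η-ξ) ^ (-2*β) * 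
      |‖ξ - (-(kval θ η • θ))‖^2 - kval θ η^2| ^ (-1+ε))))) := by
  obtain ⟨g1, g2, -⟩ := kval_ge θ η hθ h
  have hk : 0 < kval θ η := by linarith
  have h1 := jap_pos η
  have h2 := jap_pos ξ
  have h3 := jap_pos (η - ξ)
  rw [Wk, mul_pow, jap_sq, jap_sq, wgt, ENNReal.ofReal_mul (by positivity), ENNReal.ofReal_mul (by positivity), 
    ENNReal.ofReal_mul (by positivity), ENNReal.ofReal_mul (by positivity)]
  ring

lemma wgt_meas {n : ℕ} (θ : En n) (ε : ℝ) : Measurable (fun p : En n × En n => wgt θ ε p.1 p.2) := by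
  have k1 : Measurable (fun p : En n × En n => kval θ p.1) := (kval_meas θ).comp measurable_fst
  have k2 : Measurable (fun p : En n × En n => (kval θ p.1, p.2)) := k1.prodMk measurable_snd
  have c : Continuous (fun p : ℝ × En n => |‖p.2 - (-(p.1 • θ))‖^2 - p.1^2|) := by fun_prop
  exact ((c.measurable.comp k2).pow_const _).ennreal_ofReal

lemma wgt_meas2 {n : ℕ} (θ : En n) (ε : ℝ) (η : En n) : Measurable (fun ξ => wgt θ ε η ξ) := by
  have c : Continuous (fun ξ : En n => |‖ξ - (-(kval θ η • θ))‖^2 - kval θ η^2|) := by fun_prop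
  exact (c.measurable.pow_const _).ennreal_ofReal

lemma Wk_meas {n : ℕ} (θ : En n) (α β ε : ℝ) : Measurable (fun p : En n × En n => Wk θ α β ε p.1 p.2) := by
  have k1 : Measurable (fun p : En n × En n => kval θ p.1) := (kval_meas θ).comp measurable_fst
  have j1 : Measurable (fun p : En n × En n => jap p.1 ^ (2*α)) := ((jap_rpow_cont (2*α)).comp continuous_fst).measurable
  have j2 : Measurable (fun p : En n × En n => jap p.2 ^ (-β)) := ((jap_rpow_cont (-β)).comp continuous_snd).measurable
  have j3 : Measurable (fun p : En n × En n => jap (p.1 - p.2) ^ (-β)) := 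
    ((jap_rpow_cont (-β)).comp (continuous_fst.sub continuous_snd)).measurable
  exact j1.ennreal_ofReal.mul ((k1.pow_const _).ennreal_ofReal.mul (((j2.ennreal_ofReal.mul j3.ennreal_ofReal).pow_const 2).mul (wgt_meas θ ε)))

lemma L2_le_H1 {n : ℕ} (u : 𝓢(En n, ℂ)) : ∫⁻ ζ, ‖u ζ‖ₑ^2 ≤ H1n u := 
  lintegral_mono (fun _ => le_self_add)

set_option maxHeartbeats 1600000 in
lemma bil1 (m : ℕ) (α β μ ε : ℝ) (hε : 0 < ε) (hε1 : ε < 1/2) (hα : 0 ≤ α) (hβ : 0 ≤ β) (hμ : 0 ≤ μ)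
    (hm : (m:ℝ) ≤ 2*β+μ) (hE : 2*α-2*β-2+μ+5*ε ≤ 0) : ∃ C : ℝ≥0∞, C ≠ ⊤ ∧ ∀ θ : En (m+1), ‖θ‖ = 1 → ∀ a b : 𝓢(En (m+1), ℂ),
    ∫⁻ η in {η : En (m+1) | ⟪η, θ⟫ < 0 ∧ 1 ≤ ‖η‖}, ENNReal.ofReal (jap η ^ (2*α)) * 
      (∫⁻ ξ in {ξ | ‖ξ‖ ≤ ‖η‖/2}, ‖a ξ‖ₑ * (‖b (η-ξ)‖ₑ * (ENNReal.ofReal (jap ξ ^ (-β)) * ENNReal.ofReal (jap (η-ξ) ^ (-β)))) * wgt θ ε η ξ)^2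
      ≤ C * (H1n a * H1n b) := by
  obtain ⟨C1, hC1, hk⟩ := ker1 m α β μ ε hε hε1 hα hβ hμ hm hE
  obtain ⟨Ct, hCt, ht⟩ := trace_bound (m+1) (by omega) ε hε hε1
  refine ⟨Ct * C1, by finiteness, fun θ hθ a b => ?_⟩
  have mS : MeasurableSet {η : En (m+1) | ⟪η, θ⟫ < 0 ∧ 1 ≤ ‖η‖} := 
    ((isOpen_lt (f := fun η : En (m+1) => ⟪η, θ⟫) (by fun_prop) (by fun_prop)).measurableSet).inter 
      (isClosed_le (f := fun _ : En (m+1) => (1:ℝ)) (g := fun η => ‖η‖) (by fun_prop) (by fun_prop)).measurableSet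
  have mb : Measurable (fun x => ‖b x‖ₑ) := b.continuous.enorm.measurable
  have ma : Measurable (fun x => ‖a x‖ₑ) := a.continuous.enorm.measurable
  set D : Set (En (m+1) × En (m+1)) := {p | ‖p.1 - p.2‖ ≤ ‖p.1‖/2} with hD
  have mD : MeasurableSet D := 
    (isClosed_le (f := fun p : En (m+1) × En (m+1) => ‖p.1 - p.2‖) (g := fun p => ‖p.1‖/2) (by fun_prop) (by fun_prop)).measurableSet
  have mW : Measurable (fun p : En (m+1) × En (m+1) => Wk θ α β ε p.1 (p.1 - p.2)) := 
    (Wk_meas θ α β ε).comp (measurable_fst.prodMk (measurable_fst.sub measurable_snd))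
  set N : En (m+1) × En (m+1) → ℝ≥0∞ := D.indicator (fun p => Wk θ α β ε p.1 (p.1 - p.2) * ‖b p.2‖ₑ^2) with hN
  have mN : Measurable N := Measurable.indicator (mW.mul ((mb.comp measurable_snd).pow_const 2)) mD
  have pt : ∀ η ∈ {η : En (m+1) | ⟪η, θ⟫ < 0 ∧ 1 ≤ ‖η‖}, ENNReal.ofReal (jap η ^ (2*α)) * 
      (∫⁻ ξ in {ξ | ‖ξ‖ ≤ ‖η‖/2}, ‖a ξ‖ₑ * (‖b (η-ξ)‖ₑ * (ENNReal.ofReal (jap ξ ^ (-β)) * ENNReal.ofReal (jap (η-ξ) ^ (-β)))) * wgt θ ε η ξ)^2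
      ≤ Ct * H1n a * ∫⁻ y, N (η, y) := by
    rintro η ⟨h1, h2⟩
    obtain ⟨g1, g2, -⟩ := kval_ge θ η hθ h1
    have hk0 : 0 < kval θ η := by linarith
    have mw : Measurable (fun ξ => wgt θ ε η ξ) := wgt_meas2 θ ε η
    have mj1 : Measurable (fun ξ : En (m+1) => ENNReal.ofReal (jap ξ ^ (-β))) := (jap_rpow_cont (-β)).measurable.ennreal_ofReal
    have mj2 : Measurable (fun ξ : En (m+1) => ENNReal.ofReal (jap (η - ξ) ^ (-β))) := 
      ((jap_rpow_cont (-β)).comp (continuous_const.sub continuous_id)).measurable.ennreal_ofReal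
    have mb2 : Measurable (fun ξ => ‖b (η - ξ)‖ₑ) := (b.continuous.comp (continuous_const.sub continuous_id)).enorm.measurable
    have mg := mb2.mul (mj1.mul mj2)
    have s1 := cs_w (volume.restrict {ξ : En (m+1) | ‖ξ‖ ≤ ‖η‖/2}) (fun ξ => ‖a ξ‖ₑ) _ (fun ξ => wgt θ ε η ξ) ma.aemeasurable
      mg.aemeasurable mw.aemeasurable
    have s2 : ∫⁻ ξ in {ξ : En (m+1) | ‖ξ‖ ≤ ‖η‖/2}, ‖a ξ‖ₑ^2 * wgt θ ε η ξ ≤ Ct * ENNReal.ofReal (kval θ η^(-1+2*ε)) * H1n a :=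
      (setLIntegral_le_lintegral _ _).trans (ht a (-(kval θ η • θ)) (kval θ η) hk0)
    have mB : MeasurableSet {ξ : En (m+1) | ‖ξ‖ ≤ ‖η‖/2} := 
      (isClosed_le (f := fun ξ : En (m+1) => ‖ξ‖) (g := fun _ => ‖η‖/2) (by fun_prop) (by fun_prop)).measurableSet
    have s3 : ENNReal.ofReal (jap η ^ (2*α)) * (ENNReal.ofReal (kval θ η^(-1+2*ε)) * 
        ∫⁻ ξ in {ξ : En (m+1) | ‖ξ‖ ≤ ‖η‖/2}, (‖b (η-ξ)‖ₑ * (ENNReal.ofReal (jap ξ ^ (-β)) * ENNReal.ofReal (jap (η-ξ) ^ (-β))))^2 * wgt θ ε η ξ)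
        = ∫⁻ y, N (η, y) := by
      rw [← lintegral_const_mul' _ _ ENNReal.ofReal_ne_top, ← lintegral_const_mul' _ _ ENNReal.ofReal_ne_top,
        ← lintegral_indicator mB, ← lintegral_sub_left_eq_self _ η]
      congr 1; ext y
      by_cases hy : ‖η - y‖ ≤ ‖η‖/2
      · rw [hN, Set.indicator_of_mem (show η - y ∈ {ξ : En (m+1) | ‖ξ‖ ≤ ‖η‖/2} from hy), 
          Set.indicator_of_mem (show (η, y) ∈ D from hy)]
        simp only [Wk, sub_sub_cancel]
        ring
      · rw [hN, Set.indicator_of_notMem (show η - y ∉ {ξ : En (m+1) | ‖ξ‖ ≤ ‖η‖/2} from hy), 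
          Set.indicator_of_notMem (show (η, y) ∉ D from hy)]
    rw [← s3]
    calc _ ≤ ENNReal.ofReal (jap η ^ (2*α)) * (Ct * ENNReal.ofReal (kval θ η^(-1+2*ε)) * H1n a * 
          ∫⁻ ξ in {ξ : En (m+1) | ‖ξ‖ ≤ ‖η‖/2}, (‖b (η-ξ)‖ₑ * (ENNReal.ofReal (jap ξ ^ (-β)) * ENNReal.ofReal (jap (η-ξ) ^ (-β))))^2 * wgt θ ε η ξ) := by
          refine mul_le_mul_right (s1.trans (mul_le_mul_left s2 _)) _
      _ = _ := by ring
  refine (setLIntegral_mono' mS pt).trans ?_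
  rw [lintegral_const_mul _ mN.lintegral_prod_right', lintegral_lintegral_swap (f := fun η y => N (η, y)) (mN.aemeasurable)]
  have inner : ∀ y, ∫⁻ η in {η : En (m+1) | ⟪η, θ⟫ < 0 ∧ 1 ≤ ‖η‖}, N (η, y) ≤ C1 * ‖b y‖ₑ^2 := by
    intro y
    refine le_trans ?_ (mul_le_mul_left (hk θ hθ y) _)
    have mT : MeasurableSet {η : En (m+1) | ⟪η, θ⟫ < 0 ∧ 1 ≤ ‖η‖ ∧ ‖η - y‖ ≤ ‖η‖/2} := by
      apply meas_lt_le2 <;> fun_prop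
    rw [← lintegral_mul_const' _ _ (by finiteness), ← lintegral_indicator mS, ← lintegral_indicator mT]
    apply lintegral_mono
    intro η
    beta_reduce
    by_cases h1 : η ∈ {η : En (m+1) | ⟪η, θ⟫ < 0 ∧ 1 ≤ ‖η‖}
    · rw [Set.indicator_of_mem h1]
      obtain ⟨h2, h3⟩ := h1
      by_cases h4 : (η, y) ∈ D
      · rw [hN, Set.indicator_of_mem h4, Set.indicator_of_mem (show η ∈ {η : En (m+1) | ⟪η, θ⟫ < 0 ∧ 1 ≤ ‖η‖ ∧ ‖η - y‖ ≤ ‖η‖/2} from ⟨h2, h3, h4⟩), Wk_eq θ hθ α β ε η (η - y) h2, sub_sub_cancel]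
        refine mul_le_mul_left (ENNReal.ofReal_le_ofReal (le_of_eq ?_)) _
        ring
      · rw [hN, Set.indicator_of_notMem h4]; exact zero_le
    · rw [Set.indicator_of_notMem h1]; exact zero_le
  calc _ ≤ Ct * H1n a * ∫⁻ y, C1 * ‖b y‖ₑ^2 := mul_le_mul_right (lintegral_mono inner) _
    _ = Ct * H1n a * (C1 * ∫⁻ y, ‖b y‖ₑ^2) := by rw [lintegral_const_mul' _ _ hC1]
    _ ≤ Ct * H1n a * (C1 * H1n b) := by gcongr; exact L2_le_H1 b
    _ = _ := by ring
set_option maxHeartbeats 1600000 in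
lemma bil2 (m : ℕ) (α β μ ε : ℝ) (hε : 0 < ε) (hε1 : ε < 1/2) (hα : 0 ≤ α) (hβ : 0 ≤ β) (hμ : 0 ≤ μ)
    (hm : (m:ℝ) ≤ 2*β+μ) (hE : 2*α-2*β-2+μ+5*ε ≤ 0) : ∃ C : ℝ≥0∞, C ≠ ⊤ ∧ ∀ θ : En (m+1), ‖θ‖ = 1 → ∀ a b : 𝓢(En (m+1), ℂ),
    ∫⁻ η in {η : En (m+1) | ⟪η, θ⟫ < 0 ∧ 1 ≤ ‖η‖}, ENNReal.ofReal (jap η ^ (2*α)) * 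
      (∫⁻ ξ in {ξ | ‖η‖ ≤ 2*‖ξ‖}, ‖b (η-ξ)‖ₑ * (‖a ξ‖ₑ * (ENNReal.ofReal (jap ξ ^ (-β)) * ENNReal.ofReal (jap (η-ξ) ^ (-β)))) * wgt θ ε η ξ)^2
      ≤ C * (H1n a * H1n b) := by
  obtain ⟨C1, hC1, hk⟩ := ker2 m α β μ ε hε hε1 hα hβ hμ hm hE
  obtain ⟨Ct, hCt, ht⟩ := trace_bound (m+1) (by omega) ε hε hε1
  refine ⟨Ct * C1, by finiteness, fun θ hθ a b => ?_⟩
  have mS : MeasurableSet {η : En (m+1) | ⟪η, θ⟫ < 0 ∧ 1 ≤ ‖η‖} := 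
    ((isOpen_lt (f := fun η : En (m+1) => ⟪η, θ⟫) (by fun_prop) (by fun_prop)).measurableSet).inter 
      (isClosed_le (f := fun _ : En (m+1) => (1:ℝ)) (g := fun η => ‖η‖) (by fun_prop) (by fun_prop)).measurableSet
  have mb : Measurable (fun x => ‖b x‖ₑ) := b.continuous.enorm.measurable
  have ma : Measurable (fun x => ‖a x‖ₑ) := a.continuous.enorm.measurable
  set D : Set (En (m+1) × En (m+1)) := {p | ‖p.1‖ ≤ 2*‖p.2‖} with hD
  have mD : MeasurableSet D := 
    (isClosed_le (f := fun p : En (m+1) × En (m+1) => ‖p.1‖) (g := fun p => 2*‖p.2‖) (by fun_prop) (by fun_prop)).measurableSet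
  have mW : Measurable (fun p : En (m+1) × En (m+1) => Wk θ α β ε p.1 p.2) := Wk_meas θ α β ε
  set N : En (m+1) × En (m+1) → ℝ≥0∞ := D.indicator (fun p => Wk θ α β ε p.1 p.2 * ‖a p.2‖ₑ^2) with hN
  have mN : Measurable N := Measurable.indicator (mW.mul ((ma.comp measurable_snd).pow_const 2)) mD
  have pt : ∀ η ∈ {η : En (m+1) | ⟪η, θ⟫ < 0 ∧ 1 ≤ ‖η‖}, ENNReal.ofReal (jap η ^ (2*α)) * 
      (∫⁻ ξ in {ξ | ‖η‖ ≤ 2*‖ξ‖}, ‖b (η-ξ)‖ₑ * (‖a ξ‖ₑ * (ENNReal.ofReal (jap ξ ^ (-β)) * ENNReal.ofReal (jap (η-ξ) ^ (-β)))) * wgt θ ε η ξ)^2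
      ≤ Ct * H1n b * ∫⁻ y, N (η, y) := by
    rintro η ⟨h1, h2⟩
    obtain ⟨g1, g2, -⟩ := kval_ge θ η hθ h1
    have hk0 : 0 < kval θ η := by linarith
    have mw : Measurable (fun ξ => wgt θ ε η ξ) := wgt_meas2 θ ε η
    have mj1 : Measurable (fun ξ : En (m+1) => ENNReal.ofReal (jap ξ ^ (-β))) := (jap_rpow_cont (-β)).measurable.ennreal_ofReal
    have mj2 : Measurable (fun ξ : En (m+1) => ENNReal.ofReal (jap (η - ξ) ^ (-β))) := 
      ((jap_rpow_cont (-β)).comp (continuous_const.sub continuous_id)).measurable.ennreal_ofReal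
    have mb2 : Measurable (fun ξ => ‖b (η - ξ)‖ₑ) := (b.continuous.comp (continuous_const.sub continuous_id)).enorm.measurable
    have mg := ma.mul (mj1.mul mj2)
    have s1 := cs_w (volume.restrict {ξ : En (m+1) | ‖η‖ ≤ 2*‖ξ‖}) (fun ξ => ‖b (η - ξ)‖ₑ) _ (fun ξ => wgt θ ε η ξ) mb2.aemeasurable
      mg.aemeasurable mw.aemeasurable
    have s2 : ∫⁻ ξ in {ξ : En (m+1) | ‖η‖ ≤ 2*‖ξ‖}, ‖b (η - ξ)‖ₑ^2 * wgt θ ε η ξ ≤ Ct * ENNReal.ofReal (kval θ η^(-1+2*ε)) * H1n b := by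
      refine (setLIntegral_le_lintegral _ _).trans ?_
      refine le_trans (le_of_eq ?_) (ht b (η + (kval θ η • θ)) (kval θ η) hk0)
      rw [← lintegral_sub_left_eq_self _ η]
      congr 1; ext ζ
      rw [wgt, sub_sub_cancel, ← norm_neg (ζ - _)]
      congr 5
      rw [show η - ζ - -(kval θ η • θ) = -(ζ - (η + kval θ η • θ)) by abel]
    have mB : MeasurableSet {ξ : En (m+1) | ‖η‖ ≤ 2*‖ξ‖} := 
      (isClosed_le (f := fun _ : En (m+1) => ‖η‖) (g := fun ξ => 2*‖ξ‖) (by fun_prop) (by fun_prop)).measurableSet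
    have s3 : ENNReal.ofReal (jap η ^ (2*α)) * (ENNReal.ofReal (kval θ η^(-1+2*ε)) * 
        ∫⁻ ξ in {ξ : En (m+1) | ‖η‖ ≤ 2*‖ξ‖}, (‖a ξ‖ₑ * (ENNReal.ofReal (jap ξ ^ (-β)) * ENNReal.ofReal (jap (η-ξ) ^ (-β))))^2 * wgt θ ε η ξ)
        = ∫⁻ y, N (η, y) := by
      rw [← lintegral_const_mul' _ _ ENNReal.ofReal_ne_top, ← lintegral_const_mul' _ _ ENNReal.ofReal_ne_top,
        ← lintegral_indicator mB]
      congr 1; ext y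
      by_cases hy : ‖η‖ ≤ 2*‖y‖
      · rw [hN, Set.indicator_of_mem (show y ∈ {ξ : En (m+1) | ‖η‖ ≤ 2*‖ξ‖} from hy), 
          Set.indicator_of_mem (show (η, y) ∈ D from hy)]
        simp only [Wk]
        ring
      · rw [hN, Set.indicator_of_notMem (show y ∉ {ξ : En (m+1) | ‖η‖ ≤ 2*‖ξ‖} from hy), 
          Set.indicator_of_notMem (show (η, y) ∉ D from hy)]
    rw [← s3]
    calc _ ≤ ENNReal.ofReal (jap η ^ (2*α)) * (Ct * ENNReal.ofReal (kval θ η^(-1+2*ε)) * H1n b * 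
          ∫⁻ ξ in {ξ : En (m+1) | ‖η‖ ≤ 2*‖ξ‖}, (‖a ξ‖ₑ * (ENNReal.ofReal (jap ξ ^ (-β)) * ENNReal.ofReal (jap (η-ξ) ^ (-β))))^2 * wgt θ ε η ξ) := by
          refine mul_le_mul_right (s1.trans (mul_le_mul_left s2 _)) _
      _ = _ := by ring
  refine (setLIntegral_mono' mS pt).trans ?_
  rw [lintegral_const_mul _ mN.lintegral_prod_right', lintegral_lintegral_swap (f := fun η y => N (η, y)) (mN.aemeasurable)]
  have inner : ∀ y, ∫⁻ η in {η : En (m+1) | ⟪η, θ⟫ < 0 ∧ 1 ≤ ‖η‖}, N (η, y) ≤ C1 * ‖a y‖ₑ^2 := by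
    intro y
    refine le_trans ?_ (mul_le_mul_left (hk θ hθ y) _)
    have mT : MeasurableSet {η : En (m+1) | ⟪η, θ⟫ < 0 ∧ 1 ≤ ‖η‖ ∧ ‖η‖ ≤ 2*‖y‖} := by
      apply meas_lt_le2 <;> fun_prop
    rw [← lintegral_mul_const' _ _ (by finiteness), ← lintegral_indicator mS, ← lintegral_indicator mT]
    apply lintegral_mono
    intro η
    beta_reduce
    by_cases h1 : η ∈ {η : En (m+1) | ⟪η, θ⟫ < 0 ∧ 1 ≤ ‖η‖}
    · rw [Set.indicator_of_mem h1]
      obtain ⟨h2, h3⟩ := h1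
      by_cases h4 : (η, y) ∈ D
      · rw [hN, Set.indicator_of_mem h4, Set.indicator_of_mem (show η ∈ {η : En (m+1) | ⟪η, θ⟫ < 0 ∧ 1 ≤ ‖η‖ ∧ ‖η‖ ≤ 2*‖y‖} from ⟨h2, h3, h4⟩), Wk_eq θ hθ α β ε η y h2]
      · rw [hN, Set.indicator_of_notMem h4]; exact zero_le
    · rw [Set.indicator_of_notMem h1]; exact zero_le
  calc _ ≤ Ct * H1n b * ∫⁻ y, C1 * ‖a y‖ₑ^2 := mul_le_mul_right (lintegral_mono inner) _
    _ = Ct * H1n b * (C1 * ∫⁻ y, ‖a y‖ₑ^2) := by rw [lintegral_const_mul' _ _ hC1]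
    _ ≤ Ct * H1n b * (C1 * H1n a) := by gcongr; exact L2_le_H1 a
    _ = _ := by ring

lemma bil (m : ℕ) (α β μ ε : ℝ) (hε : 0 < ε) (hε1 : ε < 1/2) (hα : 0 ≤ α) (hβ : 0 ≤ β) (hμ : 0 ≤ μ)
    (hm : (m:ℝ) ≤ 2*β+μ) (hE : 2*α-2*β-2+μ+5*ε ≤ 0) : ∃ C : ℝ≥0∞, C ≠ ⊤ ∧ ∀ θ : En (m+1), ‖θ‖ = 1 → ∀ a b : 𝓢(En (m+1), ℂ),
    ∫⁻ η in {η : En (m+1) | ⟪η, θ⟫ < 0 ∧ 1 ≤ ‖η‖}, ENNReal.ofReal (jap η ^ (2*α)) * 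
      (∫⁻ ξ, (ENNReal.ofReal (jap ξ ^ (-β)) * ‖a ξ‖ₑ) * (ENNReal.ofReal (jap (η-ξ) ^ (-β)) * ‖b (η-ξ)‖ₑ) * wgt θ ε η ξ)^2
      ≤ C * (H1n a * H1n b) := by
  obtain ⟨C1, hC1, h1⟩ := bil1 m α β μ ε hε hε1 hα hβ hμ hm hE
  obtain ⟨C2, hC2, h2⟩ := bil2 m α β μ ε hε hε1 hα hβ hμ hm hE
  refine ⟨2 * C1 + 2 * C2, by finiteness, fun θ hθ a b => ?_⟩
  have mS : MeasurableSet {η : En (m+1) | ⟪η, θ⟫ < 0 ∧ 1 ≤ ‖η‖} := 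
    ((isOpen_lt (f := fun η : En (m+1) => ⟪η, θ⟫) (by fun_prop) (by fun_prop)).measurableSet).inter 
      (isClosed_le (f := fun _ : En (m+1) => (1:ℝ)) (g := fun η => ‖η‖) (by fun_prop) (by fun_prop)).measurableSet
  set T1 : En (m+1) → ℝ≥0∞ := fun η => ∫⁻ ξ in {ξ | ‖ξ‖ ≤ ‖η‖/2}, ‖a ξ‖ₑ * (‖b (η-ξ)‖ₑ * (ENNReal.ofReal (jap ξ ^ (-β)) * ENNReal.ofReal (jap (η-ξ) ^ (-β)))) * wgt θ ε η ξ with hT1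
  set T2 : En (m+1) → ℝ≥0∞ := fun η => ∫⁻ ξ in {ξ | ‖η‖ ≤ 2*‖ξ‖}, ‖b (η-ξ)‖ₑ * (‖a ξ‖ₑ * (ENNReal.ofReal (jap ξ ^ (-β)) * ENNReal.ofReal (jap (η-ξ) ^ (-β)))) * wgt θ ε η ξ with hT2
  have key : ∀ η, (∫⁻ ξ, (ENNReal.ofReal (jap ξ ^ (-β)) * ‖a ξ‖ₑ) * (ENNReal.ofReal (jap (η-ξ) ^ (-β)) * ‖b (η-ξ)‖ₑ) * wgt θ ε η ξ) ≤ T1 η + T2 η := by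
    intro η
    have hu : (univ : Set (En (m+1))) ⊆ {ξ | ‖ξ‖ ≤ ‖η‖/2} ∪ {ξ | ‖η‖ ≤ 2*‖ξ‖} := by
      intro ξ _
      rcases le_total ‖ξ‖ (‖η‖/2) with h | h
      · left; exact h
      · right
        rw [Set.mem_ofPred_eq]; linarith
    rw [← setLIntegral_univ]
    refine (lintegral_mono_set hu).trans ((lintegral_union_le _ _ _).trans (le_of_eq ?_))
    rw [hT1, hT2]
    congr 1
    · congr 1; ext ξ; ring
    · congr 1; ext ξ; ring
  have mT1 : Measurable (fun η => ENNReal.ofReal (jap η ^ (2*α)) * T1 η ^ 2) := by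
    refine (jap_rpow_cont (2*α)).measurable.ennreal_ofReal.mul (Measurable.pow_const ?_ 2)
    have mD : MeasurableSet {p : En (m+1) × En (m+1) | ‖p.2‖ ≤ ‖p.1‖/2} := 
      (isClosed_le (f := fun p : En (m+1) × En (m+1) => ‖p.2‖) (g := fun p => ‖p.1‖/2) (by fun_prop) (by fun_prop)).measurableSet
    have ma : Measurable (fun p : En (m+1) × En (m+1) => ‖a p.2‖ₑ) := (a.continuous.comp continuous_snd).enorm.measurable
    have mb : Measurable (fun p : En (m+1) × En (m+1) => ‖b (p.1 - p.2)‖ₑ) := (b.continuous.comp (continuous_fst.sub continuous_snd)).enorm.measurable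
    have j2 : Measurable (fun p : En (m+1) × En (m+1) => jap p.2 ^ (-β)) := ((jap_rpow_cont (-β)).comp continuous_snd).measurable
    have j3 : Measurable (fun p : En (m+1) × En (m+1) => jap (p.1 - p.2) ^ (-β)) := 
      ((jap_rpow_cont (-β)).comp (continuous_fst.sub continuous_snd)).measurable
    have hm := Measurable.indicator ((ma.mul (mb.mul (j2.ennreal_ofReal.mul j3.ennreal_ofReal))).mul (wgt_meas θ ε)) mD
    have hm2 := hm.lintegral_prod_right' (ν := volume)
    convert hm2 using 2 with η
    rw [hT1]; beta_reduce
    rw [← lintegral_indicator]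
    · rfl
    · exact (isClosed_le (f := fun ξ : En (m+1) => ‖ξ‖) (g := fun _ => ‖η‖/2) (by fun_prop) (by fun_prop)).measurableSet
  calc _ ≤ ∫⁻ η in {η : En (m+1) | ⟪η, θ⟫ < 0 ∧ 1 ≤ ‖η‖}, (2 * (ENNReal.ofReal (jap η ^ (2*α)) * T1 η ^ 2) + 2 * (ENNReal.ofReal (jap η ^ (2*α)) * T2 η ^ 2)) := by
        apply lintegral_mono
        intro η
        beta_reduce
        calc _ ≤ ENNReal.ofReal (jap η ^ (2*α)) * (T1 η + T2 η)^2 := by gcongr; exact key η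
          _ ≤ ENNReal.ofReal (jap η ^ (2*α)) * (2 * (T1 η ^2 + T2 η^2)) := by
              gcongr
              have := ENNReal.rpow_add_le_mul_rpow_add_rpow (T1 η) (T2 η) (p := 2) (by norm_num)
              norm_num at this
              exact_mod_cast this
          _ = _ := by ring
    _ = 2 * (∫⁻ η in {η : En (m+1) | ⟪η, θ⟫ < 0 ∧ 1 ≤ ‖η‖}, ENNReal.ofReal (jap η ^ (2*α)) * T1 η ^ 2) + 
        2 * ∫⁻ η in {η : En (m+1) | ⟪η, θ⟫ < 0 ∧ 1 ≤ ‖η‖}, ENNReal.ofReal (jap η ^ (2*α)) * T2 η ^ 2 := by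
        rw [lintegral_add_left (mT1.const_mul 2), lintegral_const_mul' _ _ (by norm_num), lintegral_const_mul' _ _ (by norm_num)]
    _ ≤ 2 * (C1 * (H1n a * H1n b)) + 2 * (C2 * (H1n a * H1n b)) := by
        gcongr
        · exact h1 θ hθ a b
        · exact h2 θ hθ a b
    _ = _ := by ring
end PartH

section PartI
open scoped Topology LineDeriv

lemma jap_rpow_eq {n : ℕ} (x : En n) (s : ℝ) : jap x ^ s = (1 + ‖x‖^2) ^ (s/2) := by
  unfold jap
  rw [Real.sqrt_eq_rpow, ← Real.rpow_mul (by positivity)]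
  congr 1; ring

lemma sch_lint {n : ℕ} (w : 𝓢(En n, ℂ)) : ∫⁻ ξ, ‖w ξ‖ₑ^2 = ENNReal.ofReal (∫ ξ, ‖w ξ‖^2) := by
  have h : Integrable (fun ξ => ‖w ξ‖^2) := by
    have := (SchwartzMap.memLp w 2 (μ := volume)).integrable_norm_pow (by norm_num)
    simpa using this
  rw [ofReal_integral_eq_lintegral_ofReal h (ae_of_all _ fun x => by positivity)]
  apply lintegral_congr
  intro x
  rw [ENNReal.ofReal_pow (norm_nonneg _), ofReal_norm]

lemma sch_planch {n : ℕ} (w : 𝓢(En n, ℂ)) : ∫⁻ ξ, ‖w ξ‖ₑ^2 = ∫⁻ ξ, ‖(𝓕⁻ w : 𝓢(En n, ℂ)) ξ‖ₑ^2 := by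
  rw [sch_lint, sch_lint, ← SchwartzMap.integral_norm_sq_fourier (𝓕⁻ w)]
  have : 𝓕 (𝓕⁻ w) = w := FourierTransform.fourier_fourierInv_eq w
  rw [this]

def ebas {n : ℕ} (i : Fin n) : En n := EuclideanSpace.single i 1

lemma ebas_norm {n : ℕ} (i : Fin n) : ‖ebas i‖ = 1 := by simp [ebas]

lemma sch_dinv {n : ℕ} (w : 𝓢(En n, ℂ)) (i : Fin n) (x : En n) :
    ‖(𝓕⁻ (∂_{ebas i} w) : 𝓢(En n, ℂ)) x‖ₑ ≤ ENNReal.ofReal (2*π) * (ENNReal.ofReal (jap x) * ‖(𝓕⁻ w : 𝓢(En n, ℂ)) x‖ₑ) := by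
  have ht : (fun y : En n => inner ℝ y (ebas i)).HasTemperateGrowth := by fun_prop
  have e : (𝓕⁻ (∂_{ebas i} w) : 𝓢(En n, ℂ)) x = -(2 * π * Complex.I) * (((inner ℝ x (ebas i) : ℝ) : ℂ) * (𝓕⁻ w : 𝓢(En n, ℂ)) x) := by
    rw [SchwartzMap.fourierInv_lineDerivOp_eq, _root_.smul_apply, SchwartzMap.smulLeftCLM_apply_apply ht]
    simp
  rw [← ofReal_norm, ← ofReal_norm, ← ENNReal.ofReal_mul (jap_pos x).le, ← ENNReal.ofReal_mul (by positivity)]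
  apply ENNReal.ofReal_le_ofReal
  rw [e, norm_mul, norm_mul]
  have h1 : ‖-(2 * (π:ℂ) * Complex.I)‖ = 2 * π := by
    simp [abs_of_pos Real.pi_pos]
  rw [h1]
  have h2 : ‖((inner ℝ x (ebas i) : ℝ) : ℂ)‖ ≤ jap x := by
    rw [Complex.norm_real]
    refine (norm_inner_le_norm _ _).trans ?_
    rw [ebas_norm, mul_one]
    exact jap_ge_norm x
  gcongr

lemma clm_norm_le {n : ℕ} (L : En n →L[ℝ] ℂ) : ‖L‖ₑ ≤ ∑ i, ‖L (ebas i)‖ₑ := by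
  have h : ‖L‖ ≤ ∑ i, ‖L (ebas i)‖ := by
    apply ContinuousLinearMap.opNorm_le_bound _ (by positivity)
    intro x
    have hx : x = ∑ i, x i • ebas i := by
      have := (EuclideanSpace.basisFun (Fin n) ℝ).sum_repr x
      simpa [ebas] using this.symm
    have : L x = ∑ i, x i • L (ebas i) := by
      conv_lhs => rw [hx]
      simp
    rw [this, Finset.sum_mul]
    refine (norm_sum_le _ _).trans (Finset.sum_le_sum fun i _ => ?_)
    rw [norm_smul, mul_comm]
    gcongr
    exact PiLp.norm_apply_le x i
  rw [← ofReal_norm]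
  refine (ENNReal.ofReal_le_ofReal h).trans ?_
  rw [ENNReal.ofReal_sum_of_nonneg (fun _ _ => norm_nonneg _)]
  simp [ofReal_norm]

lemma H1n_le {n : ℕ} (w : 𝓢(En n, ℂ)) : H1n w ≤
    (1 + (n:ℝ≥0∞) * n * ENNReal.ofReal (2*π)^2) * ∫⁻ x, (ENNReal.ofReal (jap x) * ‖(𝓕⁻ w : 𝓢(En n, ℂ)) x‖ₑ)^2 := by
  have h1 : H1n w ≤ ∫⁻ ζ, (‖w ζ‖ₑ^2 + n * ∑ i : Fin n, ‖(∂_{ebas i} w : 𝓢(En n, ℂ)) ζ‖ₑ^2) := by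
    unfold H1n
    apply lintegral_mono
    intro ζ
    beta_reduce
    gcongr
    have h2 := clm_norm_le (fderiv ℝ w ζ)
    calc ‖fderiv ℝ w ζ‖ₑ^2 ≤ (∑ i, ‖fderiv ℝ w ζ (ebas i)‖ₑ)^2 := by gcongr
      _ ≤ _ := by
        have := ENNReal.inner_le_Lp_mul_Lq (Finset.univ : Finset (Fin n)) (fun _ => 1) (fun i => ‖fderiv ℝ w ζ (ebas i)‖ₑ) (p := 2) (q := 2) (by constructor <;> norm_num)
        have h3 : (∑ i, ‖fderiv ℝ w ζ (ebas i)‖ₑ)^2 ≤ ((n:ℝ≥0∞)^(1/2:ℝ) * (∑ i, ‖fderiv ℝ w ζ (ebas i)‖ₑ^2)^(1/2:ℝ))^2 := by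
          gcongr
          simpa using this
        refine h3.trans (le_of_eq ?_)
        rw [mul_pow, ← ENNReal.rpow_natCast, ← ENNReal.rpow_natCast, ← ENNReal.rpow_mul, ← ENNReal.rpow_mul]
        norm_num
        rfl
  have mw : ∀ v : 𝓢(En n, ℂ), Measurable (fun ζ => ‖v ζ‖ₑ^2) := fun v => by
    have := v.continuous
    fun_prop
  refine h1.trans ?_
  rw [lintegral_add_left (mw w), lintegral_const_mul _ (Finset.measurable_sum _ fun i _ => mw _), lintegral_finsetSum _ (fun i _ => mw _), sch_planch w]
  set J := ∫⁻ x, (ENNReal.ofReal (jap x) * ‖(𝓕⁻ w : 𝓢(En n, ℂ)) x‖ₑ)^2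
  have hA : ∫⁻ x, ‖(𝓕⁻ w : 𝓢(En n, ℂ)) x‖ₑ^2 ≤ J := by
    apply lintegral_mono
    intro x
    beta_reduce
    gcongr
    conv_lhs => rw [← one_mul (‖_‖ₑ)]
    gcongr
    rw [ENNReal.one_le_ofReal]
    exact jap_ge_one x
  have hB : ∀ i : Fin n, ∫⁻ ζ, ‖(∂_{ebas i} w : 𝓢(En n, ℂ)) ζ‖ₑ^2 ≤ ENNReal.ofReal (2*π)^2 * J := by
    intro i
    rw [sch_planch, ← lintegral_const_mul' _ _ (ENNReal.pow_ne_top ENNReal.ofReal_ne_top)]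
    apply lintegral_mono
    intro x
    beta_reduce
    rw [← mul_pow]
    gcongr
    exact sch_dinv w i x
  calc _ ≤ J + n * ∑ i : Fin n, ENNReal.ofReal (2*π)^2 * J := by
        gcongr with i
        exact hB i
    _ = _ := by
        simp; ring

def ufun {n : ℕ} (β : ℝ) (q : 𝓢(En n, ℂ)) : 𝓢(En n, ℂ) :=
  SchwartzMap.smulLeftCLM ℂ (fun x : En n => (1 + ‖x‖^2)^(β/2)) (𝓕 q)

lemma ufun_apply {n : ℕ} (β : ℝ) (q : 𝓢(En n, ℂ)) (x : En n) : ufun β q x = jap x ^ β • (𝓕 q : 𝓢(En n, ℂ)) x := by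
  unfold ufun
  rw [SchwartzMap.smulLeftCLM_apply_apply (Function.hasTemperateGrowth_one_add_norm_sq_rpow _ _), jap_rpow_eq]

lemma sob_eq {n : ℕ} (β : ℝ) (q : 𝓢(En n, ℂ)) :
    ∫⁻ x, (ENNReal.ofReal (jap x)^2 * ‖(𝓕⁻ (ufun β q) : 𝓢(En n, ℂ)) x‖ₑ)^2 = ENNReal.ofReal (sobNorm β 2 q ^ 2) := by
  have hu : (fun ξ => (jap ξ ^ β : ℝ) • 𝓕 (q : En n → ℂ) ξ) = ufun β q := by
    ext ξ; rw [ufun_apply]; rfl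
  have hv : 𝓕⁻ (ufun β q : En n → ℂ) = (𝓕⁻ (ufun β q) : 𝓢(En n, ℂ)) := (SchwartzMap.fourierInv_coe _).symm
  set v : 𝓢(En n, ℂ) := 𝓕⁻ (ufun β q) with hvd
  have hs : sobNorm β 2 q ^ 2 = ∫ x, jap x ^ (2*2:ℝ) * ‖v x‖^2 := by
    unfold sobNorm
    rw [hu, hv, ← Real.sqrt_eq_rpow, Real.sq_sqrt]
    exact integral_nonneg fun x => mul_nonneg (Real.rpow_nonneg (jap_pos x).le _) (by positivity)
  set w : 𝓢(En n, ℂ) := SchwartzMap.smulLeftCLM ℂ (fun x : En n => (1 + ‖x‖^2)^(1:ℝ)) v with hw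
  have hwx : ∀ x, w x = (jap x ^ 2) • v x := by
    intro x
    rw [hw, SchwartzMap.smulLeftCLM_apply_apply (Function.hasTemperateGrowth_one_add_norm_sq_rpow _ _)]
    congr 1
    unfold jap
    rw [Real.sq_sqrt (by positivity), Real.rpow_one]
  have := sch_lint w
  rw [hs]
  convert this using 2
  · ext x
    rw [hwx, enorm_smul, Real.enorm_eq_ofReal (by positivity), ENNReal.ofReal_pow (jap_pos x).le]
  · congr 1
    ext x
    rw [hwx, norm_smul, mul_pow]
    congr 1
    rw [Real.norm_of_nonneg (by positivity), ← pow_mul, ← Real.rpow_natCast]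
    norm_num

def afam {n : ℕ} (β : ℝ) (q : 𝓢(En n, ℂ)) : Option (Fin n) → 𝓢(En n, ℂ)
  | none => ufun β q
  | some i => ∂_{ebas i} (ufun β q)

lemma H1n_afam (n : ℕ) : ∃ C : ℝ≥0∞, C ≠ ⊤ ∧ ∀ (β : ℝ) (q : 𝓢(En n, ℂ)) (j : Option (Fin n)),
    H1n (afam β q j) ≤ C * ENNReal.ofReal (sobNorm β 2 q ^ 2) := by
  refine ⟨(1 + (n:ℝ≥0∞) * n * ENNReal.ofReal (2*π)^2) * (1 + ENNReal.ofReal (2*π)^2), ?_, ?_⟩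
  · apply ENNReal.mul_ne_top <;> simp [ENNReal.mul_eq_top]
  intro β q j
  refine (H1n_le _).trans ?_
  rw [mul_assoc (1 + (n:ℝ≥0∞) * n * ENNReal.ofReal (2*π)^2)]
  refine mul_le_mul_right (α := ℝ≥0∞) ?_ _
  rw [← sob_eq]
  cases j with
  | none =>
    refine le_trans ?_ (mul_le_mul_left (le_self_add) _)
    rw [one_mul]
    apply lintegral_mono
    intro x
    beta_reduce
    show (ENNReal.ofReal (jap x) * ‖(𝓕⁻ (ufun β q) : 𝓢(En n, ℂ)) x‖ₑ)^2 ≤ _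
    have : (1:ℝ≥0∞) ≤ ENNReal.ofReal (jap x) := by
      rw [ENNReal.one_le_ofReal]; exact jap_ge_one x
    gcongr
    exact le_self_pow this (by norm_num)
  | some i =>
    refine le_trans ?_ (mul_le_mul_left (le_add_self) _)
    rw [← lintegral_const_mul' _ _ (ENNReal.pow_ne_top ENNReal.ofReal_ne_top)]
    apply lintegral_mono
    intro x
    beta_reduce
    rw [← mul_pow]
    refine pow_le_pow_left' ?_ 2
    refine (mul_le_mul_right (sch_dinv (ufun β q) i x) _).trans (le_of_eq ?_)
    ring

lemma g_bound {n : ℕ} (β : ℝ) (hβ : 0 ≤ β) (q : 𝓢(En n, ℂ)) (ξ : En n) :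
    ‖(𝓕 q : 𝓢(En n, ℂ)) ξ‖ₑ + ‖fderiv ℝ (𝓕 q : 𝓢(En n, ℂ)) ξ‖ₑ ≤
      ENNReal.ofReal (1+β) * ∑ j, (ENNReal.ofReal (jap ξ ^ (-β)) * ‖afam β q j ξ‖ₑ) := by
  set u := ufun β q with hu
  set p : En n → ℝ := fun x => (1 + ‖x‖^2)^(-β/2) with hp
  have hpj : ∀ x, p x = jap x ^ (-β) := fun x => by rw [jap_rpow_eq]
  have hf : ((𝓕 q : 𝓢(En n, ℂ)) : En n → ℂ) = fun x => p x • u x := by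
    ext x
    rw [hpj, hu, ufun_apply, smul_smul, ← Real.rpow_add (jap_pos x)]
    simp
  have hd : HasFDerivAt p (((-β/2) * (1+‖ξ‖^2)^(-β/2-1)) • ((2:ℝ) • innerSL ℝ ξ)) ξ := by
    have h1 : HasFDerivAt (fun x : En n => 1 + ‖x‖^2) ((2:ℝ) • innerSL ℝ ξ) ξ := by
      have := (hasStrictFDerivAt_norm_sq ξ).hasFDerivAt.const_add 1
      have e : (2:ℝ) • innerSL ℝ ξ = (2:ℕ) • innerSL ℝ ξ := by
        ext y; simp
      rw [e]; exact this
    exact h1.rpow_const (Or.inl (by positivity))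
  have hdn : ‖((-β/2) * (1+‖ξ‖^2)^(-β/2-1)) • ((2:ℝ) • innerSL ℝ ξ)‖ ≤ β * p ξ := by
    rw [norm_smul, norm_smul, innerSL_apply_norm, norm_mul, Real.norm_of_nonneg (by positivity : (0:ℝ) ≤ (1+‖ξ‖^2)^(-β/2-1)), Real.norm_eq_abs, abs_of_nonpos (by linarith), Real.rpow_sub_one (by positivity)]
    have h3 : ‖ξ‖ / (1+‖ξ‖^2) ≤ 1 := by
      rw [div_le_one (by positivity)]
      nlinarith [sq_nonneg (‖ξ‖-1), norm_nonneg ξ]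
    have h4 : 0 ≤ β * p ξ := mul_nonneg hβ (by simp only [hp]; positivity)
    calc _ = β * p ξ * (‖ξ‖ / (1+‖ξ‖^2)) := by
          simp only [hp]; norm_num; ring
      _ ≤ β * p ξ * 1 := by gcongr
      _ = _ := mul_one _
  have hU : HasFDerivAt u (fderiv ℝ u ξ) ξ := u.differentiableAt.hasFDerivAt
  have hF := hd.fun_smul hU
  have hp0 : 0 ≤ p ξ := by simp only [hp]; positivity
  have hreal : ‖(𝓕 q : 𝓢(En n, ℂ)) ξ‖ + ‖fderiv ℝ (𝓕 q : 𝓢(En n, ℂ)) ξ‖ ≤ (1+β) * (p ξ * (‖u ξ‖ + ‖fderiv ℝ u ξ‖)) := by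
    rw [hf, hF.fderiv]
    have hA : ‖p ξ • u ξ‖ = p ξ * ‖u ξ‖ := by rw [norm_smul, Real.norm_of_nonneg hp0]
    have hB : ‖p ξ • fderiv ℝ u ξ‖ = p ξ * ‖fderiv ℝ u ξ‖ := by rw [norm_smul, Real.norm_of_nonneg hp0]
    have h5 := norm_add_le (p ξ • fderiv ℝ u ξ) ((((-β/2) * (1+‖ξ‖^2)^(-β/2-1)) • ((2:ℝ) • innerSL ℝ ξ)).smulRight (u ξ))
    rw [ContinuousLinearMap.norm_smulRight_apply, hB] at h5
    beta_reduce
    rw [hA]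
    have h6 := mul_le_mul_of_nonneg_right hdn (norm_nonneg (u ξ))
    have h7 : 0 ≤ β * (p ξ * ‖fderiv ℝ u ξ‖) := by positivity
    nlinarith
  rw [← ofReal_norm, ← ofReal_norm, ← ENNReal.ofReal_add (norm_nonneg _) (norm_nonneg _)]
  refine (ENNReal.ofReal_le_ofReal hreal).trans ?_
  rw [ENNReal.ofReal_mul (by positivity), ENNReal.ofReal_mul hp0, ENNReal.ofReal_add (norm_nonneg _) (norm_nonneg _), ofReal_norm, ofReal_norm, hpj, ← Finset.mul_sum, Fintype.sum_option]
  refine mul_le_mul_right (mul_le_mul_right ?_ _) _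
  exact add_le_add le_rfl (clm_norm_le _)

end PartI

section PartJ
open scoped Topology

lemma sq_sum_ennreal {ι : Type*} [Fintype ι] (f : ι → ℝ≥0∞) :
    (∑ i, f i)^2 ≤ (Fintype.card ι : ℝ≥0∞) * ∑ i, f i ^ 2 := by
  have := ENNReal.inner_le_Lp_mul_Lq (Finset.univ : Finset ι) (fun _ => 1) f (p := 2) (q := 2) (by constructor <;> norm_num)
  have h3 : (∑ i, f i)^2 ≤ ((Fintype.card ι:ℝ≥0∞)^(1/2:ℝ) * (∑ i, f i^2)^(1/2:ℝ))^2 := by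
    refine pow_le_pow_left' ?_ 2
    simpa using this
  refine h3.trans (le_of_eq ?_)
  rw [mul_pow, ← ENNReal.rpow_natCast, ← ENNReal.rpow_natCast, ← ENNReal.rpow_mul, ← ENNReal.rpow_mul]
  norm_num

lemma sch_bdd {n : ℕ} (f : 𝓢(En n, ℂ)) : ∃ B, 0 ≤ B ∧ ∀ x, ‖f x‖ ≤ B ∧ ‖fderiv ℝ f x‖ ≤ B := by
  obtain ⟨B1, h1⟩ : ∃ B, ∀ x, ‖f x‖ ≤ B := ⟨_, fun x => SchwartzMap.norm_le_seminorm ℝ f x⟩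
  obtain ⟨B2, h2⟩ : ∃ B, ∀ x, ‖fderiv ℝ f x‖ ≤ B :=
    ⟨_, fun x => SchwartzMap.norm_le_seminorm ℝ (SchwartzMap.fderivCLM ℝ _ _ f) x⟩
  refine ⟨max B1 B2, ((norm_nonneg _).trans (h1 0)).trans (le_max_left _ _), fun x => ⟨(h1 x).trans (le_max_left _ _), (h2 x).trans (le_max_right _ _)⟩⟩

lemma F_props {n : ℕ} (f : 𝓢(En n, ℂ)) (η : En n) :
    ContDiff ℝ 1 (fun ξ => f ξ * f (η - ξ)) ∧
    (∃ B, ∀ x, ‖f x * f (η - x)‖ ≤ B ∧ ‖fderiv ℝ (fun ξ => f ξ * f (η - ξ)) x‖ ≤ B) ∧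
    Integrable (fun ξ => f ξ * f (η - ξ)) ∧
    ∀ x, ‖f x * f (η - x)‖ₑ + ‖fderiv ℝ (fun ξ => f ξ * f (η - ξ)) x‖ₑ ≤
      (‖f x‖ₑ + ‖fderiv ℝ f x‖ₑ) * (‖f (η - x)‖ₑ + ‖fderiv ℝ f (η - x)‖ₑ) := by
  have hd : ∀ x, ‖fderiv ℝ (fun ξ => f ξ * f (η - ξ)) x‖ ≤ ‖f x‖ * ‖fderiv ℝ f (η - x)‖ + ‖f (η - x)‖ * ‖fderiv ℝ f x‖ := by
    intro x
    have h1 : HasFDerivAt f (fderiv ℝ f x) x := f.differentiableAt.hasFDerivAt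
    have h2 : HasFDerivAt (fun ξ => f (η - ξ)) (-(fderiv ℝ f (η - x))) x := by
      have h3 : HasFDerivAt (fun ξ : En n => η - ξ) (-(ContinuousLinearMap.id ℝ (En n))) x := (hasFDerivAt_id x).const_sub η
      have h4 : HasFDerivAt f (fderiv ℝ f (η - x)) (η - x) := f.differentiableAt.hasFDerivAt
      have := h4.comp x h3
      have e : fderiv ℝ f (η - x) ∘SL (-ContinuousLinearMap.id ℝ (En n)) = -(fderiv ℝ f (η - x)) := by
        ext; simp
      rw [e] at this; exact this
    have h5 := (h1.fun_mul h2).fderiv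
    rw [h5]
    refine (norm_add_le _ _).trans (le_of_eq ?_)
    rw [norm_smul, norm_smul, norm_neg]
  have hc : Continuous (fun ξ => f (η - ξ)) := f.continuous.comp (by fun_prop)
  obtain ⟨B, hB0, hB⟩ := sch_bdd f
  refine ⟨?_, ⟨B*B + B*B, fun x => ⟨?_, ?_⟩⟩, ?_, ?_⟩
  · have h1 : ContDiff ℝ 1 f := f.smooth 1
    have h2 : ContDiff ℝ 1 (fun ξ => f (η - ξ)) := h1.comp (by fun_prop)
    exact h1.mul h2
  · rw [norm_mul]
    have := mul_le_mul (hB x).1 (hB (η - x)).1 (norm_nonneg _) hB0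
    nlinarith
  · refine (hd x).trans ?_
    exact add_le_add (mul_le_mul (hB x).1 (hB (η - x)).2 (norm_nonneg _) hB0) (mul_le_mul (hB (η-x)).1 (hB x).2 (norm_nonneg _) hB0)
  · exact f.integrable.mul_bdd (c := B) hc.aestronglyMeasurable (ae_of_all _ fun x => (hB _).1)
  · intro x
    simp only [← ofReal_norm]
    rw [← ENNReal.ofReal_add (by positivity) (by positivity), ← ENNReal.ofReal_add (by positivity) (by positivity), ← ENNReal.ofReal_add (by positivity) (by positivity), ← ENNReal.ofReal_mul (by positivity)]
    apply ENNReal.ofReal_le_ofReal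
    have := hd x
    rw [norm_mul]
    nlinarith [mul_nonneg (norm_nonneg (fderiv ℝ f x)) (norm_nonneg (fderiv ℝ f (η - x)))]

/-- bilinear term -/
def Tij {n : ℕ} (θ : En n) (β ε : ℝ) (a b : 𝓢(En n, ℂ)) (η : En n) : ℝ≥0∞ :=
  ∫⁻ ξ, (ENNReal.ofReal (jap ξ ^ (-β)) * ‖a ξ‖ₑ) * (ENNReal.ofReal (jap (η - ξ) ^ (-β)) * ‖b (η - ξ)‖ₑ) * wgt θ ε η ξ

lemma ja_meas {n : ℕ} (β : ℝ) (a : 𝓢(En n, ℂ)) : Measurable (fun ξ => ENNReal.ofReal (jap ξ ^ (-β)) * ‖a ξ‖ₑ) := by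
  have h1 := a.continuous
  have h2 := jap_rpow_cont (n := n) (-β)
  exact (ENNReal.measurable_ofReal.comp h2.measurable).mul h1.measurable.enorm

lemma Tij_meas {n : ℕ} (θ : En n) (β ε : ℝ) (a b : 𝓢(En n, ℂ)) : Measurable (Tij θ β ε a b) := by
  unfold Tij
  refine Measurable.lintegral_prod_right' (f := fun p : En n × En n => (ENNReal.ofReal (jap p.2 ^ (-β)) * ‖a p.2‖ₑ) * (ENNReal.ofReal (jap (p.1 - p.2) ^ (-β)) * ‖b (p.1 - p.2)‖ₑ) * wgt θ ε p.1 p.2) ?_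
  exact (((ja_meas β a).comp measurable_snd).mul ((ja_meas β b).comp (measurable_fst.sub measurable_snd))).mul (wgt_meas θ ε)

lemma int_le_toReal {X : Type*} [MeasurableSpace X] (μ : Measure X) (h : X → ℝ) (h0 : ∀ x, 0 ≤ h x) (M : ℝ≥0∞) (hM : M ≠ ⊤)
    (hh : ∫⁻ x, ENNReal.ofReal (h x) ∂μ ≤ M) : ∫ x, h x ∂μ ≤ M.toReal := by
  by_cases hi : Integrable h μ
  · rw [integral_eq_lintegral_of_nonneg_ae (ae_of_all _ h0) hi.1]
    exact ENNReal.toReal_mono hM hh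
  · rw [integral_undef hi]; positivity

set_option maxHeartbeats 1600000 in
lemma main_m (m : ℕ) (α β μ ε : ℝ) (hε : 0 < ε) (hε1 : ε < 1/2) (hα : 0 ≤ α) (hβ : 0 ≤ β) (hμ : 0 ≤ μ)
    (h1 : (m:ℝ) ≤ 2*β+μ) (h2 : 2*α-2*β-2+μ+5*ε ≤ 0) :
    ∃ M : ℝ≥0∞, M ≠ ⊤ ∧ ∀ θ : En (m+1), ‖θ‖ = 1 → ∀ q : 𝓢(En (m+1), ℂ), ∃ P : En (m+1) → ℂ,
      (∀ η : En (m+1), ⟪η, θ⟫ < 0 →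
          Filter.Tendsto
            (fun d : ℝ => ∫ r in {r : ℝ | 0 < r ∧ d < |1 - r|},
              ((1 - r)⁻¹ : ℝ) • Sop θ r ⇑q η)
            (nhdsWithin 0 (Set.Ioi 0)) (nhds (P η))) ∧
      ∫⁻ η in {η : En (m+1) | ⟪η,θ⟫ < 0 ∧ 1 ≤ ‖η‖}, ENNReal.ofReal (jap η ^ (2*α)) * ‖P η‖ₑ^2 ≤
        M * ENNReal.ofReal (sobNorm β 2 q ^ 2)^2 := by
  obtain ⟨Kc, hKc, hpv⟩ := pv_bound (m+1) (by omega) ε hε (by linarith)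
  obtain ⟨Cb, hCb, hbil⟩ := bil m α β μ ε hε hε1 hα hβ hμ h1 h2
  obtain ⟨Ch, hCh, hH⟩ := H1n_afam (m+1)
  set c := ENNReal.ofReal (1+β) with hc
  set N : ℝ≥0∞ := (Fintype.card (Option (Fin (m+1)) × Option (Fin (m+1))) : ℝ≥0∞) with hN
  refine ⟨(Kc*c^2)^2 * N * (N * (Cb * Ch^2)), ?_, ?_⟩
  · have : c ≠ ⊤ := ENNReal.ofReal_ne_top
    have : N ≠ ⊤ := ENNReal.natCast_ne_top _
    finiteness
  intro θ hθ q
  have key : ∀ η : En (m+1), ∃ p : ℂ, ⟪η, θ⟫ < 0 → 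
      Filter.Tendsto
            (fun d : ℝ => ∫ r in {r : ℝ | 0 < r ∧ d < |1 - r|},
              ((1 - r)⁻¹ : ℝ) • Sop θ r ⇑q η)
            (nhdsWithin 0 (Set.Ioi 0)) (nhds p) ∧ (1 ≤ ‖η‖ → ‖p‖ₑ ≤ Kc * c^2 * ∑ p : Option (Fin (m+1)) × Option (Fin (m+1)), Tij θ β ε (afam β q p.1) (afam β q p.2) η) := by
    intro η
    by_cases hη : ⟪η, θ⟫ < 0
    swap
    · exact ⟨0, fun h => absurd h hη⟩
    have hk := kval_ge θ η hθ hη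
    have hk0 : 0 < kval θ η := hk.2.1.trans_le hk.1
    set f : 𝓢(En (m+1), ℂ) := 𝓕 q with hf
    obtain ⟨f1, f2, f3, f4⟩ := F_props f η
    obtain ⟨p, hp1, hp2⟩ := hpv (-(kval θ η • θ)) (kval θ η) hk0 (fun ξ => f ξ * f (η - ξ)) f1 f2 f3
    refine ⟨p, fun _ => ⟨?_, fun hη1 => ?_⟩⟩
    · convert hp1 using 6
      unfold Sop
      rw [if_pos hη]
      rfl
    · refine (hp2 (hη1.trans hk.1)).trans ?_
      rw [mul_assoc]
      refine mul_le_mul_right ?_ _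
      have e : ∑ p : Option (Fin (m+1)) × Option (Fin (m+1)), Tij θ β ε (afam β q p.1) (afam β q p.2) η
         = ∫⁻ ξ, ∑ p : Option (Fin (m+1)) × Option (Fin (m+1)), (ENNReal.ofReal (jap ξ ^ (-β)) * ‖afam β q p.1 ξ‖ₑ) * (ENNReal.ofReal (jap (η - ξ) ^ (-β)) * ‖afam β q p.2 (η - ξ)‖ₑ) * wgt θ ε η ξ := by
        rw [lintegral_finsetSum]
        · rfl
        · intro p _
          exact ((ja_meas β _).mul ((ja_meas β _).comp (measurable_const.sub measurable_id))).mul (wgt_meas2 θ ε η)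
      rw [e, ← lintegral_const_mul' _ _ (ENNReal.pow_ne_top ENNReal.ofReal_ne_top)]
      apply lintegral_mono
      intro ξ
      beta_reduce
      rw [← Finset.sum_mul, ← mul_assoc]
      refine mul_le_mul_left ?_ _
      refine (f4 ξ).trans ?_
      refine (mul_le_mul' (g_bound β hβ q ξ) (g_bound β hβ q (η - ξ))).trans (le_of_eq ?_)
      rw [Fintype.sum_prod_type]
      dsimp only
      rw [← Finset.sum_mul_sum]
      ring
  choose P hP using key
  refine ⟨P, fun η hη => (hP η hη).1, ?_⟩
  set A : Set (En (m+1)) := {η | ⟪η,θ⟫ < 0 ∧ 1 ≤ ‖η‖} with hA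
  have mA : MeasurableSet A := by
    apply MeasurableSet.inter
    · exact (isOpen_lt (f := fun η : En (m+1) => (⟪η, θ⟫ : ℝ)) (g := fun _ => 0) (by fun_prop) (by fun_prop)).measurableSet
    · exact (isClosed_le (f := fun _ => 1) (g := fun η : En (m+1) => ‖η‖) (by fun_prop) (by fun_prop)).measurableSet
  have mj : Measurable (fun η : En (m+1) => ENNReal.ofReal (jap η ^ (2*α))) :=
    ENNReal.measurable_ofReal.comp (jap_rpow_cont (n := m+1) (2*α)).measurable
  calc _ ≤ ∫⁻ η in A, ((Kc*c^2)^2 * N) * ∑ p : Option (Fin (m+1)) × Option (Fin (m+1)), ENNReal.ofReal (jap η ^ (2*α)) * Tij θ β ε (afam β q p.1) (afam β q p.2) η^2 := by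
        apply setLIntegral_mono' mA
        intro η hη
        have h3 := (hP η hη.1).2 hη.2
        have h4 := sq_sum_ennreal (fun p : Option (Fin (m+1)) × Option (Fin (m+1)) => Tij θ β ε (afam β q p.1) (afam β q p.2) η)
        have h5 : ‖P η‖ₑ^2 ≤ (Kc*c^2)^2 * (N * ∑ p : Option (Fin (m+1)) × Option (Fin (m+1)), Tij θ β ε (afam β q p.1) (afam β q p.2) η^2) := by
          refine (pow_le_pow_left' h3 2).trans ?_
          rw [mul_pow]
          exact mul_le_mul_right h4 _
        refine (mul_le_mul_right h5 _).trans (le_of_eq ?_)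
        rw [← Finset.mul_sum]
        ring
    _ = ((Kc*c^2)^2 * N) * ∑ p : Option (Fin (m+1)) × Option (Fin (m+1)), ∫⁻ η in A, ENNReal.ofReal (jap η ^ (2*α)) * Tij θ β ε (afam β q p.1) (afam β q p.2) η^2 := by
        rw [lintegral_const_mul, lintegral_finsetSum]
        · intro p _
          exact mj.mul ((Tij_meas θ β ε _ _).pow_const 2)
        · exact Finset.measurable_sum _ fun p _ => mj.mul ((Tij_meas θ β ε _ _).pow_const 2)
    _ ≤ ((Kc*c^2)^2 * N) * ∑ p : Option (Fin (m+1)) × Option (Fin (m+1)), Cb * ((Ch * ENNReal.ofReal (sobNorm β 2 q ^ 2)) * (Ch * ENNReal.ofReal (sobNorm β 2 q ^ 2))) := by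
        refine mul_le_mul_right (Finset.sum_le_sum fun p _ => ?_) _
        refine (hbil θ hθ (afam β q p.1) (afam β q p.2)).trans ?_
        exact mul_le_mul_right (mul_le_mul' (hH β q p.1) (hH β q p.2)) _
    _ = _ := by
        rw [Finset.sum_const, nsmul_eq_mul, Finset.card_univ, ← hN]
        ring

end PartJ

/-- Estimate of the principal value operator (Proposition 4.1): the principal value
`P_θ(q)(η) = p.v. ∫_0^∞ S_{θ,r}(q)(η)/(1-r) dr` exists for every `η ∈ H_θ` and
`‖P̃_θ(q)‖_{L²_α} ≤ C ‖q‖²_{W^{β,2}_2}`. -/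
theorem principal_value_operator_estimate (n : ℕ) (hn : 2 ≤ n) (β C₀ α : ℝ)
    (hβ : 0 ≤ β) (hC₀ : 1 < C₀) (χ : En n → ℝ) (hχ : IsCutoff C₀ χ)
    (hα : (((n : ℝ) - 3) / 2 < β ∧ β < ((n : ℝ) - 1) / 2 ∧
            α < 2 * β - ((n : ℝ) - 3) / 2) ∨
          (((n : ℝ) - 1) / 2 ≤ β ∧ α < β + 1)) :
    ∃ C : ℝ, 0 < C ∧ ∀ θ : En n, ‖θ‖ = 1 → ∀ q : 𝓢(En n, ℂ),
      ∃ P : En n → ℂ,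
        (∀ η : En n, ⟪η, θ⟫ < 0 →
          Filter.Tendsto
            (fun d : ℝ => ∫ r in {r : ℝ | 0 < r ∧ d < |1 - r|},
              ((1 - r)⁻¹ : ℝ) • Sop θ r ⇑q η)
            (nhdsWithin 0 (Set.Ioi 0)) (nhds (P η))) ∧
        L2w α (fun η => if ⟪η, θ⟫ < 0 then (χ η : ℝ) • P η else 0)
          ≤ C * sobNorm β 2 ⇑q ^ 2 := by
  obtain ⟨m, rfl⟩ : ∃ m, n = m + 1 := ⟨n - 1, by omega⟩
  push_cast at hα
  set α' := max α 0 with hα'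
  set μ := max 0 ((m:ℝ) - 2*β) with hμ
  have hgap : 0 < 2*β + 2 - μ - 2*α' := by
    rw [hα', hμ]
    rcases hα with ⟨h1, h2, h3⟩ | ⟨h1, h2⟩ <;>
    rcases max_cases α 0 with ⟨ha, _⟩ | ⟨ha, _⟩ <;>
    rcases max_cases 0 ((m:ℝ) - 2*β) with ⟨hb, _⟩ | ⟨hb, _⟩ <;> rw [ha, hb] <;> linarith
  obtain ⟨ε, hε, hε1, hε2⟩ : ∃ ε : ℝ, 0 < ε ∧ ε < 1/2 ∧ 5*ε ≤ 2*β + 2 - μ - 2*α' := by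
    refine ⟨min (1/4) ((2*β + 2 - μ - 2*α')/5), lt_min (by norm_num) (by positivity), (min_le_left _ _).trans_lt (by norm_num), ?_⟩
    have := min_le_right (1/4) ((2*β + 2 - μ - 2*α')/5)
    linarith
  obtain ⟨M, hM, hmain⟩ := main_m m α' β μ ε hε hε1 (le_max_right _ _) hβ (le_max_left _ _)
    (by have := le_max_right 0 ((m:ℝ) - 2*β); linarith) (by linarith)
  refine ⟨Real.sqrt M.toReal + 1, by positivity, ?_⟩
  intro θ hθ q
  obtain ⟨P, hP, hPn⟩ := hmain θ hθ q
  refine ⟨P, hP, ?_⟩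
  have hs0 : 0 ≤ sobNorm β 2 q ^ 2 := by positivity
  set A : Set (En (m+1)) := {η | ⟪η,θ⟫ < 0 ∧ 1 ≤ ‖η‖} with hA
  have mA : MeasurableSet A := by
    apply MeasurableSet.inter
    · exact (isOpen_lt (f := fun η : En (m+1) => (⟪η, θ⟫ : ℝ)) (g := fun _ => 0) (by fun_prop) (by fun_prop)).measurableSet
    · exact (isClosed_le (f := fun _ => 1) (g := fun η : En (m+1) => ‖η‖) (by fun_prop) (by fun_prop)).measurableSet
  have hInt0 : ∫ η : En (m+1), jap η ^ (2*α) * ‖(if ⟪η, θ⟫ < 0 then (χ η : ℝ) • P η else 0 : ℂ)‖^2 ≤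
      (M * ENNReal.ofReal (sobNorm β 2 q ^ 2)^2).toReal := by
    apply int_le_toReal
    · intro η
      exact mul_nonneg (Real.rpow_nonneg (jap_pos η).le _) (by positivity)
    · finiteness
    · refine le_trans ?_ hPn
      rw [← lintegral_indicator mA]
      apply lintegral_mono
      intro η
      beta_reduce
      by_cases hη : η ∈ A
      · rw [Set.indicator_of_mem hη, if_pos hη.1, ENNReal.ofReal_mul (Real.rpow_nonneg (jap_pos η).le _)]
        refine mul_le_mul' ?_ ?_
        · apply ENNReal.ofReal_le_ofReal
          apply Real.rpow_le_rpow_of_exponent_le (jap_ge_one η)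
          have := le_max_left α 0
          linarith
        · rw [← ofReal_norm, ← ENNReal.ofReal_pow (norm_nonneg _)]
          apply ENNReal.ofReal_le_ofReal
          refine pow_le_pow_left₀ (norm_nonneg _) ?_ 2
          have h5 := hχ.mem_Icc η
          rw [norm_smul, Real.norm_of_nonneg h5.1]
          exact mul_le_of_le_one_left (norm_nonneg _) h5.2
      · rw [Set.indicator_of_notMem hη]
        have : (if ⟪η, θ⟫ < 0 then (χ η : ℝ) • P η else 0 : ℂ) = 0 := by
          split_ifs with h6
          · have h7 : ‖η‖ < C₀ := by
              by_contra h8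
              exact hη ⟨h6, by linarith⟩
            rw [hχ.eq_zero η h7, zero_smul]
          · rfl
        rw [this]; simp
  unfold L2w
  rw [← Real.sqrt_eq_rpow]
  refine (Real.sqrt_le_sqrt hInt0).trans ?_
  rw [ENNReal.toReal_mul, ENNReal.toReal_pow, ENNReal.toReal_ofReal hs0, Real.sqrt_mul ENNReal.toReal_nonneg, Real.sqrt_sq hs0]
  gcongr
  linarith

end
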